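/- There exists N such that for every n ∈ 3ℤ with n ≥ N the following holds: if F_1, …, F_{n/3} are 3-uniform hypergraphs on a common vertex set of size n, and δ_1(F_i) > C(n−1, 2) − C(2n/3, 2) for every i ∈ [n/3], then the family {F_1, …, F_{n/3}} admits a rainbow matching. -/

import Mathlib

namespace RM

open Finset

open Classical in
/-- real valued indicator of a proposition -/
noncomputable def ind (p : Prop) : ℝ := if p then 1 else 0

lemma ind_true {p : Prop} (h : p) : ind p = 1 := by simp [ind, h]
lemma ind_false {p : Prop} (h : ¬ p) : ind p = 0 := by simp [ind, h]
lemma ind_nonneg (p : Prop) : 0 ≤ ind p := by unfold ind; split_ifs <;> norm_num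
lemma ind_le_one (p : Prop) : ind p ≤ 1 := by unfold ind; split_ifs <;> norm_num
lemma ind_mono {p q : Prop} (h : p → q) : ind p ≤ ind q := by
  by_cases hp : p
  · rw [ind_true hp, ind_true (h hp)]
  · rw [ind_false hp]; exact ind_nonneg q
lemma ind_congr {p q : Prop} (h : p ↔ q) : ind p = ind q := by rw [propext h]
lemma ind_and (p q : Prop) : ind (p ∧ q) = ind p * ind q := by
  by_cases hp : p <;> by_cases hq : q <;> simp [ind, hp, hq]
lemma ind_or_le (p q : Prop) : ind (p ∨ q) ≤ ind p + ind q := by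
  by_cases hp : p <;> by_cases hq : q <;> simp [ind, hp, hq]
lemma ind_not (p : Prop) : ind (¬ p) = 1 - ind p := by
  by_cases hp : p <;> simp [ind, hp]
lemma ind_pos {p : Prop} (h : 0 < ind p) : p := by
  by_contra hp; rw [ind_false hp] at h; exact lt_irrefl _ h
lemma ind_eq_one {p : Prop} (h : ind p = 1) : p := by
  apply ind_pos; rw [h]; norm_num

lemma sum_ind_eq {A : Type*} [Fintype A] (a : A) (g : A → ℝ) :
    ∑ x, ind (a = x) * g x = g a := by
  classical
  rw [Finset.sum_eq_single a]
  · rw [ind_true rfl, one_mul]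
  · intro b _ hb; rw [ind_false (fun h => hb h.symm), zero_mul]
  · intro h; exact absurd (Finset.mem_univ a) h

lemma sum_ind_eq' {A : Type*} [Fintype A] (a : A) (g : A → ℝ) :
    ∑ x, ind (x = a) * g x = g a := by
  rw [← sum_ind_eq a g]
  exact Finset.sum_congr rfl fun x _ => by rw [ind_congr eq_comm]

lemma one_sub_prod_le (r : Fin 4 → ℝ) (h0 : ∀ j, 0 ≤ r j) (h1 : ∀ j, r j ≤ 1) :
    1 - ∏ j, r j ≤ ∑ j, (1 - r j) := by
  rw [Fin.prod_univ_four, Fin.sum_univ_four]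
  have a1 : 1 - r 0 * r 1 ≤ (1 - r 0) + (1 - r 1) := by
    nlinarith [h1 0, h1 1]
  have p1 : 0 ≤ r 0 * r 1 := mul_nonneg (h0 0) (h0 1)
  have q1 : r 0 * r 1 ≤ 1 := mul_le_one₀ (h1 0) (h0 1) (h1 1)
  have a2 : 1 - r 0 * r 1 * r 2 ≤ (1 - r 0 * r 1) + (1 - r 2) := by
    nlinarith [h1 2]
  have q2 : r 0 * r 1 * r 2 ≤ 1 := mul_le_one₀ q1 (h0 2) (h1 2)
  have a3 : 1 - r 0 * r 1 * r 2 * r 3 ≤ (1 - r 0 * r 1 * r 2) + (1 - r 3) := by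
    nlinarith [h1 3]
  linarith

lemma prod_le_single (r : Fin 4 → ℝ) (h0 : ∀ j, 0 ≤ r j) (h1 : ∀ j, r j ≤ 1) (i : Fin 4) :
    ∏ j, r j ≤ r i := by
  classical
  rw [← Finset.mul_prod_erase Finset.univ r (Finset.mem_univ i)]
  have : ∏ j ∈ univ.erase i, r j ≤ 1 := Finset.prod_le_one (fun j _ => h0 j) (fun j _ => h1 j)
  exact mul_le_of_le_one_right (h0 i) this

/-- soft LP duality, by the minimax theorem -/
lemma lp_soft {E X : Type*} [Fintype E] [Fintype X] (ρ : E → Fin 4 → X) (b cap R : ℝ)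
    (hb : 0 ≤ b)
    (h : ∀ y : X → ℝ, (∀ x, 0 ≤ y x ∧ y x ≤ 1) →
      R ≤ cap * ∑ x, y x + b * ∑ e, max 0 (1 - ∑ j, y (ρ e j))) :
    ∃ W : E → ℝ, (∀ e, 0 ≤ W e ∧ W e ≤ b) ∧
      R ≤ ∑ e, W e - ∑ x, max 0 ((∑ e, ∑ j, ind (ρ e j = x) * W e) - cap) := by
  classical
  set f : (X → ℝ) → (E → ℝ) → ℝ := fun y W =>
    ∑ e, W e + ∑ x, y x * (cap - ∑ e, ∑ j, ind (ρ e j = x) * W e) with hf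
  have hfalt : ∀ y W, f y W = cap * ∑ x, y x + ∑ e, W e * (1 - ∑ j, y (ρ e j)) := by
    intro y W
    have : ∑ x, y x * (∑ e, ∑ j, ind (ρ e j = x) * W e) = ∑ e, W e * ∑ j, y (ρ e j) := by
      simp only [Finset.mul_sum]
      rw [Finset.sum_comm]
      refine Finset.sum_congr rfl fun e _ => ?_
      rw [Finset.sum_comm]
      refine Finset.sum_congr rfl fun j _ => ?_
      rw [← sum_ind_eq (ρ e j) y, Finset.mul_sum]
      exact Finset.sum_congr rfl fun x _ => by ring
    simp only [hf, mul_sub, Finset.sum_sub_distrib, this, mul_one]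
    have : ∑ x, y x * cap = cap * ∑ x, y x := by rw [← Finset.sum_mul, mul_comm]
    rw [this]; ring
  have hS := Sion.exists_isSaddlePointOn (X := Set.Icc (0 : X → ℝ) 1)
    (Y := Set.Icc (0 : E → ℝ) (fun _ => b)) (f := f)
    ⟨0, by simp⟩ (convex_Icc _ _) isCompact_Icc
    (by
      intro W _
      apply LowerSemicontinuous.lowerSemicontinuousOn
      apply Continuous.lowerSemicontinuous
      simp only [hf]; fun_prop)
    (by
      intro W _
      apply ConvexOn.quasiconvexOn
      refine ⟨convex_Icc _ _, ?_⟩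
      intro y _ y' _ s t _ _ hst
      apply le_of_eq
      simp only [hf, smul_eq_mul, Pi.add_apply, Pi.smul_apply, add_mul, Finset.sum_add_distrib,
        mul_add, Finset.mul_sum]
      have : ∑ e, W e = ∑ e, s * W e + ∑ e, t * W e := by
        rw [← Finset.mul_sum, ← Finset.mul_sum, ← add_mul, hst, one_mul]
      rw [this]
      have e1 : ∀ (s : ℝ) (y : X → ℝ), ∑ x, s * y x * (cap - ∑ e, ∑ j, ind (ρ e j = x) * W e)
        = ∑ x, s * (y x * (cap - ∑ e, ∑ j, ind (ρ e j = x) * W e)) :=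
        fun s y => Finset.sum_congr rfl fun x _ => by ring
      rw [e1, e1]; ring)
    (convex_Icc _ _) ⟨0, ⟨le_refl _, fun _ => hb⟩⟩ isCompact_Icc
    (by
      intro y _
      apply UpperSemicontinuous.upperSemicontinuousOn
      apply Continuous.upperSemicontinuous
      simp only [hf]; fun_prop)
    (by
      intro y _
      apply ConcaveOn.quasiconcaveOn
      refine ⟨convex_Icc _ _, ?_⟩
      intro W _ W' _ s t _ _ hst
      apply le_of_eq
      simp only [hfalt, smul_eq_mul, Pi.add_apply, Pi.smul_apply, add_mul, Finset.sum_add_distrib,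
        mul_add]
      have e1 : ∀ (s : ℝ) (W : E → ℝ), ∑ e, s * W e * (1 - ∑ j, y (ρ e j))
        = s * ∑ e, (W e * (1 - ∑ j, y (ρ e j))) :=
        fun s y => by rw [Finset.mul_sum]; exact Finset.sum_congr rfl fun x _ => by ring
      rw [e1, e1]
      have : cap * ∑ x, y x = (s + t) * (cap * ∑ x, y x) := by rw [hst, one_mul]
      linarith)
  obtain ⟨y, hy, W, hW, hsad⟩ := hS
  refine ⟨W, fun e => ⟨hW.1 e, hW.2 e⟩, ?_⟩
  -- best response
  have h1 := hsad (fun x => if cap < ∑ e, ∑ j, ind (ρ e j = x) * W e then 1 else 0)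
    ⟨fun x => by dsimp; split_ifs <;> norm_num, fun x => by dsimp; split_ifs <;> norm_num⟩
    (fun e => if 0 < 1 - ∑ j, y (ρ e j) then b else 0)
    ⟨fun x => by dsimp; split_ifs; exact hb; exact le_refl _,
     fun x => by dsimp; split_ifs; exact le_refl _; exact hb⟩
  have h2 : f y (fun e => if 0 < 1 - ∑ j, y (ρ e j) then b else 0)
      = cap * ∑ x, y x + b * ∑ e, max 0 (1 - ∑ j, y (ρ e j)) := by
    rw [hfalt, Finset.mul_sum (s := (univ : Finset E))]
    congr 1
    refine Finset.sum_congr rfl fun e _ => ?_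
    split_ifs with hh
    · rw [max_eq_right hh.le]
    · rw [max_eq_left (not_lt.mp hh)]; ring
  have h3 := h y (fun x => ⟨hy.1 x, hy.2 x⟩)
  rw [h2] at h1
  refine h3.trans (h1.trans (le_of_eq ?_))
  simp only [hf]
  rw [sub_eq_add_neg, ← Finset.sum_neg_distrib]
  congr 1
  refine Finset.sum_congr rfl fun x _ => ?_
  split_ifs with hh
  · rw [max_eq_right (by linarith)]; ring
  · rw [max_eq_left (by linarith)]; ring

lemma lp_dual {E X : Type*} [Fintype E] [Fintype X] (ρ : E → Fin 4 → X) (b cap R : ℝ)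
    (hb : 0 ≤ b) (hcap : 0 < cap)
    (h : ∀ y : X → ℝ, (∀ x, 0 ≤ y x ∧ y x ≤ 1) →
      R ≤ cap * ∑ x, y x + b * ∑ e, max 0 (1 - ∑ j, y (ρ e j))) :
    ∃ W : E → ℝ, (∀ e, 0 ≤ W e ∧ W e ≤ b) ∧
      (∀ x, ∑ e, ∑ j, ind (ρ e j = x) * W e ≤ cap) ∧ R ≤ ∑ e, W e := by
  obtain ⟨W, hW, hR⟩ := lp_soft ρ b cap R hb h
  set d : X → ℝ := fun x => ∑ e, ∑ j, ind (ρ e j = x) * W e with hd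
  set r : X → ℝ := fun x => cap / max cap (d x) with hr
  have hmax : ∀ x, 0 < max cap (d x) := fun x => lt_max_of_lt_left hcap
  have hr0 : ∀ x, 0 ≤ r x := fun x => div_nonneg hcap.le (hmax x).le
  have hr1 : ∀ x, r x ≤ 1 := fun x => (div_le_one (hmax x)).2 (le_max_left _ _)
  have hrd : ∀ x, d x * (1 - r x) = max 0 (d x - cap) := by
    intro x
    simp only [hr]
    rcases le_total (d x) cap with hh | hh
    · rw [max_eq_left hh, div_self hcap.ne', max_eq_left (by linarith)]; ring
    · rw [max_eq_right hh, max_eq_right (by linarith)]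
      have : d x ≠ 0 := by linarith
      field_simp
  have hrd2 : ∀ x, r x * d x ≤ cap := by
    intro x
    simp only [hr]
    rw [div_mul_eq_mul_div, div_le_iff₀ (hmax x)]
    exact mul_le_mul_of_nonneg_left (le_max_right _ _) hcap.le
  refine ⟨fun e => W e * ∏ j, r (ρ e j), fun e => ⟨?_, ?_⟩, fun x => ?_, ?_⟩
  · exact mul_nonneg (hW e).1 (Finset.prod_nonneg fun j _ => hr0 _)
  · exact (mul_le_of_le_one_right (hW e).1
      (Finset.prod_le_one (fun j _ => hr0 _) (fun j _ => hr1 _))).trans (hW e).2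
  · refine le_trans ?_ (hrd2 x)
    simp only [hd, Finset.mul_sum]
    refine Finset.sum_le_sum fun e _ => Finset.sum_le_sum fun j _ => ?_
    by_cases hx : ρ e j = x
    · rw [ind_true hx, one_mul, one_mul, mul_comm (r x)]
      have := prod_le_single (fun j => r (ρ e j)) (fun j => hr0 _) (fun j => hr1 _) j
      rw [← hx]
      exact mul_le_mul_of_nonneg_left this (hW e).1
    · rw [ind_false hx]; simp
  · refine hR.trans ?_
    have key : ∑ e, W e * (1 - ∏ j, r (ρ e j)) ≤ ∑ x, max 0 (d x - cap) := by
      calc ∑ e, W e * (1 - ∏ j, r (ρ e j)) ≤ ∑ e, W e * ∑ j, (1 - r (ρ e j)) :=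
            Finset.sum_le_sum fun e _ => mul_le_mul_of_nonneg_left
              (one_sub_prod_le _ (fun j => hr0 _) (fun j => hr1 _)) (hW e).1
        _ = ∑ x, d x * (1 - r x) := by
            simp only [hd, Finset.sum_mul, Finset.mul_sum]
            rw [Finset.sum_comm (s := (univ : Finset X))]
            refine Finset.sum_congr rfl fun e _ => ?_
            rw [Finset.sum_comm (s := (univ : Finset X))]
            refine Finset.sum_congr rfl fun j _ => ?_
            rw [← sum_ind_eq (ρ e j) (fun x => W e * (1 - r x))]
            exact Finset.sum_congr rfl fun x _ => by ring
        _ = _ := Finset.sum_congr rfl fun x _ => hrd x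
    have : ∑ e, W e * (1 - ∏ j, r (ρ e j)) = ∑ e, W e - ∑ e, W e * ∏ j, r (ρ e j) := by
      rw [← Finset.sum_sub_distrib]; exact Finset.sum_congr rfl fun e _ => by ring
    linarith

end RM

namespace RM
open Finset

/-- a matching of 4-tuples inside `Y` -/
def IsM {X : Type*} (E : (Fin 4 → X) → Prop) (Y : Finset X) (M : Finset (Fin 4 → X)) : Prop :=
  (∀ e ∈ M, E e) ∧ (∀ e ∈ M, ∀ j, e j ∈ Y) ∧
  (∀ e ∈ M, ∀ e' ∈ M, e ≠ e' → ∀ j j', e j ≠ e' j')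

lemma IsM.mono {X : Type*} {E : (Fin 4 → X) → Prop} {Y Y' : Finset X} {M : Finset (Fin 4 → X)}
    (h : IsM E Y M) (hY : Y ⊆ Y') : IsM E Y' M :=
  ⟨h.1, fun e he j => hY (h.2.1 e he j), h.2.2⟩

lemma IsM.empty {X : Type*} {E : (Fin 4 → X) → Prop} {Y : Finset X} : IsM E Y ∅ := by
  refine ⟨?_, ?_, ?_⟩ <;> simp

lemma IsM.insert {X : Type*} [DecidableEq X] {E : (Fin 4 → X) → Prop} {Y : Finset X}
    {M : Finset (Fin 4 → X)} {e : Fin 4 → X} (he : E e) (heY : ∀ j, e j ∈ Y)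
    (h : IsM E (Y \ univ.image e) M) : IsM E Y (insert e M) ∧ (insert e M).card = M.card + 1 := by
  have key : ∀ e' ∈ M, ∀ j j', e j ≠ e' j' := by
    intro e' he' j j' hh
    have := h.2.1 e' he' j'
    rw [Finset.mem_sdiff] at this
    exact this.2 (by rw [← hh]; exact Finset.mem_image_of_mem _ (Finset.mem_univ j))
  refine ⟨⟨?_, ?_, ?_⟩, ?_⟩
  · intro e' he'
    rcases Finset.mem_insert.1 he' with rfl | h'
    · exact he
    · exact h.1 _ h'
  · intro e' he'
    rcases Finset.mem_insert.1 he' with rfl | h'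
    · exact heY
    · exact fun j => (Finset.mem_sdiff.1 (h.2.1 _ h' j)).1
  · intro e1 h1 e2 h2 hne j j'
    rcases Finset.mem_insert.1 h1 with rfl | h1'
    · rcases Finset.mem_insert.1 h2 with rfl | h2'
      · exact absurd rfl hne
      · exact key _ h2' j j'
    · rcases Finset.mem_insert.1 h2 with rfl | h2'
      · exact fun hh => key _ h1' j' j hh.symm
      · exact h.2.2 _ h1' _ h2' hne j j'
  · rw [Finset.card_insert_of_notMem]
    intro hm
    exact key e hm 0 0 rfl

lemma card_pi_fix {X I : Type*} [DecidableEq X] [Fintype I] [DecidableEq I] (Y : Finset X)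
    (i : I) (x : X) (hx : x ∈ Y) :
    ∑ ψ ∈ Fintype.piFinset (fun _ : I => Y), ind (ψ i = x)
      = (Y.card : ℝ) ^ (Fintype.card I - 1) := by
  classical
  have h1 : ∑ ψ ∈ Fintype.piFinset (fun _ : I => Y), ind (ψ i = x)
      = (((Fintype.piFinset (fun _ : I => Y)).filter (fun ψ => ψ i = x)).card : ℝ) := by
    rw [Finset.card_filter]
    push_cast
    refine Finset.sum_congr rfl fun ψ _ => ?_
    unfold ind; congr
  have h2 : (Fintype.piFinset (fun _ : I => Y)).filter (fun ψ => ψ i = x)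
      = Fintype.piFinset (Function.update (fun _ : I => Y) i {x}) := by
    ext ψ
    simp only [Finset.mem_filter, Fintype.mem_piFinset]
    constructor
    · rintro ⟨h, hi⟩ j
      by_cases hj : j = i
      · subst hj; simp [hi]
      · simp [hj, h j]
    · intro h
      have hi := h i
      simp at hi
      refine ⟨fun j => ?_, hi⟩
      by_cases hj : j = i
      · subst hj; rw [hi]; exact hx
      · have := h j; simpa [hj] using this
  rw [h1, h2, Fintype.card_piFinset]
  rw [← Finset.mul_prod_erase Finset.univ _ (Finset.mem_univ i)]
  simp only [Function.update_self, Finset.card_singleton, one_mul]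
  rw [Finset.prod_congr rfl (g := fun _ => Y.card)]
  · rw [Finset.prod_const, Finset.card_erase_of_mem (Finset.mem_univ i), Finset.card_univ]
    push_cast; rfl
  · intro j hj
    rw [Function.update_of_ne (Finset.ne_of_mem_erase hj)]

lemma pow_shift (y t : ℝ) (k : ℕ) (ht : 0 ≤ t) (hy : t < y) :
    (y - t) ^ k * (1 + k * (t / y)) ≤ y ^ k := by
  have hy0 : 0 < y := by linarith
  have h0 : 0 ≤ t / y := div_nonneg ht hy0.le
  have h1 : 1 + k * (t / y) ≤ (1 + t / y) ^ k :=
    one_add_mul_le_pow (by linarith) k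
  calc (y - t) ^ k * (1 + k * (t / y)) ≤ (y - t) ^ k * (1 + t / y) ^ k :=
        mul_le_mul_of_nonneg_left h1 (pow_nonneg (by linarith) _)
    _ = ((y - t) * (1 + t / y)) ^ k := (mul_pow _ _ _).symm
    _ ≤ y ^ k := by
        apply pow_le_pow_left₀ (mul_nonneg (by linarith) (by linarith))
        have : (y - t) * (1 + t / y) = y - t * (t / y) := by field_simp; ring
        rw [this]; nlinarith [mul_nonneg ht h0]

section A1
variable {X I T : Type*} [DecidableEq X] [Fintype I] [DecidableEq I] [Fintype T]

/-- total weight -/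
noncomputable def Phi (f : (I → X) → T → ℝ) (Y : Finset X) : ℝ :=
  ∑ ψ ∈ Fintype.piFinset (fun _ : I => Y), ∑ τ, f ψ τ

lemma Phi_nonneg (f : (I → X) → T → ℝ) (hf : ∀ ψ τ, 0 ≤ f ψ τ) (Y : Finset X) : 0 ≤ Phi f Y :=
  Finset.sum_nonneg fun ψ _ => Finset.sum_nonneg fun τ _ => hf ψ τ

lemma Phi_loss (f : (I → X) → T → ℝ) (hf : ∀ ψ τ, 0 ≤ f ψ τ) (Y S : Finset X) :
    Phi f Y - Phi f (Y \ S) ≤ ∑ ψ ∈ Fintype.piFinset (fun _ : I => Y),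
      (∑ τ, f ψ τ) * ∑ i, ind (ψ i ∈ S) := by
  have h1 : ∀ ψ, 0 ≤ ∑ τ, f ψ τ := fun ψ => Finset.sum_nonneg fun τ _ => hf ψ τ
  have hsub : Fintype.piFinset (fun _ : I => Y \ S) ⊆ Fintype.piFinset (fun _ : I => Y) := by
    intro ψ hψ
    rw [Fintype.mem_piFinset] at hψ ⊢
    exact fun i => (Finset.mem_sdiff.1 (hψ i)).1
  unfold Phi
  rw [← Finset.sum_sdiff hsub, add_sub_cancel_right]
  refine le_trans ?_ (Finset.sum_le_sum_of_subset_of_nonneg (s :=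
    Fintype.piFinset (fun _ : I => Y) \ Fintype.piFinset (fun _ : I => Y \ S))
    Finset.sdiff_subset (fun ψ _ _ =>
      mul_nonneg (h1 ψ) (Finset.sum_nonneg fun i _ => ind_nonneg _)))
  refine Finset.sum_le_sum fun ψ hψ => ?_
  rw [Finset.mem_sdiff, Fintype.mem_piFinset, Fintype.mem_piFinset] at hψ
  obtain ⟨ha, hb⟩ := hψ
  push Not at hb
  obtain ⟨i, hi⟩ := hb
  have hiS : ψ i ∈ S := by
    by_contra hh; exact hi (Finset.mem_sdiff.2 ⟨ha i, hh⟩)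
  have : 1 ≤ ∑ i, ind (ψ i ∈ S) := by
    refine le_trans ?_ (Finset.single_le_sum (f := fun i => ind (ψ i ∈ S))
      (fun i _ => ind_nonneg _) (Finset.mem_univ i))
    rw [ind_true hiS]
  nlinarith [h1 ψ]

lemma sum_deg (ι : T → Fin 4 → I) (g : T → ℝ) (h : I → ℝ) :
    ∑ τ, ∑ j, h (ι τ j) * g τ = ∑ i, h i * ∑ τ, ∑ j, ind (ι τ j = i) * g τ := by
  simp only [Finset.mul_sum]
  rw [Finset.sum_comm (s := (univ : Finset I))]
  refine Finset.sum_congr rfl fun τ _ => ?_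
  rw [Finset.sum_comm (s := (univ : Finset I))]
  refine Finset.sum_congr rfl fun j _ => ?_
  rw [← sum_ind_eq (ι τ j) (fun i => h i * g τ)]
  exact Finset.sum_congr rfl fun i _ => by ring

lemma matching_lemma (E : (Fin 4 → X) → Prop) (hE : ∀ e, E e → Function.Injective e)
    (ι : T → Fin 4 → I) (f : (I → X) → T → ℝ) (hf : ∀ ψ τ, 0 ≤ f ψ τ)
    (hfE : ∀ ψ τ, f ψ τ ≠ 0 → E (fun j => ψ (ι τ j)))
    (hdeg : ∀ ψ i, ∑ τ, ∑ j, ind (ι τ j = i) * f ψ τ ≤ 1)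
    (hI : 0 < Fintype.card I) (y0 : ℕ) (hy0 : 5 ≤ y0) :
    ∀ (y : ℕ) (Y : Finset X), Y.card = y → ∃ M, IsM E Y M ∧
      Phi f Y ≤ (M.card + y0 + (5 * (Fintype.card I : ℝ) ^ 2 / y0) * y) *
        ((Fintype.card I : ℝ) * (y : ℝ) ^ (Fintype.card I - 1)) := by
  set K := Fintype.card I with hK
  set δ : ℝ := 5 * (K : ℝ) ^ 2 / y0 with hδ
  have hy0r : (5 : ℝ) ≤ y0 := by exact_mod_cast hy0
  have hδ0 : 0 ≤ δ := by positivity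
  have hK1 : (1 : ℝ) ≤ K := by exact_mod_cast hI
  have ha4 : ∀ ψ, 4 * ∑ τ, f ψ τ ≤ K := by
    intro ψ
    have := sum_deg ι (f ψ) (fun _ => 1)
    have h2 : ∑ τ, ∑ j : Fin 4, (1 : ℝ) * f ψ τ = 4 * ∑ τ, f ψ τ := by
      simp [Finset.mul_sum]
    rw [← h2, this]
    calc _ ≤ ∑ i : I, (1 : ℝ) := Finset.sum_le_sum fun i _ => by rw [one_mul]; exact hdeg ψ i
      _ = K := by simp [hK]
  have ha0 : ∀ ψ, 0 ≤ ∑ τ, f ψ τ := fun ψ => Finset.sum_nonneg fun τ _ => hf ψ τ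
  intro y
  induction y using Nat.strong_induction_on with
  | _ y ih =>
  intro Y hY
  set Q : ℝ := (K : ℝ) * (y : ℝ) ^ (K - 1) with hQ
  have hQ0 : 0 ≤ Q := by positivity
  -- Phi ≤ yQ/4
  have hPhi : Phi f Y ≤ y * Q / 4 := by
    have h1 : Phi f Y ≤ ∑ ψ ∈ Fintype.piFinset (fun _ : I => Y), (K : ℝ) / 4 :=
      Finset.sum_le_sum fun ψ _ => by linarith [ha4 ψ]
    rw [Finset.sum_const, nsmul_eq_mul, Fintype.card_piFinset] at h1
    simp only [Finset.prod_const, Finset.card_univ, hY, ← hK] at h1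
    have h2 : ((y ^ K : ℕ) : ℝ) = y * (y : ℝ) ^ (K - 1) := by
      push_cast
      rw [← pow_succ']; congr 1; omega
    rw [h2] at h1
    calc Phi f Y ≤ _ := h1
      _ = _ := by rw [hQ]; ring
  by_cases hyy : y < y0
  · refine ⟨∅, IsM.empty, ?_⟩
    have : (y : ℝ) ≤ y0 := by exact_mod_cast hyy.le
    have h3 : (0 : ℝ) ≤ δ * y := by positivity
    have h4 : (y : ℝ) * Q / 4 ≤ y0 * Q := by nlinarith
    simp only [Finset.card_empty, Nat.cast_zero, zero_add]
    nlinarith [mul_nonneg h3 hQ0]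
  push Not at hyy
  by_contra hcon
  push Not at hcon
  have hyr : (y0 : ℝ) ≤ y := by exact_mod_cast hyy
  have hy5 : (5 : ℝ) ≤ y := by linarith
  have hypos : (0 : ℝ) < y := by linarith
  have hQpos : 0 < Q := by positivity
  set Φ := Phi f Y with hΦ
  have hΦ0 : 0 ≤ Φ := Phi_nonneg f hf Y
  have hKs : ((K - 1 : ℕ) : ℝ) = K - 1 := by rw [Nat.cast_sub hI]; simp
  -- general step
  have step : ∀ (S : Finset X) (t g : ℕ), S ⊆ Y → S.card = t → 0 < t → t < y →
      (∀ M, IsM E (Y \ S) M → ∃ M', IsM E Y M' ∧ M'.card = M.card + g) →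
      g * Q + t * δ * Q + t * ((K - 1) / y * Φ) ≤
        (1 + t * ((K - 1) / y)) * (Φ - Phi f (Y \ S)) := by
    intro S t g hS hSt ht0 ht hM
    have hc : (Y \ S).card = y - t := by rw [Finset.card_sdiff_of_subset hS, hY, hSt]
    obtain ⟨M, hM1, hM2⟩ := ih (y - t) (by omega) (Y \ S) hc
    obtain ⟨M', hM'1, hM'2⟩ := hM M hM1
    have h1 := hcon M' hM'1
    rw [hM'2] at h1
    push_cast [Nat.cast_sub ht.le] at h1 hM2
    have htr : (t : ℝ) < y := by exact_mod_cast ht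
    have hps := pow_shift (y : ℝ) t (K - 1) (by positivity) htr
    rw [hKs] at hps
    set u : ℝ := 1 + ((K : ℝ) - 1) * (t / y) with hu
    have hu0 : 1 ≤ u := by
      have : 0 ≤ ((K : ℝ) - 1) * (t / y) := mul_nonneg (by linarith) (by positivity)
      linarith
    have hAnn : 0 ≤ (M.card : ℝ) + y0 + δ * (y - t) := by
      have : 0 ≤ δ * ((y : ℝ) - t) := mul_nonneg hδ0 (by linarith)
      positivity
    have h2 : Phi f (Y \ S) * u ≤ (M.card + y0 + δ * (y - t)) * Q := by
      calc Phi f (Y \ S) * u ≤ ((M.card + y0 + δ * (y - t)) * (K * ((y : ℝ) - t) ^ (K - 1))) * u :=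
            mul_le_mul_of_nonneg_right hM2 (by linarith)
        _ = (M.card + y0 + δ * (y - t)) * (K * (((y : ℝ) - t) ^ (K - 1) * u)) := by ring
        _ ≤ _ := by
          apply mul_le_mul_of_nonneg_left _ hAnn
          exact mul_le_mul_of_nonneg_left hps (by linarith)
    have h3 : (M.card + y0 + δ * (y - t)) * Q + g * Q + t * δ * Q ≤ Φ := by
      have : (M.card + y0 + δ * (y - t)) * Q + g * Q + t * δ * Q
        = (M.card + g + y0 + δ * y) * Q := by ring
      rw [this]; exact h1.le
    have hu2 : (1 + t * (((K : ℝ) - 1) / y)) = u := by rw [hu]; ring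
    rw [hu2]
    have hu3 : (t : ℝ) * (((K : ℝ) - 1) / y * Φ) = (u - 1) * Φ := by rw [hu]; ring
    rw [hu3]
    linarith
  set P := Fintype.piFinset (fun _ : I => Y) with hP
  have hPm : ∀ ψ ∈ P, ∀ i, ψ i ∈ Y := fun ψ h i => (Fintype.mem_piFinset.1 h) i
  set D : X → ℝ := fun x => Q - ∑ ψ ∈ P, ∑ τ, ∑ j, ind (ψ (ι τ j) = x) * f ψ τ with hD
  have hD0 : ∀ x ∈ Y, 0 ≤ D x := by
    intro x hx
    rw [hD, sub_nonneg]
    calc ∑ ψ ∈ P, ∑ τ, ∑ j, ind (ψ (ι τ j) = x) * f ψ τ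
        ≤ ∑ ψ ∈ P, ∑ i, ind (ψ i = x) := by
          refine Finset.sum_le_sum fun ψ _ => ?_
          rw [sum_deg ι (f ψ) (fun i => ind (ψ i = x))]
          exact Finset.sum_le_sum fun i _ =>
            mul_le_of_le_one_right (ind_nonneg _) (hdeg ψ i)
      _ = ∑ i : I, (y : ℝ) ^ (K - 1) := by
          rw [Finset.sum_comm]
          refine Finset.sum_congr rfl fun i _ => ?_
          rw [hP, card_pi_fix Y i x hx, hY]
      _ = Q := by rw [Finset.sum_const, Finset.card_univ, nsmul_eq_mul, hQ]
  have hDsum : ∑ x ∈ Y, D x = y * Q - 4 * Φ := by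
    simp only [hD]
    rw [Finset.sum_sub_distrib, Finset.sum_const, nsmul_eq_mul, hY, Finset.sum_comm]
    congr 1
    rw [hΦ]; unfold Phi
    rw [Finset.mul_sum]
    refine Finset.sum_congr rfl fun ψ hψ => ?_
    rw [Finset.sum_comm, Finset.mul_sum]
    refine Finset.sum_congr rfl fun τ _ => ?_
    rw [Finset.sum_comm]
    have : ∀ j : Fin 4, ∑ x ∈ Y, ind (ψ (ι τ j) = x) * f ψ τ = f ψ τ := by
      intro j
      rw [Finset.sum_eq_single (ψ (ι τ j))]
      · rw [ind_true rfl, one_mul]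
      · intro b _ hb; rw [ind_false (fun h => hb h.symm), zero_mul]
      · intro h; exact absurd (hPm ψ hψ _) h
    simp [this]
  -- losses
  set Le : (I → X) → T → ℝ := fun ψ τ => Φ - Phi f (Y \ univ.image (fun j => ψ (ι τ j))) with hLe
  set Lx : X → ℝ := fun x => Φ - Phi f (Y \ {x}) with hLx
  have hLpos : ∀ S, 0 ≤ Φ - Phi f (Y \ S) := by
    intro S
    rw [sub_nonneg]
    apply Finset.sum_le_sum_of_subset_of_nonneg
    · intro ψ hψ
      rw [Fintype.mem_piFinset] at hψ ⊢
      exact fun i => (Finset.mem_sdiff.1 (hψ i)).1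
    · exact fun ψ _ _ => ha0 ψ
  have se : ∀ ψ ∈ P, ∀ τ, f ψ τ * (Q + 4 * δ * Q + 4 * ((K - 1) / y * Φ)) ≤
      f ψ τ * ((1 + 4 * ((K - 1) / y)) * Le ψ τ) := by
    intro ψ hψ τ
    by_cases h0 : f ψ τ = 0
    · rw [h0]; simp
    apply mul_le_mul_of_nonneg_left _ (hf ψ τ)
    have hEe := hfE ψ τ h0
    have := step (univ.image (fun j => ψ (ι τ j))) 4 1
      (by
        intro x hx
        obtain ⟨j, _, rfl⟩ := Finset.mem_image.1 hx
        exact hPm ψ hψ _)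
      (by rw [Finset.card_image_of_injective _ (hE _ hEe)]; simp) (by norm_num) (by omega)
      (fun M hM => ⟨_, (IsM.insert hEe (fun j => hPm ψ hψ _) hM).1,
        (IsM.insert hEe (fun j => hPm ψ hψ _) hM).2⟩)
    push_cast at this
    rw [one_mul] at this
    exact this
  have sx : ∀ x ∈ Y, D x * (δ * Q + ((K - 1) / y * Φ)) ≤
      D x * ((1 + ((K - 1) / y)) * Lx x) := by
    intro x hx
    apply mul_le_mul_of_nonneg_left _ (hD0 x hx)
    have := step {x} 1 0 (by simpa using hx) (by simp) (by norm_num) (by omega)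
      (fun M hM => ⟨M, hM.mono Finset.sdiff_subset, rfl⟩)
    push_cast at this
    rw [one_mul, one_mul, one_mul, zero_mul, zero_add] at this
    exact this
  set L1 : ℝ := ∑ ψ ∈ P, ∑ τ, f ψ τ * Le ψ τ with hL1
  set L2 : ℝ := ∑ x ∈ Y, D x * Lx x with hL2
  have S1 : Φ * (Q + 4 * δ * Q + 4 * ((K - 1) / y * Φ)) ≤ (1 + 4 * ((K - 1) / y)) * L1 := by
    have hgen : ∀ c : ℝ, Φ * c = ∑ ψ ∈ P, ∑ τ, f ψ τ * c := by
      intro c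
      rw [hΦ]; unfold Phi
      rw [Finset.sum_mul]
      exact Finset.sum_congr rfl fun ψ _ => Finset.sum_mul _ _ _
    rw [hL1, Finset.mul_sum, hgen]
    refine Finset.sum_le_sum fun ψ hψ => ?_
    rw [Finset.mul_sum]
    refine Finset.sum_le_sum fun τ _ => ?_
    refine (se ψ hψ τ).trans (le_of_eq ?_)
    ring
  have S2 : (y * Q - 4 * Φ) * (δ * Q + ((K - 1) / y * Φ)) ≤ (1 + ((K - 1) / y)) * L2 := by
    rw [← hDsum, hL2, Finset.mul_sum, Finset.sum_mul]
    refine Finset.sum_le_sum fun x hx => ?_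
    refine (sx x hx).trans (le_of_eq ?_)
    ring
  have hLtot : L1 + L2 ≤ K * Q * Φ := by
    have b1 : L1 ≤ ∑ φ ∈ P, (∑ τ, f φ τ) * ∑ i, ∑ ψ ∈ P, ∑ τ, ∑ j,
        ind (ψ (ι τ j) = φ i) * f ψ τ := by
      have : ∀ ψ ∈ P, ∀ τ, f ψ τ * Le ψ τ ≤ ∑ φ ∈ P, (∑ τ, f φ τ) * ∑ i, ∑ j,
          ind (ψ (ι τ j) = φ i) * f ψ τ := by
        intro ψ _ τ
        calc f ψ τ * Le ψ τ ≤ f ψ τ * ∑ φ ∈ P, (∑ τ, f φ τ) * ∑ i, ∑ j, ind (ψ (ι τ j) = φ i) := by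
              apply mul_le_mul_of_nonneg_left _ (hf ψ τ)
              refine (Phi_loss f hf Y _).trans ?_
              refine Finset.sum_le_sum fun φ _ => mul_le_mul_of_nonneg_left ?_ (ha0 φ)
              refine Finset.sum_le_sum fun i _ => ?_
              by_cases hm : φ i ∈ univ.image (fun j => ψ (ι τ j))
              · obtain ⟨j, _, hj⟩ := Finset.mem_image.1 hm
                refine le_trans (ind_le_one _) ?_
                refine le_trans ?_ (Finset.single_le_sum (f := fun j => ind (ψ (ι τ j) = φ i))
                  (fun j _ => ind_nonneg _) (Finset.mem_univ j))
                rw [ind_true hj]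
              · rw [ind_false hm]
                exact Finset.sum_nonneg fun j _ => ind_nonneg _
          _ = _ := by
              rw [Finset.mul_sum]
              refine Finset.sum_congr rfl fun φ _ => ?_
              simp only [← Finset.sum_mul]
              ring
      calc L1 ≤ ∑ ψ ∈ P, ∑ τ, ∑ φ ∈ P, (∑ τ, f φ τ) * ∑ i, ∑ j,
          ind (ψ (ι τ j) = φ i) * f ψ τ :=
            Finset.sum_le_sum fun ψ hψ => Finset.sum_le_sum fun τ _ => this ψ hψ τ
        _ = _ := by
            have e1 : ∀ ψ ∈ P, ∑ τ, ∑ φ ∈ P, (∑ τ, f φ τ) * ∑ i, ∑ j,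
              ind (ψ (ι τ j) = φ i) * f ψ τ = ∑ φ ∈ P, (∑ τ, f φ τ) * ∑ i, ∑ τ, ∑ j,
              ind (ψ (ι τ j) = φ i) * f ψ τ := by
              intro ψ _
              rw [Finset.sum_comm]
              refine Finset.sum_congr rfl fun φ _ => ?_
              rw [← Finset.mul_sum, Finset.sum_comm]
            rw [Finset.sum_congr rfl e1, Finset.sum_comm]
            refine Finset.sum_congr rfl fun φ _ => ?_
            rw [← Finset.mul_sum, Finset.sum_comm]
    have b2 : L2 ≤ ∑ φ ∈ P, (∑ τ, f φ τ) * ∑ i, D (φ i) := by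
      calc L2 ≤ ∑ x ∈ Y, D x * ∑ φ ∈ P, (∑ τ, f φ τ) * ∑ i, ind (φ i = x) := by
            refine Finset.sum_le_sum fun x hx => mul_le_mul_of_nonneg_left ?_ (hD0 x hx)
            refine (Phi_loss f hf Y _).trans (le_of_eq ?_)
            simp only [Finset.mem_singleton]
            rfl
        _ = _ := by
            simp only [Finset.mul_sum]
            rw [Finset.sum_comm]
            refine Finset.sum_congr rfl fun φ hφ => ?_
            rw [Finset.sum_comm]
            refine Finset.sum_congr rfl fun i _ => ?_
            rw [Finset.sum_eq_single (φ i)]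
            · rw [ind_true rfl]; ring
            · intro b _ hb; rw [ind_false (fun h => hb h.symm)]; ring
            · intro h; exact absurd (hPm φ hφ _) h
    have b3 := add_le_add b1 b2
    refine b3.trans (le_of_eq ?_)
    rw [← Finset.sum_add_distrib, hΦ]
    unfold Phi
    rw [Finset.mul_sum]
    refine Finset.sum_congr rfl fun φ _ => ?_
    rw [← mul_add, ← Finset.sum_add_distrib]
    have : ∀ i, ∑ ψ ∈ P, ∑ τ, ∑ j, ind (ψ (ι τ j) = φ i) * f ψ τ + D (φ i) = Q := by
      intro i; simp only [hD]; ring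
    simp only [this]
    rw [Finset.sum_const, Finset.card_univ, nsmul_eq_mul, ← hK]
    ring
  have hL2pos : 0 ≤ L2 := Finset.sum_nonneg fun x hx => mul_nonneg (hD0 x hx) (hLpos _)
  -- final
  set r : ℝ := ((K : ℝ) - 1) / y with hr
  have hr0 : 0 ≤ r := div_nonneg (by linarith) hypos.le
  have hry : r * y = K - 1 := by rw [hr]; field_simp
  have fin1 : Φ * Q + y * δ * Q ^ 2 + (K - 1) * Φ * Q ≤ (1 + 4 * r) * (K * Q * Φ) := by
    have e1 : Φ * (Q + 4 * δ * Q + 4 * (r * Φ)) + (y * Q - 4 * Φ) * (δ * Q + (r * Φ))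
      = Φ * Q + y * δ * Q ^ 2 + (r * y) * Φ * Q := by ring
    rw [hry] at e1
    rw [← e1]
    have : (1 + r) * L2 ≤ (1 + 4 * r) * L2 := mul_le_mul_of_nonneg_right (by linarith) hL2pos
    have h5 : (1 + 4 * r) * (L1 + L2) ≤ (1 + 4 * r) * (K * Q * Φ) :=
      mul_le_mul_of_nonneg_left hLtot (by linarith)
    linarith
  have fin2 : y * δ * Q ^ 2 ≤ K * (K - 1) * Q ^ 2 := by
    have : 4 * r * (K * Q * Φ) ≤ 4 * r * (K * Q * (y * Q / 4)) := by
      apply mul_le_mul_of_nonneg_left _ (by linarith)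
      exact mul_le_mul_of_nonneg_left hPhi (by positivity)
    have e2 : 4 * r * (K * Q * (y * Q / 4)) = (r * y) * K * Q ^ 2 := by ring
    rw [e2, hry] at this
    nlinarith
  have fin3 : y * δ ≤ K * (K - 1) := le_of_mul_le_mul_right fin2 (by positivity)
  have fin4 : 5 * (K : ℝ) ^ 2 ≤ y * δ := by
    rw [hδ]
    rw [mul_div_assoc', le_div_iff₀ (by linarith)]
    nlinarith [sq_nonneg (K : ℝ)]
  nlinarith
end A1
end RM

namespace RM
open Finset

lemma pullback {X I A : Type*} [Fintype X] [DecidableEq X] [Fintype I] [DecidableEq I]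
    [Fintype A] [DecidableEq A] (κ : A → I) (hκ : Function.Injective κ) (g : (A → X) → ℝ) :
    (Fintype.card X : ℝ) ^ Fintype.card A * ∑ ψ : I → X, g (fun a => ψ (κ a))
      = (Fintype.card X : ℝ) ^ Fintype.card I * ∑ φ, g φ := by
  classical
  let e : A ⊕ ((Set.range κ)ᶜ : Set I) ≃ I :=
    (Equiv.sumCongr (Equiv.ofInjective κ hκ) (Equiv.refl _)).trans (Equiv.Set.sumCompl (Set.range κ))
  have he : ∀ a, e (Sum.inl a) = κ a := by intro a; rfl
  have hcard : Fintype.card I = Fintype.card A + Fintype.card ((Set.range κ)ᶜ : Set I) := by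
    rw [← Fintype.card_sum]; exact (Fintype.card_congr e).symm
  have h1 : ∑ ψ : I → X, g (fun a => ψ (κ a))
      = ∑ q : (A → X) × (((Set.range κ)ᶜ : Set I) → X), g q.1 := by
    symm
    apply Fintype.sum_equiv
      ((Equiv.sumArrowEquivProdArrow A ((Set.range κ)ᶜ : Set I) X).symm.trans
        (Equiv.arrowCongr e (Equiv.refl X)))
    intro q
    congr 1
    funext a
    simp [Equiv.arrowCongr, ← he]
    rfl
  rw [h1, Fintype.sum_prod_type, hcard, pow_add]
  simp only [Finset.sum_const, Finset.card_univ, Fintype.card_fun, nsmul_eq_mul]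
  rw [← Finset.mul_sum]
  push_cast
  ring

lemma sum_glue {X : Type*} [Fintype X] [DecidableEq X] (j : Fin 4) (x : X)
    (h : (Fin 4 → X) → ℝ) :
    ∑ φ : {k // k ≠ j} → X, h ((Equiv.funSplitAt j X).symm (x, φ))
      = ∑ ξ, ind (ξ j = x) * h ξ := by
  rw [← (Equiv.funSplitAt j X).symm.sum_comp, Fintype.sum_prod_type, Finset.sum_comm]
  refine Finset.sum_congr rfl fun φ _ => ?_
  have : ∀ x', ((Equiv.funSplitAt j X).symm (x', φ)) j = x' := by
    intro x'; simp [Equiv.funSplitAt]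
  simp only [this]
  rw [sum_ind_eq' x (fun x' => h ((Equiv.funSplitAt j X).symm (x', φ)))]

/-- index map -/
def iot (p : ℕ) (τ : ZMod p × ZMod p) (j : Fin 4) : Fin 4 × ZMod p :=
  (j, τ.1 + (j.val : ZMod p) * τ.2)

lemma iot_inj (p : ℕ) (τ : ZMod p × ZMod p) : Function.Injective (iot p τ) := by
  intro a b h; exact (Prod.ext_iff.1 h).1

lemma iot_cross (p : ℕ) [hp : Fact p.Prime] (hp5 : 5 ≤ p) (z b b' : ZMod p) (hb : b ≠ b')
    (j k k' : Fin 4) (hk : k ≠ j)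
    (h : iot p (z - (j.val : ZMod p) * b, b) k = iot p (z - (j.val : ZMod p) * b', b') k') :
    False := by
  have h1 : k = k' := (Prod.ext_iff.1 h).1
  have h2 := (Prod.ext_iff.1 h).2
  subst h1
  simp only [iot] at h2
  have h3 : ((k.val : ZMod p) - (j.val : ZMod p)) * (b - b') = 0 := by linear_combination h2
  rcases mul_eq_zero.1 h3 with h4 | h4
  · rw [sub_eq_zero] at h4
    rw [ZMod.natCast_eq_natCast_iff] at h4
    have := Nat.ModEq.eq_of_lt_of_lt h4 (by omega) (by omega)
    exact hk (Fin.ext this)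
  · exact hb (sub_eq_zero.1 h4)

section A2
variable {X : Type*} [Fintype X] [DecidableEq X]

/-- mean -/
noncomputable def mu (W : (Fin 4 → X) → ℝ) (j : Fin 4) (x : X) : ℝ :=
  ∑ ξ, ind (ξ j = x) * W ξ

lemma cross_zero (p : ℕ) [hp : Fact p.Prime] (hp5 : 5 ≤ p) (h : (Fin 4 → X) → ℝ)
    (hN : 0 < Fintype.card X)
    (j : Fin 4) (hh : ∀ x, ∑ ξ, ind (ξ j = x) * h ξ = 0) (z b b' : ZMod p) (hb : b ≠ b') :
    ∑ ψ : Fin 4 × ZMod p → X,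
      h (fun k => ψ (iot p (z - (j.val : ZMod p) * b, b) k)) *
      h (fun k => ψ (iot p (z - (j.val : ZMod p) * b', b') k)) = 0 := by
  let κ : Fin 4 ⊕ {k : Fin 4 // k ≠ j} → Fin 4 × ZMod p :=
    Sum.elim (iot p (z - (j.val : ZMod p) * b', b'))
      (fun k => iot p (z - (j.val : ZMod p) * b, b) k.1)
  have hκ : Function.Injective κ := by
    rintro (a | a) (c | c) hac
    · exact congrArg _ (iot_inj p _ hac)
    · exact (iot_cross p hp5 z b b' hb j c.1 a c.2 hac.symm).elim
    · exact (iot_cross p hp5 z b b' hb j a.1 c a.2 hac).elim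
    · exact congrArg _ (Subtype.ext (iot_inj p _ hac))
  let g : (Fin 4 ⊕ {k : Fin 4 // k ≠ j} → X) → ℝ := fun φ =>
    h ((Equiv.funSplitAt j X).symm (φ (Sum.inl j), fun k => φ (Sum.inr k))) *
    h (fun k => φ (Sum.inl k))
  have hpb := pullback κ hκ g
  have h1 : ∀ ψ : Fin 4 × ZMod p → X, g (fun a => ψ (κ a)) =
      h (fun k => ψ (iot p (z - (j.val : ZMod p) * b, b) k)) *
      h (fun k => ψ (iot p (z - (j.val : ZMod p) * b', b') k)) := by
    intro ψ
    simp only [g, κ, Sum.elim_inl, Sum.elim_inr]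
    congr 2
    rw [Equiv.symm_apply_eq]
    simp only [Equiv.funSplitAt, Equiv.piSplitAt, Equiv.coe_fn_mk]
    congr 2
    simp [iot]
  simp only [h1] at hpb
  have h2 : ∑ φ, g φ = 0 := by
    rw [← (Equiv.sumArrowEquivProdArrow (Fin 4) {k : Fin 4 // k ≠ j} X).symm.sum_comp,
      Fintype.sum_prod_type]
    apply Finset.sum_eq_zero
    intro φ1 _
    simp only [g]
    have : ∀ φ2 : {k : Fin 4 // k ≠ j} → X,
      h ((Equiv.funSplitAt j X).symm
        ((Equiv.sumArrowEquivProdArrow (Fin 4) {k : Fin 4 // k ≠ j} X).symm (φ1, φ2) (Sum.inl j),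
        fun k => (Equiv.sumArrowEquivProdArrow (Fin 4) {k : Fin 4 // k ≠ j} X).symm (φ1, φ2)
          (Sum.inr k))) *
      h (fun k => (Equiv.sumArrowEquivProdArrow (Fin 4) {k : Fin 4 // k ≠ j} X).symm (φ1, φ2)
          (Sum.inl k)) = h ((Equiv.funSplitAt j X).symm (φ1 j, φ2)) * h φ1 := by
      intro φ2; rfl
    simp only [this]
    rw [← Finset.sum_mul, sum_glue, hh, zero_mul]
  rw [h2, mul_zero] at hpb
  rcases mul_eq_zero.1 hpb with h3 | h3
  · exact absurd h3 (by positivity)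
  · exact h3

/-- normalized degree in the sampled structure -/
noncomputable def dg (p : ℕ) [NeZero p] (Wt : (Fin 4 → X) → ℝ) (ψ : Fin 4 × ZMod p → X)
    (i : Fin 4 × ZMod p) : ℝ :=
  (1 / p) * ∑ b : ZMod p, Wt (fun k => ψ (iot p (i.2 - (i.1.val : ZMod p) * b, b) k))

lemma second_moment (p : ℕ) [hp : Fact p.Prime] (hp5 : 5 ≤ p) (Wt : (Fin 4 → X) → ℝ)
    (m : X → ℝ) (B : ℝ)
    (hN : 0 < Fintype.card X) (i : Fin 4 × ZMod p)
    (hB : ∀ ξ, |Wt ξ - m (ξ i.1)| ≤ B)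
    (hm : ∀ x, ∑ ξ, ind (ξ i.1 = x) * (Wt ξ - m (ξ i.1)) = 0) :
    ∑ ψ : Fin 4 × ZMod p → X, (dg p Wt ψ i - m (ψ i)) ^ 2 ≤
      (Fintype.card X : ℝ) ^ (4 * p) * (B ^ 2 / p) := by
  have hp0 : (0 : ℝ) < p := by exact_mod_cast hp.out.pos
  obtain ⟨j, z⟩ := i
  simp only at hB hm
  set h : (Fin 4 → X) → ℝ := fun ξ => Wt ξ - m (ξ j) with hh
  have e1 : ∀ ψ : Fin 4 × ZMod p → X, dg p Wt ψ (j, z) - m (ψ (j, z)) =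
      (1 / p) * ∑ b : ZMod p, h (fun k => ψ (iot p (z - (j.val : ZMod p) * b, b) k)) := by
    intro ψ
    simp only [dg, hh, Finset.sum_sub_distrib, mul_sub]
    congr 1
    have : ∀ b : ZMod p, iot p (z - (j.val : ZMod p) * b, b) j = (j, z) := by
      intro b; simp [iot]
    simp only [this]
    rw [Finset.sum_const, Finset.card_univ, ZMod.card, nsmul_eq_mul]
    field_simp
  have e2 : ∀ ψ : Fin 4 × ZMod p → X, (dg p Wt ψ (j, z) - m (ψ (j, z))) ^ 2 =
      (1 / p) ^ 2 * ∑ b : ZMod p, ∑ b' : ZMod p,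
        h (fun k => ψ (iot p (z - (j.val : ZMod p) * b, b) k)) *
        h (fun k => ψ (iot p (z - (j.val : ZMod p) * b', b') k)) := by
    intro ψ
    rw [e1, mul_pow]
    congr 1
    rw [sq, Finset.sum_mul_sum]
  simp only [e2]
  rw [← Finset.mul_sum, Finset.sum_comm]
  have e3 : ∀ b : ZMod p, ∑ ψ : Fin 4 × ZMod p → X, ∑ b' : ZMod p,
        h (fun k => ψ (iot p (z - (j.val : ZMod p) * b, b) k)) *
        h (fun k => ψ (iot p (z - (j.val : ZMod p) * b', b') k)) ≤
        (Fintype.card X : ℝ) ^ (4 * p) * B ^ 2 := by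
    intro b
    rw [Finset.sum_comm, Finset.sum_eq_single b]
    · calc _ ≤ ∑ ψ : Fin 4 × ZMod p → X, B ^ 2 := by
            refine Finset.sum_le_sum fun ψ _ => ?_
            rw [← sq, ← sq_abs]
            exact pow_le_pow_left₀ (abs_nonneg _) (hB _) 2
        _ = _ := by
            rw [Finset.sum_const, Finset.card_univ, nsmul_eq_mul]
            simp [ZMod.card]
    · intro b' _ hb'
      exact cross_zero p hp5 h hN j hm z b b' hb'.symm
    · intro hb; exact absurd (Finset.mem_univ b) hb
  calc _ ≤ (1 / (p : ℝ)) ^ 2 * ∑ b : ZMod p, (Fintype.card X : ℝ) ^ (4 * p) * B ^ 2 :=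
        mul_le_mul_of_nonneg_left (Finset.sum_le_sum fun b _ => e3 b) (by positivity)
    _ = _ := by
        rw [Finset.sum_const, Finset.card_univ, ZMod.card, nsmul_eq_mul]
        field_simp

lemma sum_tau (p : ℕ) [hp : Fact p.Prime] (j : Fin 4) (z : ZMod p)
    (F : ZMod p × ZMod p → ℝ) :
    ∑ τ, ∑ j', ind (iot p τ j' = (j, z)) * F τ
      = ∑ b, F (z - (j.val : ZMod p) * b, b) := by
  have h1 : ∀ τ : ZMod p × ZMod p, ∑ j', ind (iot p τ j' = (j, z)) * F τ
      = ind (τ.1 = z - (j.val : ZMod p) * τ.2) * F τ := by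
    intro τ
    rw [Finset.sum_eq_single j]
    · congr 1
      apply ind_congr
      simp only [iot, Prod.mk.injEq, true_and]
      exact eq_sub_iff_add_eq.symm
    · intro j' _ hj'
      rw [ind_false, zero_mul]
      intro hh; exact hj' (Prod.ext_iff.1 hh).1
    · intro hh; exact absurd (Finset.mem_univ _) hh
  simp only [h1]
  rw [Fintype.sum_prod_type, Finset.sum_comm]
  refine Finset.sum_congr rfl fun b _ => ?_
  exact sum_ind_eq' (z - (j.val : ZMod p) * b) (fun a => F (a, b))

lemma sampling (E : (Fin 4 → X) → Prop) (hE : ∀ e, E e → Function.Injective e)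
    (hN : 0 < Fintype.card X)
    (W : (Fin 4 → X) → ℝ) (B : ℝ) (hB : 1 ≤ B) (hW0 : ∀ ξ, 0 ≤ W ξ)
    (hWB : ∀ ξ, (Fintype.card X : ℝ) ^ 3 * W ξ ≤ B)
    (hWE : ∀ ξ, W ξ ≠ 0 → E ξ) (hmu : ∀ j x, mu W j x ≤ 1)
    (p : ℕ) [hp : Fact p.Prime] (hp5 : 5 ≤ p) (η : ℝ) (hη : 0 < η) (y0 : ℕ) (hy0 : 5 ≤ y0) :
    ∃ M, IsM E univ M ∧
      (∑ ξ, W ξ - 4 * B ^ 3 * Fintype.card X / (p * η ^ 2)) / (4 * (1 + η)) ≤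
        M.card + y0 + 80 * (p : ℝ) ^ 2 / y0 * Fintype.card X := by
  classical
  set N : ℝ := (Fintype.card X : ℝ) with hNdef
  have hNpos : 0 < N := by rw [hNdef]; exact_mod_cast hN
  have hp0 : (0 : ℝ) < p := by exact_mod_cast hp.out.pos
  set Wt : (Fin 4 → X) → ℝ := fun ξ => N ^ 3 * W ξ with hWt
  have hWt0 : ∀ ξ, 0 ≤ Wt ξ := fun ξ => mul_nonneg (by positivity) (hW0 ξ)
  set G : (Fin 4 × ZMod p → X) → ZMod p × ZMod p → ℝ :=
    fun ψ τ => ∏ j, ind (dg p Wt ψ (iot p τ j) ≤ 1 + η) with hG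
  set f : (Fin 4 × ZMod p → X) → ZMod p × ZMod p → ℝ := fun ψ τ =>
    (1 / (p * (1 + η))) * (Wt (fun k => ψ (iot p τ k)) * G ψ τ) with hf
  have hG0 : ∀ ψ τ, 0 ≤ G ψ τ := fun ψ τ => Finset.prod_nonneg fun j _ => ind_nonneg _
  have hG1 : ∀ ψ τ j, G ψ τ ≤ ind (dg p Wt ψ (iot p τ j) ≤ 1 + η) := fun ψ τ j =>
    prod_le_single _ (fun j => ind_nonneg _) (fun j => ind_le_one _) j
  have hc0 : 0 < 1 / (p * (1 + η)) := by positivity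
  have hf0 : ∀ ψ τ, 0 ≤ f ψ τ := fun ψ τ =>
    mul_nonneg hc0.le (mul_nonneg (hWt0 _) (hG0 ψ τ))
  have hfE : ∀ ψ τ, f ψ τ ≠ 0 → E (fun j => ψ (iot p τ j)) := by
    intro ψ τ h
    apply hWE
    intro h0
    apply h
    simp [hf, hWt, h0]
  have hdeg : ∀ ψ i, ∑ τ, ∑ j, ind (iot p τ j = i) * f ψ τ ≤ 1 := by
    intro ψ i
    obtain ⟨j, z⟩ := i
    have hb : ∀ τ j', ind (iot p τ j' = (j, z)) * f ψ τ ≤ ind (iot p τ j' = (j, z)) *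
        ((1 / (p * (1 + η))) * (Wt (fun k => ψ (iot p τ k)) *
          ind (dg p Wt ψ (j, z) ≤ 1 + η))) := by
      intro τ j'
      by_cases h : iot p τ j' = (j, z)
      · rw [ind_true h, one_mul, one_mul]
        apply mul_le_mul_of_nonneg_left _ hc0.le
        apply mul_le_mul_of_nonneg_left _ (hWt0 _)
        rw [← h]; exact hG1 ψ τ j'
      · rw [ind_false h]; simp
    refine (Finset.sum_le_sum fun τ _ => Finset.sum_le_sum fun j' _ => hb τ j').trans ?_
    rw [sum_tau p j z]
    have : ∑ b : ZMod p, (1 / (p * (1 + η))) *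
        (Wt (fun k => ψ (iot p (z - (j.val : ZMod p) * b, b) k)) *
          ind (dg p Wt ψ (j, z) ≤ 1 + η)) =
        (1 / (1 + η)) * (dg p Wt ψ (j, z) * ind (dg p Wt ψ (j, z) ≤ 1 + η)) := by
      rw [← Finset.mul_sum, ← Finset.sum_mul]
      have hdg : ∑ b : ZMod p, Wt (fun k => ψ (iot p (z - (j.val : ZMod p) * b, b) k))
          = p * dg p Wt ψ (j, z) := by
        rw [dg]; field_simp
      rw [hdg]
      field_simp
    rw [this]
    by_cases h : dg p Wt ψ (j, z) ≤ 1 + η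
    · rw [ind_true h, mul_one, one_div, inv_mul_le_iff₀ (by positivity)]
      linarith
    · rw [ind_false h]; simp
  have hK : Fintype.card (Fin 4 × ZMod p) = 4 * p := by
    rw [Fintype.card_prod, ZMod.card, Fintype.card_fin]
  obtain ⟨M, hM, hPhi⟩ := matching_lemma E hE (iot p) f hf0 hfE hdeg (by rw [hK]; omega) y0 hy0
    _ univ rfl
  refine ⟨M, hM, ?_⟩
  rw [hK, Finset.card_univ, ← hNdef] at hPhi
  -- lower bound for Phi
  have hbad : ∀ i, ∑ ψ : Fin 4 × ZMod p → X, ind (¬ dg p Wt ψ i ≤ 1 + η) ≤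
      N ^ (4 * p) * (B ^ 2 / p) / η ^ 2 := by
    intro i
    have hmu0 : ∀ x, 0 ≤ mu W i.1 x := fun x =>
      Finset.sum_nonneg fun ξ _ => mul_nonneg (ind_nonneg _) (hW0 ξ)
    have h2 := second_moment p hp5 Wt (mu W i.1) B hN i
      (by
        intro ξ
        rw [abs_le]
        constructor
        · have := hmu i.1 (ξ i.1); have := hWt0 ξ; linarith
        · have := hmu0 (ξ i.1); have := hWB ξ; simp only [hWt]; linarith)
      (by
        intro x
        have a1 : ∀ ξ : Fin 4 → X, ind (ξ i.1 = x) * (Wt ξ - mu W i.1 (ξ i.1))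
          = N ^ 3 * (ind (ξ i.1 = x) * W ξ) - mu W i.1 x * ind (ξ i.1 = x) := by
          intro ξ
          by_cases h : ξ i.1 = x
          · rw [ind_true h, h, hWt]; ring
          · rw [ind_false h]; ring
        simp only [a1]
        rw [Finset.sum_sub_distrib, ← Finset.mul_sum, ← Finset.mul_sum]
        have a2 := sum_glue i.1 x (fun _ => (1 : ℝ))
        simp only [Finset.sum_const, mul_one, Finset.card_univ, nsmul_eq_mul,
          Fintype.card_fun] at a2
        rw [← a2]
        have a3 : Fintype.card {k : Fin 4 // k ≠ i.1} = 3 := by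
          rw [Fintype.card_subtype_compl]; simp
        rw [a3]
        push_cast
        rw [← hNdef]
        unfold mu
        ring)
    rw [le_div_iff₀ (by positivity), Finset.sum_mul]
    refine le_trans (Finset.sum_le_sum fun ψ _ => ?_) h2
    by_cases h : dg p Wt ψ i ≤ 1 + η
    · rw [ind_false (not_not.2 h), zero_mul]; positivity
    · rw [ind_true h, one_mul]
      apply pow_le_pow_left₀ hη.le
      have := hmu i.1 (ψ i); linarith
  have hfl : ∀ ψ τ, (1 / (p * (1 + η))) * (Wt (fun k => ψ (iot p τ k)) -
      B * ∑ j, ind (¬ dg p Wt ψ (iot p τ j) ≤ 1 + η)) ≤ f ψ τ := by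
    intro ψ τ
    apply mul_le_mul_of_nonneg_left _ hc0.le
    have h1 := one_sub_prod_le (fun j => ind (dg p Wt ψ (iot p τ j) ≤ 1 + η))
      (fun j => ind_nonneg _) (fun j => ind_le_one _)
    simp only [← ind_not] at h1
    have h2 : 0 ≤ ∑ j, ind (¬ dg p Wt ψ (iot p τ j) ≤ 1 + η) :=
      Finset.sum_nonneg fun j _ => ind_nonneg _
    have h3 : Wt (fun k => ψ (iot p τ k)) ≤ B := hWB _
    have h4 := hWt0 (fun k => ψ (iot p τ k))
    change 1 - G ψ τ ≤ _ at h1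
    nlinarith
  have hlow : (1 / (p * (1 + η))) * (p ^ 2 * (N ^ (4 * p - 1) * ∑ ξ, W ξ) -
      B * (p ^ 2 * (4 * (N ^ (4 * p) * (B ^ 2 / p) / η ^ 2)))) ≤ Phi f univ := by
    have hpi : Phi f univ = ∑ ψ, ∑ τ, f ψ τ := by
      unfold Phi; rw [Fintype.piFinset_univ]
    rw [hpi]
    refine le_trans ?_ (Finset.sum_le_sum fun ψ _ => Finset.sum_le_sum fun τ _ => hfl ψ τ)
    simp only [← Finset.mul_sum]
    apply mul_le_mul_of_nonneg_left _ hc0.le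
    simp only [Finset.sum_sub_distrib]
    have c1 : ∑ ψ : Fin 4 × ZMod p → X, ∑ τ, Wt (fun k => ψ (iot p τ k)) =
        p ^ 2 * (N ^ (4 * p - 1) * ∑ ξ, W ξ) := by
      rw [Finset.sum_comm]
      have : ∀ τ, ∑ ψ : Fin 4 × ZMod p → X, Wt (fun k => ψ (iot p τ k)) =
          N ^ (4 * p - 1) * ∑ ξ, W ξ := by
        intro τ
        have := pullback (X := X) (iot p τ) (iot_inj p τ) Wt
        rw [hK, Fintype.card_fin, ← hNdef] at this
        have h5 : N ^ (4 * p) = N * N ^ (4 * p - 1) := by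
          rw [← pow_succ']; congr 1; omega
        rw [h5] at this
        have h6 : ∑ φ, Wt φ = N ^ 3 * ∑ ξ, W ξ := by
          simp only [hWt]; rw [Finset.mul_sum]
        rw [h6] at this
        have h7 : N ^ 4 ≠ 0 := by positivity
        apply mul_left_cancel₀ h7
        rw [this]; ring
      simp only [this]
      rw [Finset.sum_const, Finset.card_univ, Fintype.card_prod, ZMod.card, nsmul_eq_mul]
      push_cast; ring
    have c2 : ∑ ψ : Fin 4 × ZMod p → X, ∑ τ, B * ∑ j, ind (¬ dg p Wt ψ (iot p τ j) ≤ 1 + η) ≤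
        B * (p ^ 2 * (4 * (N ^ (4 * p) * (B ^ 2 / p) / η ^ 2))) := by
      simp only [← Finset.mul_sum]
      apply mul_le_mul_of_nonneg_left _ (by linarith)
      rw [Finset.sum_comm]
      have : ∀ τ, ∑ ψ : Fin 4 × ZMod p → X, ∑ j, ind (¬ dg p Wt ψ (iot p τ j) ≤ 1 + η) ≤
          4 * (N ^ (4 * p) * (B ^ 2 / p) / η ^ 2) := by
        intro τ
        rw [Finset.sum_comm]
        refine (Finset.sum_le_sum fun j _ => hbad (iot p τ j)).trans (le_of_eq ?_)
        rw [Finset.sum_const, Finset.card_univ, Fintype.card_fin, nsmul_eq_mul]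
        norm_num
      refine (Finset.sum_le_sum fun τ _ => this τ).trans (le_of_eq ?_)
      rw [Finset.sum_const, Finset.card_univ, Fintype.card_prod, ZMod.card, nsmul_eq_mul]
      push_cast; ring
    simp only [← Finset.mul_sum] at c1 c2 ⊢
    linarith
  have htot := hlow.trans hPhi
  have h5 : N ^ (4 * p) = N * N ^ (4 * p - 1) := by
    rw [← pow_succ']; congr 1; omega
  rw [h5] at htot
  set Z := N ^ (4 * p - 1) with hZ
  have hZ0 : 0 < Z := by positivity
  have hpZ : 0 < 4 * p * Z := by positivity
  apply le_of_mul_le_mul_right _ hpZ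
  calc _ = (1 / (p * (1 + η))) * (p ^ 2 * (Z * ∑ ξ, W ξ) -
      B * (p ^ 2 * (4 * (N * Z * (B ^ 2 / p) / η ^ 2)))) := by
        field_simp
    _ ≤ _ := htot
    _ = _ := by push_cast; ring

/-- consequence with constants packaged -/
lemma sampling' (B ε : ℝ) (hB : 1 ≤ B) (hε : 0 < ε) : ∃ C : ℝ, 0 ≤ C ∧
    ∀ (X : Type) [Fintype X] [DecidableEq X] (E : (Fin 4 → X) → Prop)
      (_ : ∀ e, E e → Function.Injective e) (_ : 0 < Fintype.card X)
      (W : (Fin 4 → X) → ℝ) (_ : ∀ ξ, 0 ≤ W ξ)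
      (_ : ∀ ξ, (Fintype.card X : ℝ) ^ 3 * W ξ ≤ B)
      (_ : ∀ ξ, W ξ ≠ 0 → E ξ) (_ : ∀ j x, mu W j x ≤ 1),
      ∃ M, IsM E univ M ∧ ∑ ξ, W ξ ≤ 4 * M.card + ε * Fintype.card X + C := by
  set η := ε / 3 with hη
  have hη0 : 0 < η := by positivity
  obtain ⟨p, hp1, hpp⟩ := Nat.exists_infinite_primes (max 5 ⌈12 * B ^ 3 / (ε * η ^ 2)⌉₊)
  have : Fact p.Prime := ⟨hpp⟩
  have hp5 : 5 ≤ p := (le_max_left _ _).trans hp1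
  have hpb : 12 * B ^ 3 / (ε * η ^ 2) ≤ p :=
    (Nat.le_ceil _).trans (by exact_mod_cast (le_max_right _ _).trans hp1)
  have hp0 : (0 : ℝ) < p := by exact_mod_cast hpp.pos
  set q : ℝ := 80 * (p : ℝ) ^ 2 with hq
  obtain ⟨y0, hy0⟩ := exists_nat_ge (max 5 (q * 4 * (1 + η) * 3 / ε))
  have hy5 : (5 : ℝ) ≤ y0 := (le_max_left _ _).trans hy0
  have hyb : q * 4 * (1 + η) * 3 / ε ≤ y0 := (le_max_right _ _).trans hy0
  refine ⟨4 * (1 + η) * y0, by positivity, ?_⟩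
  intro X _ _ E hE hN W hW0 hWB hWE hmu
  obtain ⟨M, hM, hb⟩ := sampling E hE hN W B hB hW0 hWB hWE hmu p hp5 η hη0 y0
    (by exact_mod_cast hy5)
  refine ⟨M, hM, ?_⟩
  set N : ℝ := (Fintype.card X : ℝ) with hNd
  have hN0 : 0 ≤ N := by positivity
  have hM4 : 4 * (M.card : ℝ) ≤ N := by
    have h1 : (M.biUnion (fun e => univ.image e)).card = 4 * M.card := by
      rw [Finset.card_biUnion]
      · rw [Finset.sum_congr rfl (g := fun _ => 4)]
        · simp; ring
        · intro e he
          rw [Finset.card_image_of_injective _ (hE _ (hM.1 e he))]; simp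
      · intro e he e' he' hne
        rw [Function.onFun, Finset.disjoint_left]
        intro x hx hx'
        obtain ⟨j, _, rfl⟩ := Finset.mem_image.1 hx
        obtain ⟨j', _, hj⟩ := Finset.mem_image.1 hx'
        exact hM.2.2 e he e' he' hne j j' hj.symm
    have h2 := Finset.card_le_univ (M.biUnion (fun e => univ.image e))
    rw [h1] at h2
    rw [hNd]; exact_mod_cast h2
  rw [div_le_iff₀ (by positivity)] at hb
  have b1 : 4 * B ^ 3 * N / (p * η ^ 2) ≤ ε / 3 * N := by
    rw [div_le_iff₀ (by positivity)]
    rw [div_le_iff₀ (by positivity)] at hpb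
    nlinarith
  have b2 : q / y0 * N * (4 * (1 + η)) ≤ ε / 3 * N := by
    have : q / y0 * (4 * (1 + η)) ≤ ε / 3 := by
      rw [div_le_iff₀ hε] at hyb
      rw [div_mul_eq_mul_div, div_le_iff₀ (by linarith)]
      linarith
    nlinarith
  have b3 : 4 * η * M.card ≤ ε / 3 * N := by rw [hη]; nlinarith
  nlinarith
end A2
end RM

namespace RM
open Finset

lemma num_pair (A h ε : ℝ) (hε : 0 ≤ ε) (hh : 0 ≤ h) (hA : A ≤ 1)
    (h1 : A ^ 2 - h ^ 2 ≤ 4 / 9 + 2 * ε) : A ≤ 2 / 3 + 23 / 50 * h + 2 * ε := by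
  by_contra hc
  push Not at hc
  have h2 : h ≤ 0.725 := by linarith
  have h3 : (2 / 3 + 23 / 50 * h + 2 * ε) ^ 2 ≤ A ^ 2 := by
    apply pow_le_pow_left₀ (by positivity) hc.le
  nlinarith [mul_nonneg hh hε, mul_nonneg hh (by linarith : (0:ℝ) ≤ 0.725 - h)]

lemma sum_ind_card {A : Type*} (s : Finset A) (p : A → Prop) [DecidablePred p] :
    ∑ x ∈ s, ind (p x) = ((s.filter p).card : ℝ) := by
  rw [Finset.card_filter]; push_cast
  refine Finset.sum_congr rfl fun x _ => ?_
  unfold ind; congr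

lemma sumj_hi (J k : ℕ) (hk : 1 ≤ k) (hk2 : k ≤ 2 * J) :
    ∑ j ∈ Icc 1 J, ind (2 * J < k + j) = ((k - J : ℕ) : ℝ) := by
  rw [sum_ind_card]
  have : (Icc 1 J).filter (fun j => 2 * J < k + j) = Icc (2 * J + 1 - k) J := by
    ext j; simp only [mem_filter, mem_Icc]; omega
  rw [this, Nat.card_Icc]; congr 1; omega

lemma sumj_lo (J k : ℕ) (hk : 1 ≤ k) :
    ∑ j ∈ Icc 1 J, ind (k < j) = ((J - k : ℕ) : ℝ) := by
  rw [sum_ind_card]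
  have : (Icc 1 J).filter (fun j => k < j) = Icc (k + 1) J := by
    ext j; simp only [mem_filter, mem_Icc]; omega
  rw [this, Nat.card_Icc]; congr 1; omega

lemma pair_lemma {V : Type*} [Fintype V] (hV : 0 < Fintype.card V) (G : V → V → Prop)
    (u : V → ℝ) (hu : ∀ x, 0 ≤ u x ∧ u x ≤ 1) (ε : ℝ) (hε : 0 < ε) (J : ℕ) (hJ : 1 ≤ ε * J)
    (hdeg : (5 / 9 - ε) * (Fintype.card V : ℝ) ^ 2 ≤ ∑ x, ∑ y, ind (G x y))
    (hsum : ∑ x, u x ≤ (Fintype.card V : ℝ) / 3)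
    (hσ : ∑ x, ∑ y, ind (G x y) * max 0 (1 - u x - u y) ≤
      ε / (2 * J) * (Fintype.card V : ℝ) ^ 2) :
    ∃ S : V → Prop, ∑ x, ind (S x) ≤ (1 / 3 + 39 * ε) * (Fintype.card V : ℝ) ∧
      ∑ x, ind (¬ S x) * u x ≤ 38 * ε * (Fintype.card V : ℝ) ∧
      (1 / 3 - 3 * ε) * (Fintype.card V : ℝ) ≤ ∑ x, u x := by
  set n : ℝ := (Fintype.card V : ℝ) with hn
  have hn0 : 0 < n := by rw [hn]; exact_mod_cast hV
  have hJ0 : 0 < J := by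
    rcases Nat.eq_zero_or_pos J with h | h
    · rw [h] at hJ; norm_num at hJ
    · exact h
  have hJr : (0 : ℝ) < J := by exact_mod_cast hJ0
  set k : V → ℕ := fun x => min (2 * J) (⌊2 * J * u x⌋₊ + 1) with hk
  have hk1 : ∀ x, 1 ≤ k x := fun x => le_min (by omega) (by omega)
  have hk2 : ∀ x, k x ≤ 2 * J := fun x => min_le_left _ _
  have hku : ∀ x, 2 * J * u x ≤ k x := by
    intro x
    simp only [hk]
    push_cast
    apply le_min
    · have := (hu x).2; nlinarith
    · exact (Nat.lt_floor_add_one _).le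
  have hku2 : ∀ x, (k x : ℝ) ≤ 2 * J * u x + 1 := by
    intro x
    simp only [hk]
    push_cast
    refine (min_le_right _ _).trans ?_
    have := Nat.floor_le (a := 2 * J * u x) (by have := (hu x).1; positivity)
    linarith
  -- number of pairs with small sum
  have hpairs : ∑ x, ∑ y, ind (k x + k y < 2 * J) ≤ (4 / 9 + 2 * ε) * n ^ 2 := by
    have h1 : ∀ x y, ind (k x + k y < 2 * J) ≤
        (2 * J) * (ind (G x y) * max 0 (1 - u x - u y)) + (1 - ind (G x y)) := by
      intro x y
      by_cases hg : G x y
      · rw [ind_true hg]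
        by_cases hs : k x + k y < 2 * J
        · rw [ind_true hs]
          have a1 : (k x : ℝ) + k y ≤ 2 * J - 1 := by
            have : k x + k y + 1 ≤ 2 * J := hs
            have : (k x : ℝ) + k y + 1 ≤ 2 * J := by exact_mod_cast this
            linarith
          have a2 : 1 ≤ (2 * J) * (1 - u x - u y) := by
            have := hku x; have := hku y; linarith
          have a3 : (2 * J) * (1 - u x - u y) ≤ (2 * J) * max 0 (1 - u x - u y) :=
            mul_le_mul_of_nonneg_left (le_max_right _ _) (by positivity)
          linarith
        · rw [ind_false hs]
          have : 0 ≤ max 0 (1 - u x - u y) := le_max_left _ _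
          have : 0 ≤ (2 * J) * (1 * max 0 (1 - u x - u y)) := by positivity
          linarith
      · rw [ind_false hg]
        have := ind_le_one (k x + k y < 2 * J)
        linarith
    calc _ ≤ ∑ x, ∑ y, ((2 * J) * (ind (G x y) * max 0 (1 - u x - u y)) + (1 - ind (G x y))) :=
          Finset.sum_le_sum fun x _ => Finset.sum_le_sum fun y _ => h1 x y
      _ = (2 * J) * ∑ x, ∑ y, (ind (G x y) * max 0 (1 - u x - u y)) +
          (n ^ 2 - ∑ x, ∑ y, ind (G x y)) := by
          simp only [Finset.sum_add_distrib, Finset.sum_sub_distrib, ← Finset.mul_sum]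
          simp [sq, hn]
      _ ≤ _ := by
          have : (2 * J) * ∑ x, ∑ y, (ind (G x y) * max 0 (1 - u x - u y)) ≤
            (2 * J) * (ε / (2 * J) * n ^ 2) := mul_le_mul_of_nonneg_left hσ (by positivity)
          have e : (2 * J) * (ε / (2 * J) * n ^ 2) = ε * n ^ 2 := by field_simp
          rw [e] at this
          linarith
  -- level inequality
  have hlev : ∀ j ∈ Icc 1 J, (1 / 3 - 2 * ε) * n ≤
      ∑ x, (ind (2 * J < k x + j) + 23 / 50 * (1 - ind (k x < j) - ind (2 * J < k x + j))) := by
    intro j hj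
    rw [mem_Icc] at hj
    set H : ℝ := ∑ x, (1 - ind (2 * J < k x + j)) with hH
    set D : ℝ := ∑ x, (1 - ind (k x < j) - ind (2 * J < k x + j)) with hD
    have hpt : ∀ x y, (1 - ind (2 * J < k x + j)) * (1 - ind (2 * J < k y + j)) -
        (1 - ind (k x < j) - ind (2 * J < k x + j)) *
        (1 - ind (k y < j) - ind (2 * J < k y + j)) ≤ ind (k x + k y < 2 * J) := by
      intro x y
      by_cases a : 2 * J < k x + j
      · have a' : ¬ k x < j := by omega
        rw [ind_true a, ind_false a']; simp [ind_nonneg]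
      by_cases b : 2 * J < k y + j
      · have b' : ¬ k y < j := by omega
        rw [ind_true b, ind_false b']; simp [ind_nonneg]
      rw [ind_false a, ind_false b]
      by_cases c : k x < j
      · rw [ind_true c, ind_true (p := k x + k y < 2 * J) (by omega)]; simp
      by_cases d : k y < j
      · rw [ind_true d, ind_true (p := k x + k y < 2 * J) (by omega)]; simp
      rw [ind_false c, ind_false d]; simp [ind_nonneg]
    have hsq : H ^ 2 - D ^ 2 ≤ (4 / 9 + 2 * ε) * n ^ 2 := by
      refine le_trans ?_ hpairs
      rw [hH, hD, sq, sq, Finset.sum_mul_sum, Finset.sum_mul_sum, ← Finset.sum_sub_distrib]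
      simp only [← Finset.sum_sub_distrib]
      exact Finset.sum_le_sum fun x _ => Finset.sum_le_sum fun y _ => hpt x y
    have hD0 : 0 ≤ D := Finset.sum_nonneg fun x _ => by
      by_cases c : k x < j
      · rw [ind_true c, ind_false (by omega)]; simp
      · rw [ind_false c]; have := ind_le_one (2 * J < k x + j); linarith
    have hHn : H ≤ n := by
      calc H ≤ ∑ x : V, (1 : ℝ) := Finset.sum_le_sum fun x _ => by
            have := ind_nonneg (2 * J < k x + j); linarith
        _ = n := by simp [hn]
    have hfin := num_pair (H / n) (D / n) ε hε.le (by positivity) ((div_le_one hn0).2 hHn) (by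
      rw [div_pow, div_pow, ← sub_div, div_le_iff₀ (by positivity)]; exact hsq)
    have e1 : ∑ x, (ind (2 * J < k x + j) + 23 / 50 *
        (1 - ind (k x < j) - ind (2 * J < k x + j))) = (n - H) + 23 / 50 * D := by
      rw [Finset.sum_add_distrib, ← Finset.mul_sum, hH, Finset.sum_sub_distrib]
      simp [hn, hD]
    rw [e1]
    have e2 : H = H / n * n := by field_simp
    have e3 : D = D / n * n := by field_simp
    rw [e2, e3]
    have := mul_le_mul_of_nonneg_right hfin hn0.le
    linarith
  -- sum over j
  have hmin : ∀ x, ∑ j ∈ Icc 1 J, (ind (2 * J < k x + j) +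
      23 / 50 * (1 - ind (k x < j) - ind (2 * J < k x + j))) =
      (k x : ℝ) / 2 - 1 / 25 * min (k x : ℝ) (2 * J - k x) := by
    intro x
    simp only [Finset.sum_add_distrib, ← Finset.mul_sum, Finset.sum_sub_distrib]
    rw [sumj_hi J (k x) (hk1 x) (hk2 x), sumj_lo J (k x) (hk1 x)]
    simp only [Finset.sum_const, Nat.card_Icc, Nat.add_sub_cancel, nsmul_eq_mul, mul_one]
    rcases le_total (k x) J with h | h
    · have h' : (k x : ℝ) ≤ J := by exact_mod_cast h
      rw [Nat.sub_eq_zero_of_le h, Nat.cast_sub h, min_eq_left (by linarith)]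
      push_cast; ring
    · have h' : (J : ℝ) ≤ k x := by exact_mod_cast h
      rw [Nat.sub_eq_zero_of_le h, Nat.cast_sub h, min_eq_right (by linarith)]
      push_cast; ring
  have htot : J * ((1 / 3 - 2 * ε) * n) ≤
      ∑ x, ((k x : ℝ) / 2 - 1 / 25 * min (k x : ℝ) (2 * J - k x)) := by
    calc J * ((1 / 3 - 2 * ε) * n) = ∑ j ∈ Icc 1 J, (1 / 3 - 2 * ε) * n := by
          rw [Finset.sum_const, Nat.card_Icc, nsmul_eq_mul, Nat.add_sub_cancel]
      _ ≤ _ := Finset.sum_le_sum hlev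
      _ = _ := by
          rw [Finset.sum_comm]
          exact Finset.sum_congr rfl fun x _ => hmin x
  rw [Finset.sum_sub_distrib, ← Finset.sum_div, ← Finset.mul_sum] at htot
  set SK : ℝ := ∑ x, (k x : ℝ) with hSK
  set SM : ℝ := ∑ x, min (k x : ℝ) (2 * J - k x) with hSM
  set SU : ℝ := ∑ x, u x with hSU
  have hSM0 : 0 ≤ SM := Finset.sum_nonneg fun x _ => le_min (by positivity) (by
    have : (k x : ℝ) ≤ 2 * J := by exact_mod_cast hk2 x
    linarith)
  have hSKU : SK ≤ 2 * J * SU + n := by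
    calc SK ≤ ∑ x, (2 * J * u x + 1) := Finset.sum_le_sum fun x _ => hku2 x
      _ = _ := by rw [Finset.sum_add_distrib, ← Finset.mul_sum, ← hSU]; simp [hn]
  have hn1 : n ≤ ε * J * n := by
    have := mul_le_mul_of_nonneg_right hJ hn0.le
    linarith
  have hJU : J * SU ≤ J * (n / 3) := mul_le_mul_of_nonneg_left hsum hJr.le
  have hpJ : 0 ≤ ε * J * n := by positivity
  have hSMle : SM ≤ 2 * J * (38 * ε * n) := by linarith
  have hSKle : SK ≤ 2 * J * (n / 3) + ε * J * n := by linarith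
  refine ⟨fun x => J < k x, ?_, ?_, ?_⟩
  · have : ∀ x, 2 * J * ind (J < k x) ≤ k x + min (k x : ℝ) (2 * J - k x) := by
      intro x
      by_cases h : J < k x
      · have h' : (J : ℝ) ≤ k x := by exact_mod_cast h.le
        rw [ind_true h, min_eq_right (by linarith)]; linarith
      · have h' : (k x : ℝ) ≤ J := by exact_mod_cast (not_lt.1 h)
        rw [ind_false h, min_eq_left (by linarith)]
        have : (0 : ℝ) ≤ k x := by positivity
        linarith
    have h2 := Finset.sum_le_sum fun x (_ : x ∈ univ) => this x
    rw [← Finset.mul_sum, Finset.sum_add_distrib] at h2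
    have h3 : 2 * J * ∑ x, ind (J < k x) ≤ 2 * J * ((1 / 3 + 39 * ε) * n) := by
      refine h2.trans ?_
      have hSM2 : SM ≤ 2 * J * (37 * ε * n) := by linarith
      linarith
    exact le_of_mul_le_mul_left h3 (by positivity)
  · have : ∀ x, 2 * J * (ind (¬ J < k x) * u x) ≤ min (k x : ℝ) (2 * J - k x) := by
      intro x
      by_cases h : J < k x
      · rw [ind_false (not_not.2 h), zero_mul, mul_zero]
        have : (k x : ℝ) ≤ 2 * J := by exact_mod_cast hk2 x
        exact le_min (by positivity) (by linarith)
      · have h' : (k x : ℝ) ≤ J := by exact_mod_cast (not_lt.1 h)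
        rw [ind_true h, min_eq_left (by linarith), one_mul]
        exact hku x
    have h2 := Finset.sum_le_sum fun x (_ : x ∈ univ) => this x
    rw [← Finset.mul_sum] at h2
    exact le_of_mul_le_mul_left (h2.trans hSMle) (by positivity)
  · have h3 : 2 * J * ((1 / 3 - 3 * ε) * n) ≤ 2 * J * SU := by linarith
    exact le_of_mul_le_mul_left h3 (by positivity)

lemma sum4 {C V : Type*} [Fintype C] [Fintype V] (g : C → V → V → V → ℝ) (a : C → ℝ) (q : V → ℝ) :
    ∑ c, ∑ x, ∑ y, ∑ z, (g c x y z - a c - 4 * (q x + q y + q z)) =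
      ∑ c, ∑ x, ∑ y, ∑ z, g c x y z - (Fintype.card V : ℝ) ^ 3 * ∑ c, a c -
        12 * (Fintype.card C * (Fintype.card V : ℝ) ^ 2 * ∑ x, q x) := by
  simp only [Finset.sum_sub_distrib, Finset.sum_add_distrib, ← Finset.mul_sum, Finset.sum_const,
    Finset.card_univ, nsmul_eq_mul]
  ring

/-- there are many elements with few smaller ones -/
lemma many_low {V : Type*} [Fintype V] (w : V → ℝ) (z : ℝ) (hz : z ≤ 1) :
    z * Fintype.card V ≤ ∑ v, ind (∑ x, ind (w x < w v) ≤ z * Fintype.card V) := by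
  classical
  set n : ℝ := (Fintype.card V : ℝ) with hn
  by_cases h : ∀ v, ∑ x, ind (w x < w v) ≤ z * n
  · have : ∑ v : V, ind (∑ x, ind (w x < w v) ≤ z * n) = n := by
      simp only [fun v => ind_true (h v)]; simp [hn]
    rw [this]
    have : 0 ≤ n := by positivity
    nlinarith
  · push Not at h
    obtain ⟨v0, hv0⟩ := h
    obtain ⟨v, hv, hmin⟩ := Finset.exists_min_image
      (univ.filter (fun v => z * n < ∑ x, ind (w x < w v))) w ⟨v0, by simpa using hv0⟩
    rw [mem_filter] at hv
    refine hv.2.le.trans (Finset.sum_le_sum fun x _ => ind_mono fun hx => ?_)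
    by_contra hc
    push Not at hc
    exact absurd (hmin x (by simpa using hc)) (not_le.2 hx)

set_option maxHeartbeats 2000000 in
lemma dual_bound {C V : Type*} [Fintype C] [Fintype V] (hC : 0 < Fintype.card C)
    (hV : 0 < Fintype.card V) (R : C → V → V → V → Prop) (γ ε ε' lam : ℝ) (J : ℕ)
    (hε : 0 < ε) (hJ : 1 ≤ ε * J) (hγ : 2000 * ε ≤ γ) (hε' : 0 < ε') (hε'1 : ε' ≤ 1)
    (hlam : 0 < lam) (hlam1 : lam ≤ γ * ε' / 8)
    (hlam2 : lam ≤ (ε' / 8) ^ 2 * (ε' / 2) * (ε / (2 * J)))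
    (hdeg : ∀ c v, (5 / 9 - ε) * (Fintype.card V : ℝ) ^ 2 ≤ ∑ x, ∑ y, ind (R c v x y))
    (hnon : ∀ S : V → Prop, ∑ x, ind (S x) ≤ (1 / 3 + 39 * ε) * (Fintype.card V : ℝ) →
      γ * Fintype.card C * (Fintype.card V : ℝ) ^ 3 ≤ ∑ c, ∑ x, ∑ y, ∑ z,
        ind (R c x y z) * (ind (¬ S x) * ind (¬ S y) * ind (¬ S z)))
    (t : C → ℝ) (w : V → ℝ) (ht : ∀ c, 0 ≤ t c ∧ t c ≤ 1) (hw : ∀ x, 0 ≤ w x ∧ w x ≤ 1)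
    (htw : 3 * ((∑ x, w x) / Fintype.card V) ≤ (∑ c, t c) / Fintype.card C - ε') :
    lam * Fintype.card C * (Fintype.card V : ℝ) ^ 3 ≤
      ∑ c, ∑ x, ∑ y, ∑ z, ind (R c x y z) * max 0 (t c - w x - w y - w z) := by
  set n : ℝ := (Fintype.card V : ℝ) with hn
  set m : ℝ := (Fintype.card C : ℝ) with hm
  have hn0 : 0 < n := by rw [hn]; exact_mod_cast hV
  have hm0 : 0 < m := by rw [hm]; exact_mod_cast hC
  by_contra hcon
  push Not at hcon
  set ζ := ε' / 8 with hζ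
  have hζ0 : 0 < ζ := by positivity
  set pV : V → ℝ := fun v => ind (∑ x, ind (w x < w v) ≤ ζ * n) with hpV
  set pC : C → ℝ := fun c => ind (∑ d, ind (t c < t d) ≤ ζ * m) with hpC
  have hmV : ζ * n ≤ ∑ v, pV v := many_low w ζ (by linarith)
  have hmC : ζ * m ≤ ∑ c, pC c := by
    have := many_low (fun c => - t c) ζ (by linarith)
    simpa [hpC, neg_lt_neg_iff] using this
  set L : C → V → ℝ := fun c v => ∑ y, ∑ z, ind (R c v y z) * max 0 (t c - w v - w y - w z) with hL
  have hL0 : ∀ c v, 0 ≤ L c v := fun c v => Finset.sum_nonneg fun y _ =>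
    Finset.sum_nonneg fun z _ => mul_nonneg (ind_nonneg _) (le_max_left _ _)
  obtain ⟨c0, v0, hc0, hv0, hLcv⟩ : ∃ c0 v0, (∑ d, ind (t c0 < t d) ≤ ζ * m) ∧
      (∑ x, ind (w x < w v0) ≤ ζ * n) ∧ L c0 v0 ≤ lam / ζ ^ 2 * n ^ 2 := by
    by_contra hno
    push Not at hno
    have h1 : ∀ c v, pC c * pV v * (lam / ζ ^ 2 * n ^ 2) ≤ L c v := by
      intro c v
      by_cases h : ∑ d, ind (t c < t d) ≤ ζ * m
      · by_cases h' : ∑ x, ind (w x < w v) ≤ ζ * n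
        · simp only [hpC, hpV]
          rw [ind_true h, ind_true h', one_mul, one_mul]
          exact (hno c v h h').le
        · simp only [hpC, hpV]
          rw [ind_false h', mul_zero, zero_mul]; exact hL0 c v
      · simp only [hpC, hpV]
        rw [ind_false h, zero_mul, zero_mul]; exact hL0 c v
    have h2 : ∑ c, ∑ v, pC c * pV v * (lam / ζ ^ 2 * n ^ 2) ≤ ∑ c, ∑ v, L c v :=
      Finset.sum_le_sum fun c _ => Finset.sum_le_sum fun v _ => h1 c v
    have h3 : ∑ c, ∑ v, pC c * pV v * (lam / ζ ^ 2 * n ^ 2) =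
        (∑ c, pC c) * (∑ v, pV v) * (lam / ζ ^ 2 * n ^ 2) := by
      rw [Finset.sum_mul_sum, Finset.sum_mul]
      refine Finset.sum_congr rfl fun c _ => ?_
      rw [Finset.sum_mul]
    rw [h3] at h2
    have h4 : (ζ * m) * (ζ * n) ≤ (∑ c, pC c) * (∑ v, pV v) :=
      mul_le_mul hmC hmV (by positivity) (le_trans (by positivity) hmC)
    have h5 : (ζ * m) * (ζ * n) * (lam / ζ ^ 2 * n ^ 2) ≤
      (∑ c, pC c) * (∑ v, pV v) * (lam / ζ ^ 2 * n ^ 2) :=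
      mul_le_mul_of_nonneg_right h4 (by positivity)
    have h6 : (ζ * m) * (ζ * n) * (lam / ζ ^ 2 * n ^ 2) = lam * m * n ^ 3 := by field_simp
    rw [h6] at h5
    exact absurd (h5.trans h2) (not_le.2 hcon)
  set s := w v0 with hs
  set t0 := t c0 with ht0
  set τ := t0 - 3 * s with hτ
  set Ew := ∑ x, w x with hEw
  set Et := ∑ c, t c with hEt
  have hs0 := (hw v0).1
  have hs1 := (hw v0).2
  -- positive part bound
  have hpos : ∑ x, max 0 (w x - s) ≤ Ew - s * n + ζ * n := by
    have h1 : ∀ x, max 0 (w x - s) ≤ (w x - s) + ind (w x < s) := by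
      intro x
      by_cases h : w x < s
      · rw [ind_true h, max_eq_left (by linarith)]; have := (hw x).1; linarith
      · rw [ind_false h, max_eq_right (by linarith)]; linarith
    have h2 := Finset.sum_le_sum fun x (_ : x ∈ univ) => h1 x
    rw [Finset.sum_add_distrib, Finset.sum_sub_distrib] at h2
    simp only [Finset.sum_const, Finset.card_univ, nsmul_eq_mul, ← hn] at h2
    linarith
  have hposn : 0 ≤ ∑ x, max 0 (w x - s) := Finset.sum_nonneg fun x _ => le_max_left _ _
  have hEt1 : Et ≤ t0 * m + ζ * m := by
    have h1 : ∀ c, t c ≤ t0 + ind (t0 < t c) := by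
      intro c
      by_cases h : t0 < t c
      · rw [ind_true h]; have := (ht c).2; have := (ht c0).1; linarith
      · rw [ind_false h]; linarith
    have h2 := Finset.sum_le_sum fun x (_ : x ∈ univ) => h1 x
    rw [Finset.sum_add_distrib] at h2
    simp only [Finset.sum_const, Finset.card_univ, nsmul_eq_mul, ← hm] at h2
    linarith
  set ew := Ew / n with hew
  set et := Et / m with het
  have hew' : Ew = ew * n := by rw [hew]; field_simp
  have het' : Et = et * m := by rw [het]; field_simp
  have het2 : et ≤ t0 + ζ := by
    rw [het, div_le_iff₀ hm0]; linarith
  have hews : s - ζ ≤ ew := by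
    rw [hew, le_div_iff₀ hn0]; linarith
  have hτ1 : ε' / 2 ≤ τ := by linarith
  have hτ0 : 0 < τ := by linarith
  set u : V → ℝ := fun x => min 1 (max 0 ((w x - s) / τ)) with hu
  have hu01 : ∀ x, 0 ≤ u x ∧ u x ≤ 1 := fun x =>
    ⟨le_min (by norm_num) (le_max_left _ _), min_le_left _ _⟩
  have hule : ∀ x, τ * u x ≤ max 0 (w x - s) := by
    intro x
    have : u x ≤ max 0 ((w x - s) / τ) := min_le_right _ _
    calc τ * u x ≤ τ * max 0 ((w x - s) / τ) := mul_le_mul_of_nonneg_left this hτ0.le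
      _ = max 0 (w x - s) := by
        rw [mul_max_of_nonneg _ _ hτ0.le, mul_zero, mul_div_cancel₀ _ hτ0.ne']
  have huge : ∀ x, u x < 1 → w x - s ≤ τ * u x := by
    intro x hx
    have h1 : u x = max 0 ((w x - s) / τ) := by
      rcases min_choice 1 (max 0 ((w x - s) / τ)) with h | h
      · exfalso; simp only [hu] at hx; rw [h] at hx; exact lt_irrefl _ hx
      · exact h
    rw [h1]
    calc w x - s = τ * ((w x - s) / τ) := by field_simp
      _ ≤ _ := mul_le_mul_of_nonneg_left (le_max_right _ _) hτ0.le
  have hτu : τ * ∑ x, u x ≤ (ew - s + ζ) * n := by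
    rw [Finset.mul_sum]
    refine (Finset.sum_le_sum fun x _ => hule x).trans (hpos.trans (le_of_eq ?_))
    rw [hew']; ring
  have hsumu : ∑ x, u x ≤ n / 3 := by
    have h1 : (ew - s + ζ) * n ≤ τ * (n / 3) := by
      have : ew - s + ζ ≤ τ / 3 := by linarith
      have := mul_le_mul_of_nonneg_right this hn0.le
      linarith
    exact le_of_mul_le_mul_left (hτu.trans h1) hτ0
  have hLu : ∑ x, ∑ y, ind (R c0 v0 x y) * max 0 (1 - u x - u y) ≤ ε / (2 * J) * n ^ 2 := by
    have h1 : ∀ x y, τ * (ind (R c0 v0 x y) * max 0 (1 - u x - u y)) ≤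
        ind (R c0 v0 x y) * max 0 (t0 - s - w x - w y) := by
      intro x y
      rw [mul_left_comm]
      apply mul_le_mul_of_nonneg_left _ (ind_nonneg _)
      rcases le_total (1 - u x - u y) 0 with h | h
      · rw [max_eq_left h, mul_zero]; exact le_max_left _ _
      · by_cases h1 : u x < 1
        · by_cases h2 : u y < 1
          · rw [max_eq_right h]
            refine le_trans ?_ (le_max_right _ _)
            have q1 := huge x h1
            have q2 := huge y h2
            have q3 : τ * (1 - u x - u y) = τ - τ * u x - τ * u y := by ring
            rw [q3]
            linarith
          · have : 1 - u x - u y ≤ 0 := by have := (hu01 x).1; linarith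
            rw [max_eq_left this, mul_zero]; exact le_max_left _ _
        · have : 1 - u x - u y ≤ 0 := by have := (hu01 y).1; linarith
          rw [max_eq_left this, mul_zero]; exact le_max_left _ _
    have h2 : τ * ∑ x, ∑ y, ind (R c0 v0 x y) * max 0 (1 - u x - u y) ≤ L c0 v0 := by
      simp only [Finset.mul_sum]
      exact Finset.sum_le_sum fun x _ => Finset.sum_le_sum fun y _ => h1 x y
    have h3 : lam / ζ ^ 2 * n ^ 2 ≤ τ * (ε / (2 * J) * n ^ 2) := by
      have : lam / ζ ^ 2 ≤ τ * (ε / (2 * J)) := by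
        rw [div_le_iff₀ (by positivity)]
        have h4 : ζ ^ 2 * (ε' / 2) * (ε / (2 * J)) ≤ ζ ^ 2 * τ * (ε / (2 * J)) := by
          apply mul_le_mul_of_nonneg_right _ (by positivity)
          exact mul_le_mul_of_nonneg_left hτ1 (by positivity)
        linarith
      calc _ ≤ τ * (ε / (2 * J)) * n ^ 2 := mul_le_mul_of_nonneg_right this (by positivity)
        _ = _ := by ring
    exact le_of_mul_le_mul_left (h2.trans (hLcv.trans h3)) hτ0
  obtain ⟨S, hS1, hS2, hS3⟩ := pair_lemma hV (R c0 v0) u hu01 ε hε J hJ (hdeg c0 v0) hsumu hLu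
  rw [← hn] at hS1 hS2 hS3
  -- colours
  have hcol : ∑ c, ind (t c < t0 - τ / 4) ≤ 36 * ε * m := by
    have h1 : ∀ c, τ / 4 * ind (t c < t0 - τ / 4) ≤ t0 - t c + ind (t0 < t c) := by
      intro c
      by_cases h : t c < t0 - τ / 4
      · rw [ind_true h]
        have := ind_nonneg (t0 < t c); linarith
      · rw [ind_false h]
        by_cases h' : t0 < t c
        · rw [ind_true h']; have := (ht c).2; have := (ht c0).1; linarith
        · rw [ind_false h']; linarith
    have h2 := Finset.sum_le_sum fun x (_ : x ∈ univ) => h1 x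
    rw [← Finset.mul_sum, Finset.sum_add_distrib, Finset.sum_sub_distrib] at h2
    simp only [Finset.sum_const, Finset.card_univ, nsmul_eq_mul, ← hm] at h2
    have h3 : τ * (1 / 3 - 3 * ε) ≤ ew - s + ζ := by
      have h4 : τ * ((1 / 3 - 3 * ε) * n) ≤ (ew - s + ζ) * n :=
        (mul_le_mul_of_nonneg_left hS3 hτ0.le).trans hτu
      apply le_of_mul_le_mul_right _ hn0
      linarith
    have h5 : t0 - et ≤ 9 * ε * τ - ζ := by linarith
    have h6 : τ / 4 * ∑ c, ind (t c < t0 - τ / 4) ≤ τ / 4 * (36 * ε * m) := by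
      have : m * t0 - et * m ≤ (9 * ε * τ - ζ) * m := by
        have := mul_le_mul_of_nonneg_right h5 (by positivity : 0 ≤ m)
        linarith
      linarith [hc0]
    exact le_of_mul_le_mul_left h6 (by positivity)
  -- main lower bound
  have hpt : ∀ c x y z, (ε' / 4) * (ind (R c x y z) * (ind (¬ S x) * ind (¬ S y) * ind (¬ S z)) -
      ind (t c < t0 - τ / 4) - 4 * (ind (¬ S x) * u x + ind (¬ S y) * u y + ind (¬ S z) * u z)) ≤
      ind (R c x y z) * max 0 (t c - w x - w y - w z) := by
    intro c x y z
    have hRn : 0 ≤ ind (R c x y z) * max 0 (t c - w x - w y - w z) :=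
      mul_nonneg (ind_nonneg _) (le_max_left _ _)
    have hi : 0 ≤ ind (t c < t0 - τ / 4) := ind_nonneg _
    have hx0 : 0 ≤ ind (¬ S x) * u x := mul_nonneg (ind_nonneg _) (hu01 x).1
    have hy0 : 0 ≤ ind (¬ S y) * u y := mul_nonneg (ind_nonneg _) (hu01 y).1
    have hz0 : 0 ≤ ind (¬ S z) * u z := mul_nonneg (ind_nonneg _) (hu01 z).1
    by_cases hall : R c x y z ∧ ¬ S x ∧ ¬ S y ∧ ¬ S z ∧ ¬ (t c < t0 - τ / 4) ∧ u x + u y + u z ≤ 1 / 4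
    · obtain ⟨h1, h2, h3, h4, h5, h6⟩ := hall
      rw [ind_true h2, ind_true h3, ind_true h4] at *
      rw [ind_true h1, ind_false h5]
      have ux := (hu01 x).1
      have uy := (hu01 y).1
      have uz := (hu01 z).1
      have a1 := huge x (by linarith)
      have a2 := huge y (by linarith)
      have a3 := huge z (by linarith)
      have a4 : τ * (u x + u y + u z) ≤ τ * (1 / 4) := mul_le_mul_of_nonneg_left h6 hτ0.le
      have a5 : ε' / 4 ≤ t c - w x - w y - w z := by push Not at h5; linarith
      rw [one_mul (max _ _)]
      refine le_trans ?_ (le_max_right _ _)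
      refine le_trans ?_ a5
      nlinarith
    · refine le_trans ?_ hRn
      apply mul_nonpos_of_nonneg_of_nonpos (by positivity)
      by_cases h1 : R c x y z
      swap
      · rw [ind_false h1]; linarith
      by_cases h2 : S x
      · rw [ind_false (not_not.2 h2)] at *; linarith
      by_cases h3 : S y
      · rw [ind_false (not_not.2 h3)] at *; linarith
      by_cases h4 : S z
      · rw [ind_false (not_not.2 h4)] at *; linarith
      by_cases h5 : t c < t0 - τ / 4
      · rw [ind_true h5, ind_true h1, ind_true h2, ind_true h3, ind_true h4]
        rw [ind_true h2] at hx0; rw [ind_true h3] at hy0; rw [ind_true h4] at hz0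
        linarith
      · rw [ind_false h5, ind_true h1, ind_true h2, ind_true h3, ind_true h4]
        have h6 : ¬ (u x + u y + u z ≤ 1 / 4) := fun h6 => hall ⟨h1, h2, h3, h4, h5, h6⟩
        linarith
  have hbig := Finset.sum_le_sum fun c (_ : c ∈ univ) => Finset.sum_le_sum fun x (_ : x ∈ univ) =>
    Finset.sum_le_sum fun y (_ : y ∈ univ) => Finset.sum_le_sum fun z (_ : z ∈ univ) => hpt c x y z
  simp only [← Finset.mul_sum] at hbig
  rw [sum4 (fun c x y z => ind (R c x y z) * (ind (¬ S x) * ind (¬ S y) * ind (¬ S z)))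
    (fun c => ind (t c < t0 - τ / 4)) (fun x => ind (¬ S x) * u x), ← hn, ← hm] at hbig
  have hS := hnon S hS1
  have hX : (ε' / 4) * (γ * m * n ^ 3 - 36 * ε * m * n ^ 3 - 4 * (3 * (38 * ε * n ^ 3 * m))) ≤
      ∑ c, ∑ x, ∑ y, ∑ z, ind (R c x y z) * max 0 (t c - w x - w y - w z) := by
    refine le_trans ?_ hbig
    apply mul_le_mul_of_nonneg_left _ (by positivity)
    have k1 : n ^ 3 * ∑ c, ind (t c < t0 - τ / 4) ≤ 36 * ε * m * n ^ 3 := by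
      have := mul_le_mul_of_nonneg_left hcol (by positivity : 0 ≤ n ^ 3)
      linarith
    have k2 : m * n ^ 2 * ∑ x, ind (¬ S x) * u x ≤ 38 * ε * n ^ 3 * m := by
      have := mul_le_mul_of_nonneg_left hS2 (by positivity : 0 ≤ m * n ^ 2)
      linarith
    linarith
  have hY : lam * m * n ^ 3 ≤
      (ε' / 4) * (γ * m * n ^ 3 - 36 * ε * m * n ^ 3 - 4 * (3 * (38 * ε * n ^ 3 * m))) := by
    have e : (ε' / 4) * (γ * m * n ^ 3 - 36 * ε * m * n ^ 3 - 4 * (3 * (38 * ε * n ^ 3 * m)))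
      = ((ε' / 4) * (γ - 492 * ε)) * (m * n ^ 3) := by ring
    rw [e, mul_assoc]
    apply mul_le_mul_of_nonneg_right _ (by positivity)
    nlinarith
  exact absurd (hY.trans hX) (not_le.2 hcon)

end RM

namespace RM
open Finset

/-- `Mb R P`: the set `P` of colours and vertices is perfectly matched by disjoint edges. -/
inductive Mb {C V : Type} [DecidableEq C] [DecidableEq V] (R : C → V → V → V → Prop) :
    Finset (C ⊕ V) → Prop
  | nil : Mb R ∅
  | cons (c : C) (x y z : V) (P : Finset (C ⊕ V)) (h : R c x y z) (hc : Sum.inl c ∉ P)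
      (hx : Sum.inr x ∉ P) (hy : Sum.inr y ∉ P) (hz : Sum.inr z ∉ P) (hP : Mb R P) :
      Mb R ({Sum.inl c, Sum.inr x, Sum.inr y, Sum.inr z} ∪ P)

section
variable {C V : Type} [DecidableEq C] [DecidableEq V] {R : C → V → V → V → Prop}

lemma Mb.single {c : C} {x y z : V} (h : R c x y z) :
    Mb R {Sum.inl c, Sum.inr x, Sum.inr y, Sum.inr z} := by
  have := Mb.cons c x y z ∅ h (by simp) (by simp) (by simp) (by simp) Mb.nil
  simpa using this

lemma Mb.union {P Q : Finset (C ⊕ V)} (hP : Mb R P) (hQ : Mb R Q) (hd : Disjoint P Q) :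
    Mb R (P ∪ Q) := by
  induction hP with
  | nil => simpa using hQ
  | cons c x y z P h hc hx hy hz hP ih =>
    rw [Finset.union_assoc]
    rw [Finset.disjoint_union_left] at hd
    have h2 := hd.1
    simp only [Finset.disjoint_insert_left, Finset.disjoint_singleton_left] at h2
    refine Mb.cons c x y z _ h ?_ ?_ ?_ ?_ (ih hd.2)
    all_goals simp only [Finset.mem_union, not_or]
    · exact ⟨hc, h2.1⟩
    · exact ⟨hx, h2.2.1⟩
    · exact ⟨hy, h2.2.2.1⟩
    · exact ⟨hz, h2.2.2.2⟩

lemma Mb.biUnion {ι : Type*} [DecidableEq ι] (s : Finset ι) (f : ι → Finset (C ⊕ V))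
    (h : ∀ i ∈ s, Mb R (f i)) (hd : ∀ i ∈ s, ∀ j ∈ s, i ≠ j → Disjoint (f i) (f j)) :
    Mb R (s.biUnion f) := by
  induction s using Finset.induction_on with
  | empty => simpa using Mb.nil
  | insert a s ha ih =>
    rw [Finset.biUnion_insert]
    refine Mb.union (h a (by simp)) (ih (fun i hi => h i (by simp [hi]))
      (fun i hi j hj hij => hd i (by simp [hi]) j (by simp [hj]) hij)) ?_
    rw [Finset.disjoint_biUnion_right]
    intro i hi
    exact hd a (by simp) i (by simp [hi]) (by rintro rfl; exact ha hi)

end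

lemma sum_subtype_ind {A : Type*} [Fintype A] (p : A → Prop) [Fintype {a // p a}] (f : A → ℝ) :
    ∑ e : {a // p a}, f e.1 = ∑ a, ind (p a) * f a := by
  classical
  have h : ∑ a, ind (p a) * f a = ∑ a ∈ univ.filter p, f a := by
    rw [Finset.sum_filter]
    refine Finset.sum_congr rfl (fun a _ => ?_)
    by_cases h : p a
    · rw [ind_true h, if_pos h, one_mul]
    · rw [ind_false h, if_neg h, zero_mul]
  rw [h]
  exact (Finset.sum_subtype _ (by simp) f).symm

/-- Cyclic symmetrisation. -/
lemma cyc {E X : Type} [Fintype E] [Fintype X] [DecidableEq X] (ρ : E → Fin 4 → X)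
    (hρ : Function.Injective ρ) (W : E → ℝ) (b : ℝ) (hb : 0 ≤ b) (hW : ∀ e, 0 ≤ W e ∧ W e ≤ b)
    (hcap : ∀ x, ∑ e, ∑ j, ind (ρ e j = x) * W e ≤ 4) :
    ∃ W' : (Fin 4 → X) → ℝ, (∀ ξ, 0 ≤ W' ξ) ∧ (∀ ξ, W' ξ ≤ b) ∧
      (∀ ξ, W' ξ ≠ 0 → ∃ e, ∃ s : Fin 4, ξ = fun i => ρ e (i - s)) ∧
      (∀ j x, mu W' j x ≤ 1) ∧ ∑ ξ, W' ξ = ∑ e, W e := by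
  classical
  refine ⟨fun ξ => (1/4) * ∑ s : Fin 4, ∑ e, ind (ξ = fun i => ρ e (i - s)) * W e,
    ?_, ?_, ?_, ?_, ?_⟩
  · intro ξ
    refine mul_nonneg (by norm_num) (Finset.sum_nonneg fun s _ => Finset.sum_nonneg fun e _ =>
      mul_nonneg (ind_nonneg _) (hW e).1)
  · intro ξ
    have key : ∀ s : Fin 4, ∑ e, ind (ξ = fun i => ρ e (i - s)) * W e ≤ b := by
      intro s
      by_cases h : ∃ e0, ξ = fun i => ρ e0 (i - s)
      · obtain ⟨e0, he0⟩ := h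
        calc ∑ e, ind (ξ = fun i => ρ e (i - s)) * W e
            ≤ ∑ e, ind (e = e0) * W e := by
              refine Finset.sum_le_sum fun e _ => mul_le_mul_of_nonneg_right ?_ (hW e).1
              refine ind_mono ?_
              intro h1
              apply hρ
              funext i
              have := congrFun (h1.symm.trans he0) (i + s)
              simpa using this
          _ = W e0 := sum_ind_eq' e0 W
          _ ≤ b := (hW e0).2
      · push Not at h
        have : ∑ e, ind (ξ = fun i => ρ e (i - s)) * W e = 0 := by
          refine Finset.sum_eq_zero fun e _ => ?_
          rw [ind_false (h e), zero_mul]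
        rw [this]; exact hb
    calc (1/4) * ∑ s : Fin 4, ∑ e, ind (ξ = fun i => ρ e (i - s)) * W e
        ≤ (1/4) * ∑ s : Fin 4, b := by gcongr; exact key _
      _ = b := by simp
  · intro ξ hξ
    by_contra hcon
    push Not at hcon
    apply hξ
    have : ∀ s : Fin 4, ∑ e, ind (ξ = fun i => ρ e (i - s)) * W e = 0 := by
      intro s
      refine Finset.sum_eq_zero fun e _ => ?_
      rw [ind_false (hcon e s), zero_mul]
    simp [this]
  · intro j x
    have h1 : mu (fun ξ => (1/4) * ∑ s : Fin 4, ∑ e, ind (ξ = fun i => ρ e (i - s)) * W e) j x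
        = (1/4) * ∑ s : Fin 4, ∑ e, ind (ρ e (j - s) = x) * W e := by
      unfold mu
      calc ∑ ξ : Fin 4 → X, ind (ξ j = x) *
            ((1/4) * ∑ s : Fin 4, ∑ e, ind (ξ = fun i => ρ e (i - s)) * W e)
          = ∑ ξ : Fin 4 → X, ∑ s : Fin 4, ∑ e,
              (1/4) * (ind (ξ = fun i => ρ e (i - s)) * (ind (ξ j = x) * W e)) := by
            refine Finset.sum_congr rfl fun ξ _ => ?_
            rw [Finset.mul_sum, Finset.mul_sum]
            refine Finset.sum_congr rfl fun s _ => ?_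
            rw [Finset.mul_sum, Finset.mul_sum]
            refine Finset.sum_congr rfl fun e _ => ?_
            ring
        _ = ∑ s : Fin 4, ∑ e, ∑ ξ : Fin 4 → X,
              (1/4) * (ind (ξ = fun i => ρ e (i - s)) * (ind (ξ j = x) * W e)) := by
            rw [Finset.sum_comm]
            refine Finset.sum_congr rfl fun s _ => ?_
            rw [Finset.sum_comm]
        _ = _ := by
            rw [Finset.mul_sum]
            refine Finset.sum_congr rfl fun s _ => ?_
            rw [Finset.mul_sum]
            refine Finset.sum_congr rfl fun e _ => ?_
            rw [← Finset.mul_sum]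
            congr 1
            exact sum_ind_eq' (fun i => ρ e (i - s)) (fun ξ => ind (ξ j = x) * W e)
    rw [h1]
    have h2 : ∑ s : Fin 4, ∑ e, ind (ρ e (j - s) = x) * W e
        = ∑ s : Fin 4, ∑ e, ind (ρ e s = x) * W e :=
      (Equiv.subLeft j).sum_comp (fun i => ∑ e, ind (ρ e i = x) * W e)
    rw [h2, Finset.sum_comm]
    linarith [hcap x]
  · calc ∑ ξ : Fin 4 → X, (1/4) * ∑ s : Fin 4, ∑ e, ind (ξ = fun i => ρ e (i - s)) * W e
        = (1/4) * ∑ s : Fin 4, ∑ e, ∑ ξ : Fin 4 → X, ind (ξ = fun i => ρ e (i - s)) * W e := by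
          rw [← Finset.mul_sum]
          congr 1
          rw [Finset.sum_comm]
          refine Finset.sum_congr rfl fun s _ => ?_
          rw [Finset.sum_comm]
      _ = (1/4) * ∑ s : Fin 4, ∑ e, W e := by
          congr 1
          refine Finset.sum_congr rfl fun s _ => ?_
          refine Finset.sum_congr rfl fun e _ => ?_
          exact sum_ind_eq' (fun i => ρ e (i - s)) (fun _ => W e)
      _ = ∑ e, W e := by simp

/-- The edge `(c,x,y,z)` as a tuple of points. -/
def rho0 {C V : Type} (e : C × V × V × V) : Fin 4 → C ⊕ V :=
  ![Sum.inl e.1, Sum.inr e.2.1, Sum.inr e.2.2.1, Sum.inr e.2.2.2]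

lemma rho0_inj {C V : Type} {c : C} {x y z : V} (h : x ≠ y ∧ x ≠ z ∧ y ≠ z) :
    Function.Injective (rho0 (c, x, y, z)) := by
  obtain ⟨d1, d2, d3⟩ := h
  intro i j hij
  unfold rho0 at hij
  fin_cases i <;> fin_cases j
  all_goals first
    | rfl
    | (exfalso; simp at hij; done)
    | exact absurd (Sum.inr.inj hij) d1
    | exact absurd (Sum.inr.inj hij) d2
    | exact absurd (Sum.inr.inj hij) d3
    | exact absurd (Sum.inr.inj hij).symm d1
    | exact absurd (Sum.inr.inj hij).symm d2
    | exact absurd (Sum.inr.inj hij).symm d3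

lemma rho0_injective {C V : Type} : Function.Injective (rho0 (C := C) (V := V)) := by
  rintro ⟨c, x, y, z⟩ ⟨c', x', y', z'⟩ heq
  have e0 := congrFun heq 0
  have e1 := congrFun heq 1
  have e2 := congrFun heq 2
  have e3 := congrFun heq 3
  simp [rho0] at e0 e1 e2 e3
  subst e0 e1 e2 e3
  rfl

lemma rho0_image {C V : Type} [DecidableEq C] [DecidableEq V] (c : C) (x y z : V) (s : Fin 4) :
    univ.image (fun i => rho0 (c, x, y, z) (i - s))
      = {Sum.inl c, Sum.inr x, Sum.inr y, Sum.inr z} := by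
  ext w
  simp only [mem_image, mem_univ, true_and, mem_insert, mem_singleton]
  constructor
  · rintro ⟨i, rfl⟩
    generalize i - s = j
    fin_cases j <;> simp [rho0]
  · rintro (h | h | h | h)
    · exact ⟨0 + s, by simp [rho0, h]⟩
    · exact ⟨1 + s, by simp [rho0, h]⟩
    · exact ⟨2 + s, by simp [rho0, h]⟩
    · exact ⟨3 + s, by simp [rho0, h]⟩

lemma rho0_sum {C V : Type} [Fintype C] [Fintype V] (R : C → V → V → V → Prop)
    [Fintype {e : C × V × V × V // R e.1 e.2.1 e.2.2.1 e.2.2.2}] (y : C ⊕ V → ℝ) :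
    ∑ e : {e : C × V × V × V // R e.1 e.2.1 e.2.2.1 e.2.2.2}, max 0 (1 - ∑ j, y (rho0 e.1 j))
     = ∑ c, ∑ x, ∑ y', ∑ z, ind (R c x y' z) *
          max 0 (1 - y (Sum.inl c) - y (Sum.inr x) - y (Sum.inr y') - y (Sum.inr z)) := by
  have h := sum_subtype_ind (fun e : C × V × V × V => R e.1 e.2.1 e.2.2.1 e.2.2.2)
    (fun e => max 0 (1 - ∑ j, y (rho0 e j)))
  rw [h]
  simp only [Fintype.sum_prod_type]
  refine Finset.sum_congr rfl fun c _ => Finset.sum_congr rfl fun x _ =>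
    Finset.sum_congr rfl fun x' _ => Finset.sum_congr rfl fun z _ => ?_
  have : 1 - ∑ j, y (rho0 (c, x, x', z) j)
      = 1 - y (Sum.inl c) - y (Sum.inr x) - y (Sum.inr x') - y (Sum.inr z) := by
    rw [Fin.sum_univ_four]
    simp [rho0]
    ring
  rw [this]

set_option maxHeartbeats 2000000 in
theorem almost_pm (γ ε δ : ℝ) (hε : 0 < ε) (hγ : 2000 * ε ≤ γ) (hδ : 0 < δ) :
    ∃ m0 : ℕ, ∀ (C V : Type) [Fintype C] [Fintype V] [DecidableEq C] [DecidableEq V]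
      (R : C → V → V → V → Prop), m0 ≤ Fintype.card C → Fintype.card V = 3 * Fintype.card C →
      (∀ c x y z, R c x y z → x ≠ y ∧ x ≠ z ∧ y ≠ z) →
      (∀ c v, (5/9 - ε) * (Fintype.card V:ℝ)^2 ≤ ∑ x, ∑ y, ind (R c v x y)) →
      (∀ S : V → Prop, ∑ x, ind (S x) ≤ (1/3 + 39*ε) * Fintype.card V →
        γ * Fintype.card C * (Fintype.card V)^3 ≤ ∑ c, ∑ x, ∑ y, ∑ z, ind (R c x y z) *
          (ind (¬S x) * ind (¬S y) * ind (¬S z))) →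
      ∃ P : Finset (C ⊕ V), Mb R P ∧ ((univ \ P).card : ℝ) ≤ δ * Fintype.card C := by
  classical
  set ε' : ℝ := min 1 (δ/16) with hε'd
  have hε'0 : 0 < ε' := by rw [hε'd]; positivity
  have hε'1 : ε' ≤ 1 := min_le_left _ _
  have hε'2 : ε' ≤ δ/16 := min_le_right _ _
  obtain ⟨J, hJ⟩ := exists_nat_ge (1/ε)
  have hJ1 : 1 ≤ ε * J := by
    rw [div_le_iff₀ hε] at hJ; linarith
  have hJ0 : (0:ℝ) < J := by
    rcases Nat.eq_zero_or_pos J with h | h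
    · rw [h] at hJ1; norm_num at hJ1
    · exact_mod_cast h
  have hγ0 : 0 < γ := by linarith
  set lam : ℝ := min (γ * ε' / 8) ((ε'/8)^2 * (ε'/2) * (ε/(2*J))) with hlamd
  have hlam0 : 0 < lam := by rw [hlamd]; positivity
  set B : ℝ := max 1 (256 / (27 * lam)) with hBd
  have hB1 : 1 ≤ B := le_max_left _ _
  have hB2 : 256 / (27 * lam) ≤ B := le_max_right _ _
  obtain ⟨K, hK0, hK⟩ := sampling' B ε' hB1 hε'0
  obtain ⟨m0, hm0⟩ := exists_nat_ge (2 * K / δ + 1)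
  refine ⟨m0, ?_⟩
  intro C V _ _ _ _ R hm hV hdist hdeg hnon
  set m : ℕ := Fintype.card C with hmd
  have hmm : 2 * K / δ + 1 ≤ (m:ℝ) := hm0.trans (by exact_mod_cast hm)
  have hm1 : (1:ℝ) ≤ m := by
    have : 0 ≤ 2 * K / δ := by positivity
    linarith
  have hmpos : 0 < m := by
    have : (0:ℝ) < m := by linarith
    exact_mod_cast this
  have hVr : (Fintype.card V : ℝ) = 3 * m := by rw [hV]; push_cast; ring
  have hX : Fintype.card (C ⊕ V) = 4 * m := by rw [Fintype.card_sum, hV]; ring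
  have hXr : (Fintype.card (C ⊕ V) : ℝ) = 4 * m := by rw [hX]; push_cast; ring
  let Ed := {e : C × V × V × V // R e.1 e.2.1 e.2.2.1 e.2.2.2}
  let ρ : Ed → Fin 4 → C ⊕ V := fun e => rho0 e.1
  set b : ℝ := B / (4 * m)^3 with hbd
  have hb0 : 0 ≤ b := by rw [hbd]; positivity
  have hdual : ∀ y : C ⊕ V → ℝ, (∀ x, 0 ≤ y x ∧ y x ≤ 1) →
      (1 - ε') * (4 * m) ≤ 4 * ∑ x, y x + b * ∑ e, max 0 (1 - ∑ j, y (ρ e j)) := by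
    intro y hy
    have hs : ∑ x, y x = ∑ c, y (Sum.inl c) + ∑ v, y (Sum.inr v) := Fintype.sum_sum_type y
    have hL0 : 0 ≤ ∑ e, max 0 (1 - ∑ j, y (ρ e j)) :=
      Finset.sum_nonneg fun e _ => le_max_left _ _
    have hc0 : 0 ≤ ∑ c, y (Sum.inl c) := Finset.sum_nonneg fun c _ => (hy _).1
    have hv0 : 0 ≤ ∑ v, y (Sum.inr v) := Finset.sum_nonneg fun c _ => (hy _).1
    have hts : ∑ c, (1 - y (Sum.inl c)) = m - ∑ c, y (Sum.inl c) := by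
      rw [Finset.sum_sub_distrib]; simp [hmd]
    by_cases h : 3 * ((∑ x, y (Sum.inr x)) / Fintype.card V)
        ≤ (∑ c, (1 - y (Sum.inl c))) / Fintype.card C - ε'
    · have hdb := dual_bound (C := C) (V := V) (by omega) (by omega) R γ ε ε' lam J hε hJ1 hγ
        hε'0 hε'1 hlam0 (min_le_left _ _) (min_le_right _ _) hdeg hnon
        (fun c => 1 - y (Sum.inl c)) (fun v => y (Sum.inr v))
        (fun c => ⟨by linarith [(hy (Sum.inl c)).2], by linarith [(hy (Sum.inl c)).1]⟩)
        (fun v => hy _) h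
      have hLe : ∑ e, max 0 (1 - ∑ j, y (ρ e j)) = ∑ c, ∑ x, ∑ y', ∑ z, ind (R c x y' z) *
          max 0 (1 - y (Sum.inl c) - y (Sum.inr x) - y (Sum.inr y') - y (Sum.inr z)) :=
        rho0_sum R y
      rw [hLe]
      rw [← hmd, hVr] at hdb
      have h3 : b * (lam * m * (3 * m)^3) ≤ b * ∑ c, ∑ x, ∑ y', ∑ z, ind (R c x y' z) *
          max 0 (1 - y (Sum.inl c) - y (Sum.inr x) - y (Sum.inr y') - y (Sum.inr z)) :=
        mul_le_mul_of_nonneg_left hdb hb0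
      have h4 : b * (lam * m * (3 * m)^3) = (27 * lam * B) / 64 * m := by
        rw [hbd]; field_simp; ring
      have h5 : 256 ≤ 27 * lam * B := by
        rw [div_le_iff₀ (by positivity)] at hB2; linarith
      have h6 : 4 * (m:ℝ) ≤ (27 * lam * B) / 64 * m := by
        apply mul_le_mul_of_nonneg_right _ (by linarith)
        linarith
      have h7 : 0 ≤ ε' * (4 * m) := by positivity
      rw [hs]
      linarith
    · push Not at h
      have hbL : 0 ≤ b * ∑ e, max 0 (1 - ∑ j, y (ρ e j)) := mul_nonneg hb0 hL0
      rw [hts, ← hmd, hVr] at h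
      have h2 : (m - ∑ c, y (Sum.inl c)) - ε' * m < ∑ v, y (Sum.inr v) := by
        have hmne : (m:ℝ) ≠ 0 := by linarith
        have e1 : 3 * ((∑ x, y (Sum.inr x)) / (3 * (m:ℝ))) = (∑ x, y (Sum.inr x)) / m := by
          field_simp
        have e2 : (↑m - ∑ c, y (Sum.inl c)) / (m:ℝ) - ε'
            = (m - ∑ c, y (Sum.inl c) - ε' * m) / m := by field_simp
        rw [e1, e2, div_lt_div_iff_of_pos_right (by linarith)] at h
        linarith
      rw [hs]
      linarith
  obtain ⟨W, hW, hWcap, hWsum⟩ := lp_dual ρ b 4 ((1 - ε') * (4 * m)) hb0 (by norm_num) hdual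
  have hρinj : Function.Injective ρ := fun e e' h => Subtype.ext (rho0_injective h)
  obtain ⟨W', hW'0, hW'b, hW'E, hW'mu, hW's⟩ := cyc ρ hρinj W b hb0 hW hWcap
  have hedge : ∀ (e : Ed) (s : Fin 4), Function.Injective (fun i => ρ e (i - s)) ∧
      Mb R (univ.image (fun i => ρ e (i - s))) := by
    rintro ⟨⟨c, x, y, z⟩, h⟩ s
    have hd := hdist c x y z h
    refine ⟨(rho0_inj hd).comp sub_left_injective, ?_⟩
    have := rho0_image c x y z s
    show Mb R (univ.image (fun i => rho0 (c, x, y, z) (i - s)))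
    rw [this]
    exact Mb.single h
  obtain ⟨M, hM, hMc⟩ := hK (C ⊕ V) (fun ξ => Function.Injective ξ ∧ Mb R (univ.image ξ))
    (fun e he => he.1) (by omega) W' hW'0
    (by
      intro ξ
      rw [hXr]
      have h1 := hW'b ξ
      have hp : (0:ℝ) < (4 * m)^3 := by positivity
      calc (4 * (m:ℝ))^3 * W' ξ ≤ (4 * m)^3 * b := mul_le_mul_of_nonneg_left h1 hp.le
        _ = B := by rw [hbd]; field_simp)
    (by
      intro ξ hξ
      obtain ⟨e, s, rfl⟩ := hW'E ξ hξ
      exact hedge e s)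
    hW'mu
  have hdM : ∀ e ∈ M, ∀ e' ∈ M, e ≠ e' → Disjoint (univ.image e) (univ.image e') := by
    intro e he e' he' hne
    rw [Finset.disjoint_left]
    intro w hw hw'
    simp only [mem_image, mem_univ, true_and] at hw hw'
    obtain ⟨i, hi⟩ := hw
    obtain ⟨j, hj⟩ := hw'
    exact hM.2.2 e he e' he' hne i j (hi.trans hj.symm)
  refine ⟨M.biUnion (fun e => univ.image e), ?_, ?_⟩
  · exact Mb.biUnion M _ (fun e he => (hM.1 e he).2) hdM
  · have hc : (M.biUnion (fun e => univ.image e)).card = 4 * M.card := by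
      rw [Finset.card_biUnion hdM]
      rw [Finset.sum_congr rfl (fun e he => Finset.card_image_of_injective univ (hM.1 e he).1)]
      simp [mul_comm]
    have hc2 : (univ \ M.biUnion (fun e => univ.image e)).card + 4 * M.card = 4 * m := by
      rw [← hc, ← hX, ← Finset.card_univ]
      exact Finset.card_sdiff_add_card_eq_card (Finset.subset_univ _)
    have hc3 : ((univ \ M.biUnion (fun e => univ.image e)).card : ℝ) + 4 * M.card = 4 * m := by
      exact_mod_cast hc2
    rw [hXr] at hMc
    have hKm : K ≤ δ / 2 * m := by
      have h1 : 2 * K / δ ≤ m := by linarith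
      rw [div_le_iff₀ hδ] at h1
      linarith
    have h8 : ε' * (4 * m) ≤ δ/16 * (4 * m) :=
      mul_le_mul_of_nonneg_right hε'2 (by linarith)
    have h9 : (1 - ε') * (4 * (m:ℝ)) = 4 * m - ε' * (4 * m) := by ring
    linarith

end RM

namespace RM
open Finset

set_option maxHeartbeats 1000000 in
lemma greedy {Ω T X : Type*} [Fintype Ω] [Fintype T] [DecidableEq X] [DecidableEq Ω]
    (supp : Ω → Finset X) (A : Ω → T → Prop) (ξ D : ℝ) (k : ℕ) (hξ0 : 0 < ξ)
    (hD0 : 0 ≤ D) (hΩ : 0 < Fintype.card Ω) (hT : Nonempty T)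
    (hξ : ∀ t, ξ * Fintype.card Ω ≤ ∑ ω, ind (A ω t))
    (hk : ∀ ω, (supp ω).card ≤ k)
    (hne : ∀ ω t, A ω t → (supp ω).Nonempty)
    (hD : ∀ x, ∑ ω, ind (x ∈ supp ω) ≤ D * Fintype.card Ω) (s : ℕ)
    (hs : k * s * D ≤ ξ / 2) :
    ∃ Sel : Finset Ω, Sel.card = s ∧ (∀ ω ∈ Sel, ∃ t, A ω t) ∧
      (∀ ω ∈ Sel, ∀ ω' ∈ Sel, ω ≠ ω' → Disjoint (supp ω) (supp ω')) ∧
      ∑ t, ∏ ω ∈ Sel, (1 - ind (A ω t) / 2) ≤ Fintype.card T * (1 - ξ / 4) ^ s := by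
  classical
  induction s with
  | zero =>
    refine ⟨∅, rfl, by simp, by simp, by simp⟩
  | succ s ih =>
    have hs' : (k:ℝ) * s * D ≤ ξ / 2 := by
      refine le_trans ?_ hs
      push_cast
      have : 0 ≤ (k:ℝ) * D := by positivity
      nlinarith
    obtain ⟨Sel, hc, hA, hdis, hΦ⟩ := ih hs'
    set U := Sel.biUnion supp with hU
    have hUc : (U.card : ℝ) ≤ k * s := by
      have : U.card ≤ s * k := by
        rw [hU, ← hc]
        exact Finset.card_biUnion_le_card_mul _ _ _ (fun ω _ => hk ω)
      have h2 : (U.card : ℝ) ≤ s * k := by exact_mod_cast this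
      linarith
    have hbad : ∑ ω, ind (¬ Disjoint (supp ω) U) ≤ ξ / 2 * Fintype.card Ω := by
      calc ∑ ω, ind (¬ Disjoint (supp ω) U)
          ≤ ∑ ω, ∑ x ∈ U, ind (x ∈ supp ω) := by
            refine Finset.sum_le_sum fun ω _ => ?_
            by_cases h : Disjoint (supp ω) U
            · rw [ind_false (by simpa using h)]
              exact Finset.sum_nonneg fun x _ => ind_nonneg _
            · rw [ind_true h]
              rw [Finset.not_disjoint_iff] at h
              obtain ⟨x, hx, hxU⟩ := h
              calc (1:ℝ) = ind (x ∈ supp ω) := (ind_true hx).symm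
                _ ≤ _ := Finset.single_le_sum (f := fun x => ind (x ∈ supp ω))
                  (fun x _ => ind_nonneg _) hxU
        _ = ∑ x ∈ U, ∑ ω, ind (x ∈ supp ω) := Finset.sum_comm
        _ ≤ ∑ x ∈ U, D * Fintype.card Ω := Finset.sum_le_sum fun x _ => hD x
        _ = U.card * D * Fintype.card Ω := by rw [Finset.sum_const, nsmul_eq_mul]; ring
        _ ≤ (k * s) * D * Fintype.card Ω := by gcongr
        _ ≤ ξ / 2 * Fintype.card Ω := by gcongr
    let f : T → ℝ := fun t => ∏ ω ∈ Sel, (1 - ind (A ω t) / 2)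
    have hf0 : ∀ t, 0 < f t := fun t => Finset.prod_pos fun ω _ => by
      have := ind_le_one (A ω t); linarith
    have hfree : ∀ t, ξ / 2 * Fintype.card Ω ≤ ∑ ω, ind (A ω t ∧ Disjoint (supp ω) U) := by
      intro t
      have h1 : ∑ ω, ind (A ω t) ≤ ∑ ω, (ind (A ω t ∧ Disjoint (supp ω) U) +
          ind (¬ Disjoint (supp ω) U)) := by
        refine Finset.sum_le_sum fun ω _ => ?_
        by_cases h : Disjoint (supp ω) U
        · have := ind_mono (p := A ω t) (q := A ω t ∧ Disjoint (supp ω) U) (fun h' => ⟨h', h⟩)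
          linarith [ind_nonneg (¬ Disjoint (supp ω) U)]
        · rw [ind_true h]
          linarith [ind_le_one (A ω t), ind_nonneg (A ω t ∧ Disjoint (supp ω) U)]
      rw [Finset.sum_add_distrib] at h1
      linarith [hξ t]
    have hFpos : 0 < ∑ t, f t := Finset.sum_pos (fun t _ => hf0 t) univ_nonempty
    have hΩr : (0:ℝ) < Fintype.card Ω := by exact_mod_cast hΩ
    obtain ⟨ω, hω⟩ : ∃ ω, ξ / 2 * ∑ t, f t ≤ ∑ t, ind (A ω t ∧ Disjoint (supp ω) U) * f t := by
      by_contra hcon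
      push Not at hcon
      have h1 : ∑ ω, ∑ t, ind (A ω t ∧ Disjoint (supp ω) U) * f t
          < ∑ ω : Ω, ξ / 2 * ∑ t, f t := by
        refine Finset.sum_lt_sum_of_nonempty ?_ (fun ω _ => hcon ω)
        rw [Finset.univ_nonempty_iff]
        exact Fintype.card_pos_iff.mp hΩ
      have h2 : ∑ t, ξ / 2 * Fintype.card Ω * f t
          ≤ ∑ ω, ∑ t, ind (A ω t ∧ Disjoint (supp ω) U) * f t := by
        rw [Finset.sum_comm]
        refine Finset.sum_le_sum fun t _ => ?_
        rw [← Finset.sum_mul]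
        exact mul_le_mul_of_nonneg_right (hfree t) (hf0 t).le
      rw [← Finset.mul_sum] at h2
      rw [Finset.sum_const, nsmul_eq_mul, Finset.card_univ] at h1
      nlinarith
    have hex : ∃ t, A ω t ∧ Disjoint (supp ω) U := by
      by_contra hcon
      push Not at hcon
      have : ∑ t, ind (A ω t ∧ Disjoint (supp ω) U) * f t = 0 :=
        Finset.sum_eq_zero fun t _ => by
          rw [ind_false (fun h => hcon t h.1 h.2), zero_mul]
      rw [this] at hω
      have : 0 < ξ / 2 * ∑ t, f t := by positivity
      linarith
    obtain ⟨t0, ht0, hdU⟩ := hex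
    have hdS : ∀ ω' ∈ Sel, Disjoint (supp ω) (supp ω') := by
      intro ω' h'
      rw [hU, Finset.disjoint_biUnion_right] at hdU
      exact hdU ω' h'
    have hnot : ω ∉ Sel := by
      intro hmem
      have h1 := hdS ω hmem
      rw [disjoint_self, Finset.bot_eq_empty] at h1
      have h2 := hne ω t0 ht0
      rw [h1] at h2
      exact Finset.not_nonempty_empty h2
    refine ⟨insert ω Sel, ?_, ?_, ?_, ?_⟩
    · rw [Finset.card_insert_of_notMem hnot, hc]
    · intro ω' h'
      rcases Finset.mem_insert.mp h' with rfl | h'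
      · exact ⟨t0, ht0⟩
      · exact hA ω' h'
    · intro a ha b hb hab
      rcases Finset.mem_insert.mp ha with rfl | ha'
      · rcases Finset.mem_insert.mp hb with rfl | hb'
        · exact absurd rfl hab
        · exact hdS b hb'
      · rcases Finset.mem_insert.mp hb with rfl | hb'
        · exact (hdS a ha').symm
        · exact hdis a ha' b hb' hab
    · have h1 : ∑ t, ∏ ω' ∈ insert ω Sel, (1 - ind (A ω' t) / 2)
          ≤ ∑ t, (f t - 1 / 2 * (ind (A ω t ∧ Disjoint (supp ω) U) * f t)) := by
        refine Finset.sum_le_sum fun t _ => ?_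
        rw [Finset.prod_insert hnot]
        have h3 := ind_mono (p := A ω t ∧ Disjoint (supp ω) U) (q := A ω t) (fun h => h.1)
        have h4 := mul_le_mul_of_nonneg_right h3 (hf0 t).le
        show (1 - ind (A ω t) / 2) * f t ≤ _
        linarith
      rw [Finset.sum_sub_distrib, ← Finset.mul_sum] at h1
      have h5 : ∑ t, f t ≤ Fintype.card T * (1 - ξ / 4) ^ s := hΦ
      have hξ4 : 0 ≤ 1 - ξ / 4 := by
        have h6 := hξ t0
        have h7 : ∑ ω, ind (A ω t0) ≤ ∑ ω : Ω, (1:ℝ) :=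
          Finset.sum_le_sum fun ω _ => ind_le_one _
        simp only [Finset.sum_const, Finset.card_univ, nsmul_eq_mul, mul_one] at h7
        have : ξ ≤ 1 := by
          by_contra hcon
          push Not at hcon
          nlinarith
        linarith
      calc _ ≤ (1 - ξ / 4) * ∑ t, f t := by linarith
        _ ≤ (1 - ξ / 4) * (Fintype.card T * (1 - ξ / 4) ^ s) :=
          mul_le_mul_of_nonneg_left h5 hξ4
        _ = _ := by rw [pow_succ]; ring

end RM

namespace RM
open Finset

/-- Blocks `(u,(c,p,q))`. -/
abbrev Bk (C V : Type) := V × (C × V × V)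

section
variable {C V : Type} [DecidableEq C] [DecidableEq V]

def sb (b : Bk C V) : Finset (C ⊕ V) :=
  {Sum.inl b.2.1, Sum.inr b.1, Sum.inr b.2.2.1, Sum.inr b.2.2.2}

def so (ω : Bk C V × Bk C V × Bk C V) : Finset (C ⊕ V) := sb ω.1 ∪ sb ω.2.1 ∪ sb ω.2.2

def Abs (R : C → V → V → V → Prop) (ω : Bk C V × Bk C V × Bk C V) (t : Bk C V) : Prop :=
  Disjoint (so ω) (sb t) ∧ Mb R (so ω) ∧ Mb R (so ω ∪ sb t)

lemma sb_card (b : Bk C V) : (sb b).card ≤ 4 := by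
  unfold sb
  exact Finset.card_le_four

lemma so_card (ω : Bk C V × Bk C V × Bk C V) : (so ω).card ≤ 12 := by
  unfold so
  have h1 := Finset.card_union_le (sb ω.1 ∪ sb ω.2.1) (sb ω.2.2)
  have h2 := Finset.card_union_le (sb ω.1) (sb ω.2.1)
  have := sb_card ω.1
  have := sb_card ω.2.1
  have := sb_card ω.2.2
  omega

lemma so_nonempty (ω : Bk C V × Bk C V × Bk C V) : (so ω).Nonempty :=
  ⟨Sum.inl ω.1.2.1, by simp [so, sb]⟩

set_option maxHeartbeats 2000000 in
lemma abs_of (R : C → V → V → V → Prop) (hR : ∀ c x y z, R c x y z → x ≠ y ∧ x ≠ z ∧ y ≠ z)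
    (b1 b2 b3 t : Bk C V) (ht : t.1 ≠ t.2.2.1 ∧ t.1 ≠ t.2.2.2 ∧ t.2.2.1 ≠ t.2.2.2)
    (h12 : Disjoint (sb b2) (sb b1)) (h13 : Disjoint (sb b3) (sb b1))
    (h23 : Disjoint (sb b3) (sb b2)) (h1 : Disjoint (sb b1) (sb t)) (h2 : Disjoint (sb b2) (sb t))
    (h3 : Disjoint (sb b3) (sb t))
    (r1 : R b1.2.1 b1.1 b1.2.2.1 b1.2.2.2) (r2 : R b2.2.1 b2.1 b2.2.2.1 b2.2.2.2)
    (r3 : R b3.2.1 b3.1 b3.2.2.1 b3.2.2.2)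
    (s1 : R b1.2.1 t.1 b1.2.2.1 b1.2.2.2) (s2 : R b2.2.1 t.2.2.1 b2.2.2.1 b2.2.2.2)
    (s3 : R b3.2.1 t.2.2.2 b3.2.2.1 b3.2.2.2) (hr : R t.2.1 b1.1 b2.1 b3.1) :
    Abs R (b1, b2, b3) t := by
  have m1 : Mb R (sb b1) := Mb.single r1
  have m2 : Mb R (sb b2) := Mb.single r2
  have m3 : Mb R (sb b3) := Mb.single r3
  refine ⟨?_, ?_, ?_⟩
  · simp only [so]
    rw [Finset.disjoint_union_left, Finset.disjoint_union_left]
    exact ⟨⟨h1, h2⟩, h3⟩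
  · simp only [so]
    refine Mb.union (Mb.union m1 m2 h12.symm) m3 ?_
    rw [Finset.disjoint_union_left]
    exact ⟨h13.symm, h23.symm⟩
  · obtain ⟨u1, c1, p1, q1⟩ := b1
    obtain ⟨u2, c2, p2, q2⟩ := b2
    obtain ⟨u3, c3, p3, q3⟩ := b3
    obtain ⟨v1, c, v2, v3⟩ := t
    have d1 := hR _ _ _ _ r1
    have d2 := hR _ _ _ _ r2
    have d3 := hR _ _ _ _ r3
    have d4 := hR _ _ _ _ hr
    have n1 := Mb.single s1
    have n2 := Mb.single s2
    have n3 := Mb.single s3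
    have n4 := Mb.single hr
    have e : so ((u1, c1, p1, q1), (u2, c2, p2, q2), (u3, c3, p3, q3)) ∪ sb (v1, c, v2, v3)
      = (({Sum.inl c1, Sum.inr v1, Sum.inr p1, Sum.inr q1} ∪
        {Sum.inl c2, Sum.inr v2, Sum.inr p2, Sum.inr q2}) ∪
        {Sum.inl c3, Sum.inr v3, Sum.inr p3, Sum.inr q3}) ∪
        {Sum.inl c, Sum.inr u1, Sum.inr u2, Sum.inr u3} := by
      ext w
      simp only [so, sb, mem_union, mem_insert, mem_singleton]
      apply iff_of_eq
      ac_rfl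
    rw [e]
    simp only [sb, Finset.disjoint_insert_left, Finset.disjoint_singleton_left, mem_insert,
      mem_singleton, not_or, Sum.inl.injEq, Sum.inr.injEq, reduceCtorEq, not_false_eq_true,
      true_and, and_true] at h12 h13 h23 h1 h2 h3
    simp only at d1 d2 d3 d4 ht
    refine Mb.union (Mb.union (Mb.union n1 n2 ?_) n3 ?_) n4 ?_
    all_goals
      simp only [sb, Finset.disjoint_insert_left, Finset.disjoint_singleton_left, mem_insert,
        mem_singleton, not_or, Sum.inl.injEq, Sum.inr.injEq, reduceCtorEq, not_false_eq_true,
        true_and, and_true, Finset.disjoint_union_left]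
      grind

variable [Fintype C] [Fintype V]

lemma sum_bk (f : Bk C V → ℝ) : ∑ b, f b = ∑ u, ∑ c, ∑ p, ∑ q, f (u, c, p, q) := by
  simp only [Fintype.sum_prod_type]

lemma sb_count (m : ℕ) (hC : Fintype.card C = m) (hV : Fintype.card V = 3 * m) (x : C ⊕ V) :
    ∑ b : Bk C V, ind (x ∈ sb b) ≤ 27 * (m:ℝ)^3 := by
  have hVr : (Fintype.card V : ℝ) = 3 * m := by rw [hV]; push_cast; ring
  have hCr : (Fintype.card C : ℝ) = m := by rw [hC]
  rcases x with c | v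
  · have : ∀ b : Bk C V, ind (Sum.inl c ∈ sb b) = ind (b.2.1 = c) * 1 := by
      intro b
      rw [mul_one]
      apply ind_congr
      simp [sb, eq_comm]
    simp only [this]
    rw [sum_bk]
    apply le_of_eq
    calc ∑ u : V, ∑ c' : C, ∑ p : V, ∑ q : V, ind (c' = c) * 1
        = ∑ u : V, ∑ c' : C, ind (c' = c) * (3 * m)^2 := by
          simp only [Finset.sum_const, Finset.card_univ, nsmul_eq_mul, hVr]
          rw [show (∑ c' : C, 3 * (m:ℝ) * (3 * m * (ind (c' = c) * 1)))
            = ∑ c' : C, ind (c' = c) * (3 * m)^2 from Finset.sum_congr rfl fun c' _ => by ring]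
      _ = ∑ u : V, (3 * (m:ℝ))^2 := by
          refine Finset.sum_congr rfl fun _ _ => ?_
          exact sum_ind_eq' c (fun _ => (3 * (m:ℝ))^2)
      _ = _ := by
          simp only [Finset.sum_const, Finset.card_univ, nsmul_eq_mul, hVr]
          ring
  · have h1 : ∀ b : Bk C V, ind (Sum.inr v ∈ sb b) ≤
        ind (b.1 = v) * 1 + (ind (b.2.2.1 = v) * 1 + ind (b.2.2.2 = v) * 1) := by
      intro b
      simp only [mul_one]
      refine le_trans (ind_mono (q := b.1 = v ∨ (b.2.2.1 = v ∨ b.2.2.2 = v)) ?_) ?_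
      · simp [sb, eq_comm]
      · refine le_trans (ind_or_le _ _) ?_
        have := ind_or_le (b.2.2.1 = v) (b.2.2.2 = v)
        linarith
    refine le_trans (Finset.sum_le_sum fun b _ => h1 b) ?_
    rw [Finset.sum_add_distrib, Finset.sum_add_distrib, sum_bk, sum_bk, sum_bk]
    have e1 : ∑ u : V, ∑ c' : C, ∑ p : V, ∑ q : V, ind (u = v) * 1 = m * (3 * m)^2 := by
      simp only [Finset.sum_const, Finset.card_univ, nsmul_eq_mul, hVr, hCr]
      refine Eq.trans (Finset.sum_congr rfl fun x _ => ?_)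
        (sum_ind_eq' v (fun _ => (m:ℝ) * (3 * (m:ℝ))^2))
      ring
    have e2 : ∑ u : V, ∑ c' : C, ∑ p : V, ∑ q : V, ind (p = v) * 1 = m * (3 * m)^2 := by
      have : ∑ p : V, ∑ q : V, ind (p = v) * 1 = 3 * m := by
        simp only [Finset.sum_const, Finset.card_univ, nsmul_eq_mul, hVr]
        refine Eq.trans (Finset.sum_congr rfl fun x _ => ?_)
          (sum_ind_eq' v (fun _ => (3 * (m:ℝ))))
        ring
      rw [this]
      simp only [Finset.sum_const, Finset.card_univ, nsmul_eq_mul, hVr, hCr]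
      ring
    have e3 : ∑ u : V, ∑ c' : C, ∑ p : V, ∑ q : V, ind (q = v) * 1 = m * (3 * m)^2 := by
      have : ∑ q : V, ind (q = v) * 1 = 1 := sum_ind_eq' v (fun _ => (1:ℝ))
      rw [this]
      simp only [Finset.sum_const, Finset.card_univ, nsmul_eq_mul, hVr, hCr]
      ring
    rw [e1, e2, e3]
    apply le_of_eq; ring

lemma sb_bad (m : ℕ) (hC : Fintype.card C = m) (hV : Fintype.card V = 3 * m)
    (Y : Finset (C ⊕ V)) (hY : Y.card ≤ 4) :
    ∑ b : Bk C V, ind (¬ Disjoint (sb b) Y) ≤ 108 * (m:ℝ)^3 := by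
  calc ∑ b : Bk C V, ind (¬ Disjoint (sb b) Y)
      ≤ ∑ b, ∑ x ∈ Y, ind (x ∈ sb b) := by
        refine Finset.sum_le_sum fun ω _ => ?_
        by_cases h : Disjoint (sb ω) Y
        · rw [ind_false (by simpa using h)]
          exact Finset.sum_nonneg fun x _ => ind_nonneg _
        · rw [ind_true h]
          rw [Finset.not_disjoint_iff] at h
          obtain ⟨x, hx, hxU⟩ := h
          calc (1:ℝ) = ind (x ∈ sb ω) := (ind_true hx).symm
            _ ≤ _ := Finset.single_le_sum (f := fun x => ind (x ∈ sb ω))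
              (fun x _ => ind_nonneg _) hxU
    _ = ∑ x ∈ Y, ∑ b, ind (x ∈ sb b) := Finset.sum_comm
    _ ≤ ∑ x ∈ Y, 27 * (m:ℝ)^3 := Finset.sum_le_sum fun x _ => sb_count m hC hV x
    _ = Y.card * (27 * (m:ℝ)^3) := by rw [Finset.sum_const, nsmul_eq_mul]
    _ ≤ 4 * (27 * (m:ℝ)^3) := by
        apply mul_le_mul_of_nonneg_right _ (by positivity)
        exact_mod_cast hY
    _ = _ := by ring

lemma bk_card (m : ℕ) (hC : Fintype.card C = m) (hV : Fintype.card V = 3 * m) :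
    (Fintype.card (Bk C V) : ℝ) = 27 * (m:ℝ)^4 := by
  simp only [Bk, Fintype.card_prod, hC, hV]
  push_cast; ring

lemma main_one (f : V → ℝ) (g : Bk C V → ℝ) (κ : ℝ) (hf : ∀ u, 0 ≤ f u)
    (hg : ∀ u, κ ≤ ∑ r, g (u, r)) : κ * ∑ u, f u ≤ ∑ b, g b * f b.1 := by
  rw [Fintype.sum_prod_type, Finset.mul_sum]
  refine Finset.sum_le_sum fun u _ => ?_
  show κ * f u ≤ ∑ y, g (u, y) * f u
  rw [← Finset.sum_mul]
  exact mul_le_mul_of_nonneg_right (hg u) (hf u)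

lemma main_three (F : V → V → V → ℝ) (g1 g2 g3 : Bk C V → ℝ) (κ : ℝ) (hκ : 0 ≤ κ)
    (hF : ∀ x y z, 0 ≤ F x y z) (h1 : ∀ b, 0 ≤ g1 b) (h2 : ∀ b, 0 ≤ g2 b)
    (k1 : ∀ u, κ ≤ ∑ r, g1 (u, r)) (k2 : ∀ u, κ ≤ ∑ r, g2 (u, r)) (k3 : ∀ u, κ ≤ ∑ r, g3 (u, r)) :
    κ^3 * ∑ x, ∑ y, ∑ z, F x y z ≤ ∑ b1, ∑ b2, ∑ b3, g1 b1 * (g2 b2 * (g3 b3 * F b1.1 b2.1 b3.1)) := by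
  have s3 : ∀ x y, κ * ∑ z, F x y z ≤ ∑ b3, g3 b3 * F x y b3.1 := fun x y =>
    main_one (F x y) g3 κ (hF x y) k3
  have s2 : ∀ x, κ * ∑ y, κ * ∑ z, F x y z ≤ ∑ b2, g2 b2 * ∑ b3, g3 b3 * F x b2.1 b3.1 := by
    intro x
    refine le_trans (main_one (fun y => κ * ∑ z, F x y z) g2 κ
      (fun u => mul_nonneg hκ (Finset.sum_nonneg fun _ _ => hF _ _ _)) k2) ?_
    exact Finset.sum_le_sum fun b _ => mul_le_mul_of_nonneg_left (s3 _ _) (h2 b)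
  have s1 : κ * ∑ x, κ * ∑ y, κ * ∑ z, F x y z
      ≤ ∑ b1, g1 b1 * ∑ b2, g2 b2 * ∑ b3, g3 b3 * F b1.1 b2.1 b3.1 := by
    refine le_trans (main_one (fun x => κ * ∑ y, κ * ∑ z, F x y z) g1 κ
      (fun u => mul_nonneg hκ (Finset.sum_nonneg fun _ _ => mul_nonneg hκ
        (Finset.sum_nonneg fun _ _ => hF _ _ _))) k1) ?_
    exact Finset.sum_le_sum fun b _ => mul_le_mul_of_nonneg_left (s2 _) (h1 b)
  calc κ^3 * ∑ x, ∑ y, ∑ z, F x y z = κ * ∑ x, κ * ∑ y, κ * ∑ z, F x y z := by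
        simp only [Finset.mul_sum]
        refine Finset.sum_congr rfl fun _ _ => Finset.sum_congr rfl fun _ _ =>
          Finset.sum_congr rfl fun _ _ => ?_
        ring
    _ ≤ _ := s1
    _ = _ := by simp only [Finset.mul_sum]

end
end RM

namespace RM
open Finset

section
variable {C V : Type} [DecidableEq C] [DecidableEq V] [Fintype C] [Fintype V]

lemma inner_count (R : C → V → V → V → Prop) (m : ℕ) (hC : Fintype.card C = m)
    (hV : Fintype.card V = 3 * m)
    (hdeg : ∀ c v, (19/36) * (3 * (m:ℝ))^2 ≤ ∑ x, ∑ y, ind (R c v x y)) (u v : V) :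
    (m:ℝ)^3 / 2 ≤ ∑ r : C × V × V, ind (R r.1 v r.2.1 r.2.2) * ind (R r.1 u r.2.1 r.2.2) := by
  have hVr : (Fintype.card V : ℝ) = 3 * m := by rw [hV]; push_cast; ring
  have hCr : (Fintype.card C : ℝ) = m := by rw [hC]
  simp only [Fintype.sum_prod_type]
  have h : ∀ c : C, (m:ℝ)^2/2 ≤ ∑ x, ∑ y, ind (R c v x y) * ind (R c u x y) := by
    intro c
    have h1 : ∑ x : V, ∑ y : V, (ind (R c v x y) + ind (R c u x y) - 1)
        ≤ ∑ x, ∑ y, ind (R c v x y) * ind (R c u x y) := by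
      refine Finset.sum_le_sum fun x _ => Finset.sum_le_sum fun y _ => ?_
      nlinarith [ind_le_one (R c v x y), ind_le_one (R c u x y)]
    simp only [Finset.sum_add_distrib, Finset.sum_sub_distrib, Finset.sum_const,
      Finset.card_univ, nsmul_eq_mul, hVr, mul_one] at h1
    have := hdeg c v
    have := hdeg c u
    linarith
  calc (m:ℝ)^3/2 = ∑ c : C, (m:ℝ)^2/2 := by
        simp only [Finset.sum_const, Finset.card_univ, nsmul_eq_mul, hCr]; ring
    _ ≤ _ := Finset.sum_le_sum fun c _ => h c

set_option maxHeartbeats 2000000 in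
lemma abs_count (R : C → V → V → V → Prop) (hR : ∀ c x y z, R c x y z → x ≠ y ∧ x ≠ z ∧ y ≠ z)
    (m : ℕ) (hm : 700000 ≤ m) (hC : Fintype.card C = m)
    (hV : Fintype.card V = 3 * m)
    (hdeg : ∀ c v, (19/36) * (3 * (m:ℝ))^2 ≤ ∑ x, ∑ y, ind (R c v x y))
    (t : Bk C V) (ht : t.1 ≠ t.2.2.1 ∧ t.1 ≠ t.2.2.2 ∧ t.2.2.1 ≠ t.2.2.2) :
    (1/20000) * (Fintype.card (Bk C V × Bk C V × Bk C V) : ℝ) ≤ ∑ ω, ind (Abs R ω t) := by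
  have hVr : (Fintype.card V : ℝ) = 3 * m := by rw [hV]; push_cast; ring
  have hq := bk_card m hC hV
  have hmr : (700000:ℝ) ≤ m := by exact_mod_cast hm
  set q : ℝ := 27 * (m:ℝ)^4 with hqd
  have hcard : (Fintype.card (Bk C V × Bk C V × Bk C V) : ℝ) = q * (q * q) := by
    rw [Fintype.card_prod (Bk C V) (Bk C V × Bk C V), Fintype.card_prod (Bk C V) (Bk C V),
      Nat.cast_mul, Nat.cast_mul, hq]
  rw [hcard]
  let g : V → Bk C V → ℝ := fun v b =>
    ind (R b.2.1 v b.2.2.1 b.2.2.2) * ind (R b.2.1 b.1 b.2.2.1 b.2.2.2)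
  have hg0 : ∀ v b, 0 ≤ g v b := fun v b => mul_nonneg (ind_nonneg _) (ind_nonneg _)
  have hmain := main_three (fun x y z => ind (R t.2.1 x y z)) (g t.1) (g t.2.2.1) (g t.2.2.2)
    ((m:ℝ)^3/2) (by positivity) (fun _ _ _ => ind_nonneg _) (hg0 _) (hg0 _)
    (fun u => inner_count R m hC hV hdeg u _) (fun u => inner_count R m hC hV hdeg u _)
    (fun u => inner_count R m hC hV hdeg u _)
  have hF : 13.5 * (m:ℝ)^3 ≤ ∑ x, ∑ y, ∑ z, ind (R t.2.1 x y z) := by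
    calc 13.5 * (m:ℝ)^3 ≤ ∑ x : V, (19/36) * (3 * (m:ℝ))^2 := by
          simp only [Finset.sum_const, Finset.card_univ, nsmul_eq_mul, hVr]
          have : (0:ℝ) ≤ (m:ℝ)^3 := by positivity
          nlinarith
      _ ≤ _ := Finset.sum_le_sum fun x _ => hdeg _ x
  let bd : Bk C V → Bk C V → ℝ := fun b b' => ind (¬ Disjoint (sb b) (sb b'))
  have hbd : ∀ b', ∑ b, bd b b' ≤ 108 * (m:ℝ)^3 := fun b' => sb_bad m hC hV (sb b') (sb_card b')
  have hpt : ∀ b1 b2 b3 : Bk C V, g t.1 b1 * (g t.2.2.1 b2 * (g t.2.2.2 b3 *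
      ind (R t.2.1 b1.1 b2.1 b3.1))) ≤ ind (Abs R (b1, b2, b3) t) +
      (bd b1 t + bd b2 t + bd b3 t + bd b2 b1 + bd b3 b1 + bd b3 b2) := by
    intro b1 b2 b3
    have n1 : 0 ≤ bd b1 t := ind_nonneg _
    have n2 : 0 ≤ bd b2 t := ind_nonneg _
    have n3 : 0 ≤ bd b3 t := ind_nonneg _
    have n4 : 0 ≤ bd b2 b1 := ind_nonneg _
    have n5 : 0 ≤ bd b3 b1 := ind_nonneg _
    have n6 : 0 ≤ bd b3 b2 := ind_nonneg _
    have n7 : 0 ≤ ind (Abs R (b1, b2, b3) t) := ind_nonneg _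
    have hle1 : g t.1 b1 * (g t.2.2.1 b2 * (g t.2.2.2 b3 *
      ind (R t.2.1 b1.1 b2.1 b3.1))) = ind ((R b1.2.1 t.1 b1.2.2.1 b1.2.2.2 ∧
        R b1.2.1 b1.1 b1.2.2.1 b1.2.2.2) ∧ (R b2.2.1 t.2.2.1 b2.2.2.1 b2.2.2.2 ∧
        R b2.2.1 b2.1 b2.2.2.1 b2.2.2.2) ∧ (R b3.2.1 t.2.2.2 b3.2.2.1 b3.2.2.2 ∧
        R b3.2.1 b3.1 b3.2.2.1 b3.2.2.2) ∧ R t.2.1 b1.1 b2.1 b3.1) := by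
      simp only [g, ind_and]
    rw [hle1]
    by_cases d1 : Disjoint (sb b1) (sb t)
    swap
    · have : bd b1 t = 1 := ind_true d1
      linarith [ind_le_one ((R b1.2.1 t.1 b1.2.2.1 b1.2.2.2 ∧
        R b1.2.1 b1.1 b1.2.2.1 b1.2.2.2) ∧ (R b2.2.1 t.2.2.1 b2.2.2.1 b2.2.2.2 ∧
        R b2.2.1 b2.1 b2.2.2.1 b2.2.2.2) ∧ (R b3.2.1 t.2.2.2 b3.2.2.1 b3.2.2.2 ∧
        R b3.2.1 b3.1 b3.2.2.1 b3.2.2.2) ∧ R t.2.1 b1.1 b2.1 b3.1)]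
    by_cases hh : ((R b1.2.1 t.1 b1.2.2.1 b1.2.2.2 ∧
        R b1.2.1 b1.1 b1.2.2.1 b1.2.2.2) ∧ (R b2.2.1 t.2.2.1 b2.2.2.1 b2.2.2.2 ∧
        R b2.2.1 b2.1 b2.2.2.1 b2.2.2.2) ∧ (R b3.2.1 t.2.2.2 b3.2.2.1 b3.2.2.2 ∧
        R b3.2.1 b3.1 b3.2.2.1 b3.2.2.2) ∧ R t.2.1 b1.1 b2.1 b3.1)
    swap
    · rw [ind_false hh]; linarith
    rw [ind_true hh]
    by_cases d2 : Disjoint (sb b2) (sb t)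
    swap
    · have : bd b2 t = 1 := ind_true d2
      linarith
    by_cases d3 : Disjoint (sb b3) (sb t)
    swap
    · have : bd b3 t = 1 := ind_true d3
      linarith
    by_cases d4 : Disjoint (sb b2) (sb b1)
    swap
    · have : bd b2 b1 = 1 := ind_true d4
      linarith
    by_cases d5 : Disjoint (sb b3) (sb b1)
    swap
    · have : bd b3 b1 = 1 := ind_true d5
      linarith
    by_cases d6 : Disjoint (sb b3) (sb b2)
    swap
    · have : bd b3 b2 = 1 := ind_true d6
      linarith
    obtain ⟨⟨r1, r1'⟩, ⟨r2, r2'⟩, ⟨r3, r3'⟩, r4⟩ := hh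
    rw [ind_true (abs_of R hR b1 b2 b3 t ht d4 d5 d6 d1 d2 d3 r1' r2' r3' r1 r2 r3 r4)]
    linarith
  have hsum := Finset.sum_le_sum fun b1 (_ : b1 ∈ univ) => Finset.sum_le_sum
    fun b2 (_ : b2 ∈ univ) => Finset.sum_le_sum fun b3 (_ : b3 ∈ univ) => hpt b1 b2 b3
  simp only [Finset.sum_add_distrib, Finset.sum_const, Finset.card_univ, nsmul_eq_mul, hq] at hsum
  have hω : ∑ ω, ind (Abs R ω t) = ∑ b1, ∑ b2, ∑ b3, ind (Abs R (b1, b2, b3) t) := by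
    simp only [Fintype.sum_prod_type (α₁ := Bk C V)]
  have hq0 : 0 ≤ q := by rw [hqd]; positivity
  have t1 : ∑ x, q * (q * bd x t) ≤ q * (q * (108 * (m:ℝ)^3)) := by
    rw [← Finset.mul_sum, ← Finset.mul_sum]
    gcongr
    exact hbd t
  have t2 : q * ∑ x, q * bd x t ≤ q * (q * (108 * (m:ℝ)^3)) := by
    rw [← Finset.mul_sum]
    gcongr
    exact hbd t
  have t3 : q * (q * ∑ x, bd x t) ≤ q * (q * (108 * (m:ℝ)^3)) := by
    gcongr
    exact hbd t
  have u1 : ∑ b' : Bk C V, (108 * (m:ℝ)^3) = q * (108 * (m:ℝ)^3) := by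
    simp only [Finset.sum_const, Finset.card_univ, nsmul_eq_mul, hq]
  have t4 : ∑ x, ∑ y, q * bd y x ≤ q * (q * (108 * (m:ℝ)^3)) := by
    rw [← u1, Finset.mul_sum]
    refine Finset.sum_le_sum fun x _ => ?_
    rw [← Finset.mul_sum]
    exact mul_le_mul_of_nonneg_left (hbd x) hq0
  have t5 : ∑ x, q * ∑ y, bd y x ≤ q * (q * (108 * (m:ℝ)^3)) := by
    rw [← u1, Finset.mul_sum]
    refine Finset.sum_le_sum fun x _ => ?_
    exact mul_le_mul_of_nonneg_left (hbd x) hq0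
  have t6 : q * ∑ x, ∑ y, bd y x ≤ q * (q * (108 * (m:ℝ)^3)) := by
    rw [← u1]
    refine mul_le_mul_of_nonneg_left (Finset.sum_le_sum fun x _ => hbd x) hq0
  rw [← hω] at hsum
  have hmain2 : ((m:ℝ)^3/2)^3 * (13.5 * (m:ℝ)^3) ≤ ((m:ℝ)^3/2)^3 *
      ∑ x, ∑ y, ∑ z, ind (R t.2.1 x y z) := mul_le_mul_of_nonneg_left hF (by positivity)
  have hfin : (1/20000) * (q * (q * q)) + 6 * (q * (q * (108 * (m:ℝ)^3)))
      ≤ ((m:ℝ)^3/2)^3 * (13.5 * (m:ℝ)^3) := by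
    rw [hqd]
    have h11 : (0:ℝ) ≤ (m:ℝ)^11 := by positivity
    have h12 : 700000 * (m:ℝ)^11 ≤ m * (m:ℝ)^11 := mul_le_mul_of_nonneg_right hmr h11
    have e1 : (1/20000) * (27 * (m:ℝ)^4 * (27 * (m:ℝ)^4 * (27 * (m:ℝ)^4)))
      + 6 * (27 * (m:ℝ)^4 * (27 * (m:ℝ)^4 * (108 * (m:ℝ)^3)))
      = 19683/20000 * (m * (m:ℝ)^11) + 472392 * (m:ℝ)^11 := by ring
    have e2 : ((m:ℝ)^3/2)^3 * (13.5 * (m:ℝ)^3) = 13.5/8 * (m * (m:ℝ)^11) := by ring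
    rw [e1, e2]
    linarith
  linarith

lemma so_count (m : ℕ) (hm : 0 < m) (hC : Fintype.card C = m) (hV : Fintype.card V = 3 * m)
    (x : C ⊕ V) :
    ∑ ω : Bk C V × Bk C V × Bk C V, ind (x ∈ so ω) ≤
      3 / m * (Fintype.card (Bk C V × Bk C V × Bk C V) : ℝ) := by
  have hq := bk_card m hC hV
  have hc := sb_count m hC hV x
  have hmr : (0:ℝ) < m := by exact_mod_cast hm
  have hcard : (Fintype.card (Bk C V × Bk C V × Bk C V) : ℝ)
      = (27 * (m:ℝ)^4) * ((27 * (m:ℝ)^4) * (27 * (m:ℝ)^4)) := by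
    rw [Fintype.card_prod (Bk C V) (Bk C V × Bk C V), Fintype.card_prod (Bk C V) (Bk C V),
      Nat.cast_mul, Nat.cast_mul, hq]
  have h1 : ∀ ω : Bk C V × Bk C V × Bk C V, ind (x ∈ so ω) ≤
      ind (x ∈ sb ω.1) + ind (x ∈ sb ω.2.1) + ind (x ∈ sb ω.2.2) := by
    intro ω
    refine le_trans (ind_mono (q := (x ∈ sb ω.1 ∨ x ∈ sb ω.2.1) ∨ x ∈ sb ω.2.2) ?_) ?_
    · simp [so, or_assoc]
    · have := ind_or_le (x ∈ sb ω.1 ∨ x ∈ sb ω.2.1) (x ∈ sb ω.2.2)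
      have := ind_or_le (x ∈ sb ω.1) (x ∈ sb ω.2.1)
      linarith
  refine le_trans (Finset.sum_le_sum fun ω _ => h1 ω) ?_
  simp only [Finset.sum_add_distrib]
  simp only [Fintype.sum_prod_type (α₁ := Bk C V), Finset.sum_const, Finset.card_univ,
    nsmul_eq_mul, hq, ← Finset.mul_sum]
  rw [hcard]
  have e : 3 / (m:ℝ) * ((27 * (m:ℝ)^4) * ((27 * (m:ℝ)^4) * (27 * (m:ℝ)^4)))
      = 3 * ((27 * (m:ℝ)^4) * ((27 * (m:ℝ)^4) * (27 * (m:ℝ)^3))) := by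
    field_simp
  have hh : (27 * (m:ℝ)^4) * ((27 * (m:ℝ)^4) * ∑ b : Bk C V, ind (x ∈ sb b)) ≤
      (27 * (m:ℝ)^4) * ((27 * (m:ℝ)^4) * (27 * (m:ℝ)^3)) := by gcongr
  rw [e]
  linarith

end
end RM

namespace RM
open Finset

section
variable {C V : Type} [DecidableEq C] [DecidableEq V]

lemma Mb.card {R : C → V → V → V → Prop} (hR : ∀ c x y z, R c x y z → x ≠ y ∧ x ≠ z ∧ y ≠ z)
    {P : Finset (C ⊕ V)} (h : Mb R P) : P.toRight.card = 3 * P.toLeft.card := by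
  induction h with
  | nil => rfl
  | cons c x y z P h hc hx hy hz hP ih =>
    obtain ⟨d1, d2, d3⟩ := hR _ _ _ _ h
    rw [Finset.toRight_union, Finset.toLeft_union]
    have e1 : ({Sum.inl c, Sum.inr x, Sum.inr y, Sum.inr z} : Finset (C ⊕ V)).toRight = {x, y, z} := by
      ext w; simp
    have e2 : ({Sum.inl c, Sum.inr x, Sum.inr y, Sum.inr z} : Finset (C ⊕ V)).toLeft = {c} := by
      ext w; simp
    rw [e1, e2, Finset.card_union_of_disjoint, Finset.card_union_of_disjoint, ih]
    · rw [Finset.card_eq_three.mpr ⟨x, y, z, d1, d2, d3, rfl⟩]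
      simp; ring
    · simpa using hc
    · simp [hx, hy, hz]

lemma absorb_ind (R : C → V → V → V → Prop) (l : ℕ) :
    ∀ (Sel : Finset (Bk C V × Bk C V × Bk C V)) (Q : Finset (C ⊕ V)),
    (∀ ω ∈ Sel, ∀ ω' ∈ Sel, ω ≠ ω' → Disjoint (so ω) (so ω')) → (∀ ω ∈ Sel, Mb R (so ω)) →
    (∀ ω ∈ Sel, Disjoint (so ω) Q) → Q.toLeft.card = l → Q.toRight.card = 3 * l →
    (∀ t : Bk C V, t.1 ≠ t.2.2.1 ∧ t.1 ≠ t.2.2.2 ∧ t.2.2.1 ≠ t.2.2.2 →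
      ∃ A ⊆ Sel, A.card = l ∧ ∀ ω ∈ A, Abs R ω t) →
    Mb R (Sel.biUnion so ∪ Q) := by
  classical
  induction l with
  | zero =>
    intro Sel Q hd hM hQ hl hr hA
    have : Q = ∅ := by
      rw [← Finset.card_eq_zero, ← Finset.card_toLeft_add_card_toRight]; omega
    rw [this, Finset.union_empty]
    exact Mb.biUnion Sel so hM hd
  | succ l ih =>
    intro Sel Q hd hM hQ hl hr hA
    obtain ⟨c, hc⟩ : Q.toLeft.Nonempty := by rw [← Finset.card_pos]; omega
    obtain ⟨S3, hS3, hS3c⟩ := Finset.exists_subset_card_eq (s := Q.toRight) (n := 3) (by omega)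
    obtain ⟨x, y, z, d1, d2, d3, rfl⟩ := Finset.card_eq_three.mp hS3c
    have htQ : sb ((x, c, y, z) : Bk C V) ⊆ Q := by
      intro w hw
      have hx := hS3 (show x ∈ ({x, y, z} : Finset V) by simp)
      have hy := hS3 (show y ∈ ({x, y, z} : Finset V) by simp)
      have hz := hS3 (show z ∈ ({x, y, z} : Finset V) by simp)
      simp only [Finset.mem_toRight, Finset.mem_toLeft] at hx hy hz hc
      simp only [sb, mem_insert, mem_singleton] at hw
      rcases hw with rfl | rfl | rfl | rfl <;> assumption
    obtain ⟨A, hAS, hAc, hAA⟩ := hA (x, c, y, z) ⟨d1, d2, d3⟩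
    obtain ⟨ω, hω⟩ : A.Nonempty := by rw [← Finset.card_pos]; omega
    have hab := hAA ω hω
    have hωS := hAS hω
    have e1 : (sb ((x, c, y, z) : Bk C V)).toRight = {x, y, z} := by
      ext w; simp [sb]
    have e2 : (sb ((x, c, y, z) : Bk C V)).toLeft = {c} := by
      ext w; simp [sb]
    have key := ih (Sel.erase ω) (Q \ sb (x, c, y, z))
      (fun a ha b hb hab => hd a (Finset.mem_of_mem_erase ha) b (Finset.mem_of_mem_erase hb) hab)
      (fun a ha => hM a (Finset.mem_of_mem_erase ha))
      (fun a ha => (hQ a (Finset.mem_of_mem_erase ha)).mono_right Finset.sdiff_subset)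
      (by
        rw [Finset.toLeft_sdiff, e2, Finset.card_sdiff_of_subset (by simpa using hc), hl]
        simp)
      (by
        rw [Finset.toRight_sdiff, e1, Finset.card_sdiff_of_subset hS3, hr, hS3c]
        omega)
      (by
        intro t ht
        obtain ⟨A', h1, h2, h3⟩ := hA t ht
        by_cases hm : ω ∈ A'
        · refine ⟨A'.erase ω, Finset.erase_subset_erase _ h1, ?_, fun a ha =>
            h3 a (Finset.mem_of_mem_erase ha)⟩
          rw [Finset.card_erase_of_mem hm, h2]; simp
        · obtain ⟨A'', h4, h5⟩ := Finset.exists_subset_card_eq (s := A') (n := l) (by omega)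
          refine ⟨A'', ?_, h5, fun a ha => h3 a (h4 ha)⟩
          intro a ha
          refine Finset.mem_erase.mpr ⟨?_, h1 (h4 ha)⟩
          rintro rfl
          exact hm (h4 ha))
    have e : Sel.biUnion so ∪ Q = (so ω ∪ sb (x, c, y, z)) ∪
        ((Sel.erase ω).biUnion so ∪ (Q \ sb (x, c, y, z))) := by
      conv_lhs => rw [← Finset.insert_erase hωS, Finset.biUnion_insert,
        ← Finset.union_sdiff_of_subset htQ]
      ext w
      simp only [mem_union]
      tauto
    rw [e]
    refine Mb.union hab.2.2 key ?_
    rw [Finset.disjoint_union_left, Finset.disjoint_union_right, Finset.disjoint_union_right]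
    refine ⟨⟨?_, ?_⟩, ?_, Finset.disjoint_sdiff⟩
    · rw [Finset.disjoint_biUnion_right]
      intro a ha
      exact hd ω hωS a (Finset.mem_of_mem_erase ha) (Finset.ne_of_mem_erase ha).symm
    · exact (hQ ω hωS).mono_right Finset.sdiff_subset
    · rw [Finset.disjoint_biUnion_right]
      intro a ha
      exact ((hQ a (Finset.mem_of_mem_erase ha)).mono_right htQ).symm

end

lemma num_abs (ξ β κ : ℝ) (m s X : ℕ) (hξ : 0 < ξ) (hξ1 : ξ ≤ 1) (hβ : 0 < β)
    (hκ : κ = ξ * β / 96) (hs : β * m / 12 - 1 ≤ s) (hX : (X:ℝ) ≤ κ * m)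
    (hm : 27 * 3 * 120 / κ^5 < m)
    (h : (1/2 : ℝ)^X ≤ 27 * (m:ℝ)^4 * (1 - ξ / 4)^s) : False := by
  have hκ0 : 0 < κ := by rw [hκ]; positivity
  have hm0 : (0:ℝ) < m := lt_of_le_of_lt (by positivity) hm
  have h1 : Real.exp (-(κ * m)) ≤ (1/2:ℝ)^X := by
    have : Real.exp (-1) ≤ 1/2 := by
      have := Real.exp_one_gt_d9
      rw [Real.exp_neg, inv_eq_one_div]
      apply one_div_le_one_div_of_le <;> linarith
    calc Real.exp (-(κ * m)) ≤ Real.exp (-(X:ℝ)) := by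
          apply Real.exp_le_exp.mpr; linarith
      _ = (Real.exp (-1))^X := by rw [← Real.exp_nat_mul]; congr 1; ring
      _ ≤ (1/2)^X := pow_le_pow_left₀ (Real.exp_nonneg _) this X
  have h2 : (1 - ξ/4)^s ≤ Real.exp (-(ξ/4 * s)) := by
    calc (1 - ξ/4)^s ≤ (Real.exp (-(ξ/4)))^s := by
          apply pow_le_pow_left₀ (by linarith)
          have := Real.add_one_le_exp (-(ξ/4)); linarith
      _ = _ := by rw [← Real.exp_nat_mul]; congr 1; ring
  have h3 : -(ξ/4 * s) ≤ 1 - 2 * (κ * m) := by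
    have : ξ/4 * (β * m / 12 - 1) ≤ ξ/4 * s := mul_le_mul_of_nonneg_left hs (by linarith)
    have e : ξ/4 * (β * m / 12 - 1) = 2 * (κ * m) - ξ/4 := by rw [hκ]; ring
    linarith
  have h4 : Real.exp (-(κ * m)) ≤ 27 * (m:ℝ)^4 * Real.exp (1 - 2 * (κ * m)) := by
    refine h1.trans (h.trans ?_)
    gcongr
    exact h2.trans (Real.exp_le_exp.mpr h3)
  have h5 : Real.exp (κ * m) ≤ 27 * (m:ℝ)^4 * Real.exp 1 := by
    have := mul_le_mul_of_nonneg_right h4 (Real.exp_nonneg (2 * (κ * m)))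
    rw [← Real.exp_add, mul_assoc, ← Real.exp_add] at this
    have e1 : -(κ * m) + 2 * (κ * m) = κ * m := by ring
    have e2 : 1 - 2 * (κ * m) + 2 * (κ * m) = 1 := by ring
    rw [e1, e2] at this
    exact this
  have h6 : (κ * m)^5 / 120 ≤ Real.exp (κ * m) := by
    have := Real.pow_div_factorial_le_exp (κ * m) (by positivity) 5
    norm_num [Nat.factorial] at this
    linarith
  have h7 : Real.exp 1 ≤ 3 := by linarith [Real.exp_one_lt_d9]
  have h8 : (κ * m)^5 / 120 ≤ 27 * (m:ℝ)^4 * 3 := by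
    refine h6.trans (h5.trans ?_)
    gcongr
  rw [div_lt_iff₀ (by positivity)] at hm
  have h9 : 27 * 3 * 120 * (m:ℝ)^4 < m * κ^5 * (m:ℝ)^4 :=
    mul_lt_mul_of_pos_right hm (by positivity)
  have h10 : (κ * m)^5 = m * κ^5 * (m:ℝ)^4 := by ring
  linarith

lemma phi_count {Ω T : Type*} [Fintype T] (Sel : Finset Ω) (A : Ω → T → Prop) (t : T)
    [DecidablePred (fun ω => A ω t)] :
    (1/2:ℝ)^(Sel.filter (fun ω => A ω t)).card ≤ ∑ t, ∏ ω ∈ Sel, (1 - ind (A ω t) / 2) := by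
  have h1 : (1/2:ℝ)^(Sel.filter (fun ω => A ω t)).card = ∏ ω ∈ Sel, (1 - ind (A ω t) / 2) := by
    rw [Finset.card_filter, ← Finset.prod_pow_eq_pow_sum]
    refine Finset.prod_congr rfl fun ω _ => ?_
    by_cases h : A ω t
    · rw [ind_true h, if_pos h]; norm_num
    · rw [ind_false h, if_neg h]; norm_num
  rw [h1]
  refine Finset.single_le_sum (f := fun t : T => ∏ ω ∈ Sel, (1 - ind (A ω t) / 2))
    (fun t _ => Finset.prod_nonneg fun ω _ => ?_) (Finset.mem_univ t)
  have := ind_le_one (A ω t)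
  linarith

set_option maxHeartbeats 2000000 in
theorem absorb (β : ℝ) (hβ : 0 < β) (hβ1 : β ≤ 1/200000) :
    ∃ κ : ℝ, 0 < κ ∧ ∃ m0 : ℕ, ∀ (C V : Type) [Fintype C] [Fintype V] [DecidableEq C]
      [DecidableEq V] (R : C → V → V → V → Prop) (m : ℕ),
      (∀ c x y z, R c x y z → x ≠ y ∧ x ≠ z ∧ y ≠ z) →
      m0 ≤ m → Fintype.card C = m → Fintype.card V = 3 * m →
      (∀ c v, (19/36) * (3 * (m:ℝ))^2 ≤ ∑ x, ∑ y, ind (R c v x y)) →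
      ∃ P : Finset (C ⊕ V), Mb R P ∧ (P.card : ℝ) ≤ β * m ∧
        ∀ Q : Finset (C ⊕ V), Disjoint P Q → Q.toRight.card = 3 * Q.toLeft.card →
          (Q.card : ℝ) ≤ κ * m → Mb R (P ∪ Q) := by
  classical
  set ξ : ℝ := 1/20000 with hξd
  set κ : ℝ := ξ * β / 96 with hκd
  have hκ0 : 0 < κ := by rw [hκd, hξd]; positivity
  obtain ⟨m1, hm1⟩ := exists_nat_gt (27 * 3 * 120 / κ^5)
  refine ⟨κ, hκ0, max m1 700000, ?_⟩
  intro C V _ _ _ _ R m hR hm hC hV hdeg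
  have hm7 : 700000 ≤ m := le_trans (le_max_right _ _) hm
  have hmm : 27 * 3 * 120 / κ^5 < m := hm1.trans_le (by exact_mod_cast le_trans (le_max_left _ _) hm)
  have hmr : (700000:ℝ) ≤ m := by exact_mod_cast hm7
  let T := {t : Bk C V // t.1 ≠ t.2.2.1 ∧ t.1 ≠ t.2.2.2 ∧ t.2.2.1 ≠ t.2.2.2}
  have hTne : Nonempty T := by
    obtain ⟨c⟩ : Nonempty C := Fintype.card_pos_iff.mp (by omega)
    obtain ⟨S3, -, hS3c⟩ := Finset.exists_subset_card_eq (s := (univ : Finset V)) (n := 3)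
      (by rw [Finset.card_univ]; omega)
    obtain ⟨x, y, z, d1, d2, d3, -⟩ := Finset.card_eq_three.mp hS3c
    exact ⟨⟨(x, c, y, z), d1, d2, d3⟩⟩
  have hTc : (Fintype.card T : ℝ) ≤ 27 * (m:ℝ)^4 := by
    rw [← bk_card m hC hV]
    exact_mod_cast Fintype.card_subtype_le _
  set s : ℕ := ⌊β * m / 12⌋₊ with hsd
  have hs1 : (s:ℝ) ≤ β * m / 12 := Nat.floor_le (by positivity)
  have hs2 : β * m / 12 - 1 ≤ s := (Nat.sub_one_lt_floor _).le
  have hΩ : 0 < Fintype.card (Bk C V × Bk C V × Bk C V) := by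
    have hb : 0 < Fintype.card (Bk C V) := by
      have h1 := bk_card m hC hV
      have : (0:ℝ) < Fintype.card (Bk C V) := by rw [h1]; positivity
      exact_mod_cast this
    rw [Fintype.card_prod (Bk C V) (Bk C V × Bk C V), Fintype.card_prod (Bk C V) (Bk C V)]
    positivity
  obtain ⟨Sel, hc, hA, hdis, hΦ⟩ := greedy (T := T) (so (C := C) (V := V))
    (fun ω t => Abs R ω t.1) ξ (3 / m) 12 (by rw [hξd]; norm_num) (by positivity) hΩ hTne
    (fun t => abs_count R hR m hm7 hC hV hdeg t.1 t.2) so_card (fun ω _ _ => so_nonempty ω)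
    (so_count m (by omega) hC hV) s (by
      have : (s:ℝ) * (3/m) ≤ β / 4 := by
        calc (s:ℝ) * (3/m) ≤ (β * m / 12) * (3 / m) := by gcongr
          _ = β / 4 := by field_simp; norm_num
      rw [hξd]; push_cast; linarith)
  have hM : ∀ ω ∈ Sel, Mb R (so ω) := by
    intro ω hω
    obtain ⟨t, ht⟩ := hA ω hω
    exact ht.2.1
  refine ⟨Sel.biUnion so, Mb.biUnion Sel so hM hdis, ?_, ?_⟩
  · have h1 : (Sel.biUnion so).card ≤ s * 12 := by
      rw [← hc]
      exact Finset.card_biUnion_le_card_mul _ _ _ (fun ω _ => so_card ω)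
    have h2 : ((Sel.biUnion so).card : ℝ) ≤ s * 12 := by exact_mod_cast h1
    linarith
  · intro Q hPQ hbal hQ
    refine absorb_ind R Q.toLeft.card Sel Q hdis hM ?_ rfl hbal ?_
    · intro ω hω
      rw [Finset.disjoint_biUnion_left] at hPQ
      exact hPQ ω hω
    · intro t ht
      set A := Sel.filter (fun ω => Abs R ω t) with hAd
      have hl : Q.toLeft.card ≤ A.card := by
        by_contra hcon
        push Not at hcon
        have hXle : (A.card : ℝ) ≤ κ * m := by
          refine le_trans ?_ hQ
          have : A.card ≤ Q.card := by
            have := Finset.card_toLeft_add_card_toRight (u := Q)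
            omega
          exact_mod_cast this
        have h2 := phi_count (T := T) Sel (fun ω t => Abs R ω t.1) ⟨t, ht⟩
        refine num_abs ξ β κ m s A.card (by rw [hξd]; norm_num) (by rw [hξd]; norm_num) hβ hκd hs2
          hXle hmm ?_
        refine h2.trans (hΦ.trans ?_)
        refine mul_le_mul_of_nonneg_right hTc ?_
        apply pow_nonneg
        rw [hξd]; norm_num
      obtain ⟨A', h1, h2⟩ := Finset.exists_subset_card_eq hl
      refine ⟨A', h1.trans (Finset.filter_subset _ _), h2, fun ω hω => ?_⟩
      exact (Finset.mem_filter.mp (h1 hω)).2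

end RM

namespace RM
open Finset

lemma Mb.map {C V C' V' : Type} [DecidableEq C] [DecidableEq V] [DecidableEq C'] [DecidableEq V']
    {R : C → V → V → V → Prop} (f : C' → C) (g : V' → V) (hf : Function.Injective f)
    (hg : Function.Injective g) {P : Finset (C' ⊕ V')}
    (h : Mb (fun c x y z => R (f c) (g x) (g y) (g z)) P) :
    Mb R (P.image (Sum.map f g)) := by
  have hinj : Function.Injective (Sum.map f g) := Sum.map_injective.mpr ⟨hf, hg⟩
  induction h with
  | nil => exact Mb.nil
  | cons c x y z P h hc hx hy hz hP ih =>
    rw [Finset.image_union]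
    have e : ({Sum.inl c, Sum.inr x, Sum.inr y, Sum.inr z} : Finset (C' ⊕ V')).image (Sum.map f g)
      = {Sum.inl (f c), Sum.inr (g x), Sum.inr (g y), Sum.inr (g z)} := by
      simp [Finset.image_insert]
    rw [e]
    refine Mb.cons _ _ _ _ _ h ?_ ?_ ?_ ?_ ih
    · intro hmem
      apply hc
      exact (Function.Injective.mem_finset_image hinj).mp hmem
    · intro hmem
      apply hx
      exact (Function.Injective.mem_finset_image hinj).mp hmem
    · intro hmem
      apply hy
      exact (Function.Injective.mem_finset_image hinj).mp hmem
    · intro hmem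
      apply hz
      exact (Function.Injective.mem_finset_image hinj).mp hmem

lemma sum4_sub {C V : Type*} [Fintype C] [Fintype V] (p : C → Prop) (q : V → Prop)
    [Fintype {c // p c}] [Fintype {v // q v}] (f : C → V → V → V → ℝ) :
    ∑ c : {c // p c}, ∑ x : {v // q v}, ∑ y : {v // q v}, ∑ z : {v // q v}, f c.1 x.1 y.1 z.1
    = ∑ c, ∑ x, ∑ y, ∑ z, ind (p c) * (ind (q x) * (ind (q y) * (ind (q z) * f c x y z))) := by
  rw [sum_subtype_ind p (fun c => ∑ x : {v // q v}, ∑ y : {v // q v}, ∑ z : {v // q v},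
    f c x.1 y.1 z.1)]
  refine Finset.sum_congr rfl fun c _ => ?_
  rw [sum_subtype_ind q (fun x => ∑ y : {v // q v}, ∑ z : {v // q v}, f c x y.1 z.1),
    Finset.mul_sum]
  refine Finset.sum_congr rfl fun x _ => ?_
  rw [sum_subtype_ind q (fun y => ∑ z : {v // q v}, f c x y z.1), Finset.mul_sum,
    Finset.mul_sum]
  refine Finset.sum_congr rfl fun y _ => ?_
  rw [sum_subtype_ind q (fun z => f c x y z), Finset.mul_sum, Finset.mul_sum, Finset.mul_sum]

lemma sum2_sub {V : Type*} [Fintype V] (q : V → Prop)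
    [Fintype {v // q v}] (f : V → V → ℝ) :
    ∑ x : {v // q v}, ∑ y : {v // q v}, f x.1 y.1
    = ∑ x, ∑ y, (ind (q x) * (ind (q y) * f x y)) := by
  rw [sum_subtype_ind q (fun x => ∑ y : {v // q v}, f x y.1)]
  refine Finset.sum_congr rfl fun x _ => ?_
  rw [sum_subtype_ind q (fun y => f x y), Finset.mul_sum]

lemma sum4_add {C V : Type*} [Fintype C] [Fintype V] (T : C → V → V → V → ℝ) (a : C → ℝ)
    (b : V → ℝ) : ∑ c, ∑ x, ∑ y, ∑ z, (T c x y z + a c + b x + b y + b z)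
    = ∑ c, ∑ x, ∑ y, ∑ z, T c x y z + (Fintype.card V)^3 * ∑ c, a c
      + 3 * (Fintype.card C * (Fintype.card V)^2 * ∑ x, b x) := by
  simp only [Finset.sum_add_distrib, Finset.sum_const, Finset.card_univ, nsmul_eq_mul,
    ← Finset.mul_sum]
  ring

lemma drop_pt (p r : Prop) (i1 i2 i3 s1 s2 s3 t1 t2 t3 : Prop) :
    ind r * (ind (¬ s1) * ind (¬ s2) * ind (¬ s3)) ≤
     ind (¬ p) * (ind (¬ i1) * (ind (¬ i2) * (ind (¬ i3) *
      (ind r * (ind (¬ t1) * ind (¬ t2) * ind (¬ t3)))))) + ind p + (ind i1 + ind (t1 ∧ ¬ s1))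
      + (ind i2 + ind (t2 ∧ ¬ s2)) + (ind i3 + ind (t3 ∧ ¬ s3)) := by
  by_cases hL : r ∧ ¬ s1 ∧ ¬ s2 ∧ ¬ s3
  swap
  · have e : ind r * (ind (¬ s1) * ind (¬ s2) * ind (¬ s3)) = 0 := by
      rw [← ind_and, ← ind_and, ← ind_and]
      exact ind_false (by tauto)
    rw [e]
    have := ind_nonneg p
    have := ind_nonneg i1
    have := ind_nonneg i2
    have := ind_nonneg i3
    have := ind_nonneg (t1 ∧ ¬ s1)
    have := ind_nonneg (t2 ∧ ¬ s2)
    have := ind_nonneg (t3 ∧ ¬ s3)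
    have : 0 ≤ ind (¬ p) * (ind (¬ i1) * (ind (¬ i2) * (ind (¬ i3) *
      (ind r * (ind (¬ t1) * ind (¬ t2) * ind (¬ t3)))))) := by
      rw [← ind_and, ← ind_and, ← ind_and, ← ind_and, ← ind_and, ← ind_and, ← ind_and]
      exact ind_nonneg _
    linarith
  obtain ⟨hr, h1, h2, h3⟩ := hL
  have e1 : ind (t1 ∧ ¬ s1) = ind t1 := ind_congr (by tauto)
  have e2 : ind (t2 ∧ ¬ s2) = ind t2 := ind_congr (by tauto)
  have e3 : ind (t3 ∧ ¬ s3) = ind t3 := ind_congr (by tauto)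
  rw [e1, e2, e3, ind_true hr, ind_true h1, ind_true h2, ind_true h3]
  have g : ∀ X : ℝ, 0 ≤ X → X ≤ 1 → ∀ q : Prop, X ≤ ind (¬ q) * X + ind q := by
    intro X h0 h1 q
    by_cases hq : q
    · rw [ind_false (by simpa using hq), ind_true hq]; linarith
    · rw [ind_true hq, ind_false hq]; linarith
  have b1 : ∀ q : Prop, ∀ X : ℝ, 0 ≤ X → X ≤ 1 → 0 ≤ ind (¬ q) * X ∧ ind (¬ q) * X ≤ 1 := by
    intro q X h0 h1
    exact ⟨mul_nonneg (ind_nonneg _) h0, mul_le_one₀ (ind_le_one _) h0 h1⟩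
  set Y0 : ℝ := 1 with hY0
  have c1 := b1 t3 Y0 (by norm_num) (by norm_num)
  have c2 := b1 t2 _ c1.1 c1.2
  have c3 := b1 t1 _ c2.1 c2.2
  have c4 := b1 i3 _ c3.1 c3.2
  have c5 := b1 i2 _ c4.1 c4.2
  have c6 := b1 i1 _ c5.1 c5.2
  have d0 := g Y0 (by norm_num) (by norm_num) t3
  have d1 := g _ c1.1 c1.2 t2
  have d2 := g _ c2.1 c2.2 t1
  have d3 := g _ c3.1 c3.2 i3
  have d4 := g _ c4.1 c4.2 i2
  have d5 := g _ c5.1 c5.2 i1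
  have d6 := g _ c6.1 c6.2 p
  have ef : ind (¬ p) * (ind (¬ i1) * (ind (¬ i2) * (ind (¬ i3) *
      (Y0 * (ind (¬ t1) * ind (¬ t2) * ind (¬ t3)))))) = ind (¬ p) * (ind (¬ i1) * (ind (¬ i2) *
      (ind (¬ i3) * (ind (¬ t1) * (ind (¬ t2) * (ind (¬ t3) * Y0)))))) := by ring
  have e0 : Y0 * (Y0 * Y0 * Y0) = Y0 := by rw [hY0]; norm_num
  rw [ef, e0]
  linarith

set_option maxHeartbeats 4000000 in
theorem nonext (γ : ℝ) (hγ : 0 < γ) (hγ1 : γ ≤ 1) :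
    ∃ m0 : ℕ, ∀ (C V : Type) [Fintype C] [Fintype V] [DecidableEq C]
      [DecidableEq V] (R : C → V → V → V → Prop) (m : ℕ),
      (∀ c x y z, R c x y z → x ≠ y ∧ x ≠ z ∧ y ≠ z) →
      m0 ≤ m → Fintype.card C = m → Fintype.card V = 3 * m →
      (∀ c v, 5 * (m:ℝ)^2 - 7 * m ≤ ∑ x, ∑ y, ind (R c v x y)) →
      (∀ S : Finset V, S.card = m → γ * (m:ℝ)^4 ≤ ∑ c, ∑ x, ∑ y, ∑ z, ind (R c x y z) *
          (ind (¬ x ∈ S) * ind (¬ y ∈ S) * ind (¬ z ∈ S))) →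
      Mb R univ := by
  classical
  set ε : ℝ := γ / 200000 with hεd
  have hε0 : 0 < ε := by rw [hεd]; positivity
  have hε1 : ε ≤ 1/200000 := by rw [hεd]; linarith
  set β : ℝ := ε / 10 with hβd
  have hβ0 : 0 < β := by rw [hβd]; positivity
  obtain ⟨κ, hκ, m1, hm1⟩ := absorb β hβ0 (by rw [hβd]; linarith)
  obtain ⟨m2, hm2⟩ := almost_pm (γ/100) ε κ hε0 (by rw [hεd]; linarith) hκ
  obtain ⟨m3, hm3⟩ := exists_nat_ge (7 / ε)
  refine ⟨max (max m1 (2 * m2)) (max m3 1), ?_⟩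
  intro C V _ _ _ _ R m hR hm hC hV hdeg hnon
  simp only [max_le_iff] at hm
  obtain ⟨⟨hmm1, hmm2⟩, hmm3, hmp⟩ := hm
  have hmr : (1:ℝ) ≤ m := by exact_mod_cast hmp
  have hm7 : 7 ≤ ε * m := by
    have h1 : 7 / ε ≤ m := hm3.trans (by exact_mod_cast hmm3)
    rw [div_le_iff₀ hε0] at h1
    linarith
  have hm72 : 7 * (m:ℝ) ≤ ε * (m:ℝ)^2 := by
    have := mul_le_mul_of_nonneg_right hm7 (by linarith : (0:ℝ) ≤ m)
    linarith [this]
  have hVr : (Fintype.card V : ℝ) = 3 * m := by rw [hV]; push_cast; ring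
  have hCr : (Fintype.card C : ℝ) = m := by rw [hC]
  have hmsq : (0:ℝ) ≤ (m:ℝ)^2 := by positivity
  have hεm : ε * (m:ℝ)^2 ≤ 1/200000 * (m:ℝ)^2 := mul_le_mul_of_nonneg_right hε1 hmsq
  obtain ⟨P, hP, hPc, hPabs⟩ := hm1 C V R m hR hmm1 hC hV (by
    intro c v
    have := hdeg c v
    linarith)
  have hPb := hP.card hR
  have hPs := Finset.card_toLeft_add_card_toRight (u := P)
  set a : ℕ := P.toLeft.card with had
  have ha : (a:ℝ) ≤ β / 4 * m := by
    have : 4 * a = P.card := by omega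
    have h2 : 4 * (a:ℝ) = P.card := by exact_mod_cast this
    linarith
  have ha0 : (0:ℝ) ≤ a := Nat.cast_nonneg a
  let C' := {c : C // ¬ Sum.inl c ∈ P}
  let V' := {v : V // ¬ Sum.inr v ∈ P}
  have hsR : ∑ x : V, ind (Sum.inr x ∈ P) = 3 * a := by
    rw [sum_ind_card]
    have : univ.filter (fun x : V => Sum.inr x ∈ P) = P.toRight := by ext; simp
    rw [this, hPb]; push_cast; ring
  have hsL : ∑ x : C, ind (Sum.inl x ∈ P) = a := by
    rw [sum_ind_card]
    have : univ.filter (fun x : C => Sum.inl x ∈ P) = P.toLeft := by ext; simp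
    rw [this]
  have hcC : Fintype.card C' = m - a := by
    rw [Fintype.card_subtype_compl, hC]
    congr 1
    rw [Fintype.card_subtype]
    congr 1
    ext; simp
  have hcV : Fintype.card V' = 3 * m - 3 * a := by
    rw [Fintype.card_subtype_compl, hV]
    congr 1
    rw [Fintype.card_subtype, ← hPb]
    congr 1
    ext; simp
  have ham : 2 * a ≤ m := by
    have h1 : β / 4 * m ≤ 1 / 2 * m := by
      apply mul_le_mul_of_nonneg_right _ (by linarith)
      rw [hβd]; linarith
    have : 2 * (a:ℝ) ≤ m := by linarith
    exact_mod_cast this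
  have hcCle : Fintype.card C' ≤ m := by omega
  have hcVle : Fintype.card V' ≤ 3 * m := by omega
  have hcCr : (Fintype.card C' : ℝ) ≤ m := by exact_mod_cast hcCle
  have hcVr : (Fintype.card V' : ℝ) ≤ 3 * m := by exact_mod_cast hcVle
  obtain ⟨P', hP', hP'c⟩ := hm2 C' V' (fun c x y z => R c.1 x.1 y.1 z.1) (by omega) (by omega)
    (by
      intro c x y z h
      have := hR _ _ _ _ h
      exact ⟨fun h => this.1 (congrArg _ h), fun h => this.2.1 (congrArg _ h),
        fun h => this.2.2 (congrArg _ h)⟩)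
    (by
      intro c v
      rw [sum2_sub (fun v : V => ¬ Sum.inr v ∈ P) (fun x y => ind (R c.1 v.1 x y))]
      have h1 : ∑ x : V, ∑ y : V, (ind (R c.1 v.1 x y) - ind (Sum.inr x ∈ P) - ind (Sum.inr y ∈ P))
          ≤ ∑ x : V, ∑ y : V, (ind (¬ Sum.inr x ∈ P) *
            (ind (¬ Sum.inr y ∈ P) * ind (R c.1 v.1 x y))) := by
        refine Finset.sum_le_sum fun x _ => Finset.sum_le_sum fun y _ => ?_
        have i1 := ind_le_one (R c.1 v.1 x y)
        have i0 := ind_nonneg (R c.1 v.1 x y)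
        by_cases hx : Sum.inr x ∈ P
        · rw [ind_true hx]
          have := ind_nonneg (Sum.inr y ∈ P)
          rw [ind_false (show ¬ ¬ Sum.inr x ∈ P from not_not.mpr hx)]
          linarith
        · rw [ind_true hx, ind_false hx]
          by_cases hy : Sum.inr y ∈ P
          · rw [ind_true hy, ind_false (show ¬ ¬ Sum.inr y ∈ P from not_not.mpr hy)]
            linarith
          · rw [ind_true hy, ind_false hy]
            linarith
      refine le_trans ?_ h1
      simp only [Finset.sum_sub_distrib, Finset.sum_const, Finset.card_univ, nsmul_eq_mul,
        ← Finset.mul_sum, hsR, hVr]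
      have h2 := hdeg c.1 v.1
      have h3 : (5/9 - ε) * (Fintype.card V' : ℝ)^2 ≤ (5/9 - ε) * (3 * m)^2 := by
        apply mul_le_mul_of_nonneg_left _ (by linarith)
        exact pow_le_pow_left₀ (Nat.cast_nonneg _) hcVr 2
      have h4 : (a:ℝ) * m ≤ β / 4 * m * m := mul_le_mul_of_nonneg_right ha (by linarith)
      have h5 : β / 4 * m * m = ε * (m:ℝ)^2 / 40 := by rw [hβd]; ring
      have h6 : 0 ≤ ε * (m:ℝ)^2 := by positivity
      linarith)
    (by
      intro S' hS'
      set S0 : Finset V := (univ.filter (fun x : V' => S' x)).map (Function.Embedding.subtype _)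
        with hS0
      have hmem : ∀ x : V', x.1 ∈ S0 ↔ S' x := by
        intro x
        rw [hS0]
        simp only [Finset.mem_map, Finset.mem_filter, Finset.mem_univ, true_and,
          Function.Embedding.coe_subtype]
        constructor
        · rintro ⟨y, hy, hyx⟩
          rwa [← Subtype.ext hyx]
        · intro h
          exact ⟨x, h, rfl⟩
      have hS0c : (S0.card : ℝ) ≤ m + 117 * ε * m := by
        have h1 : (S0.card : ℝ) = ∑ x : V', ind (S' x) := by
          rw [sum_ind_card, hS0, Finset.card_map]
        rw [h1]
        refine hS'.trans ?_
        calc (1/3 + 39 * ε) * (Fintype.card V' : ℝ) ≤ (1/3 + 39 * ε) * (3 * m) := by gcongr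
          _ = _ := by ring
      obtain ⟨S, hSc, hSd⟩ : ∃ S : Finset V, S.card = m ∧ ((S0 \ S).card : ℝ) ≤ 117 * ε * m := by
        rcases le_total S0.card m with h | h
        · obtain ⟨S, h1, h2⟩ := Finset.exists_superset_card_eq h (by rw [hV]; omega)
          refine ⟨S, h2, ?_⟩
          rw [Finset.sdiff_eq_empty_iff_subset.mpr h1]
          simp; positivity
        · obtain ⟨S, h1, h2⟩ := Finset.exists_subset_card_eq h
          refine ⟨S, h2, ?_⟩
          rw [Finset.card_sdiff_of_subset h1, Nat.cast_sub (by omega), h2]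
          linarith
      have hbig := hnon S hSc
      have hle : ∑ c, ∑ x, ∑ y, ∑ z, ind (R c x y z) *
          (ind (¬ x ∈ S) * ind (¬ y ∈ S) * ind (¬ z ∈ S)) ≤
          ∑ c, ∑ x, ∑ y, ∑ z, (ind (¬ Sum.inl c ∈ P) * (ind (¬ Sum.inr x ∈ P) *
            (ind (¬ Sum.inr y ∈ P) * (ind (¬ Sum.inr z ∈ P) * (ind (R c x y z) *
            (ind (¬ x ∈ S0) * ind (¬ y ∈ S0) * ind (¬ z ∈ S0)))))) + ind (Sum.inl c ∈ P)
            + (ind (Sum.inr x ∈ P) + ind (x ∈ S0 ∧ ¬ x ∈ S))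
            + (ind (Sum.inr y ∈ P) + ind (y ∈ S0 ∧ ¬ y ∈ S))
            + (ind (Sum.inr z ∈ P) + ind (z ∈ S0 ∧ ¬ z ∈ S))) := by
        refine Finset.sum_le_sum fun c _ => Finset.sum_le_sum fun x _ =>
          Finset.sum_le_sum fun y _ => Finset.sum_le_sum fun z _ => ?_
        exact drop_pt _ _ _ _ _ _ _ _ _ _ _
      rw [sum4_add (fun c x y z => ind (¬ Sum.inl c ∈ P) * (ind (¬ Sum.inr x ∈ P) *
            (ind (¬ Sum.inr y ∈ P) * (ind (¬ Sum.inr z ∈ P) * (ind (R c x y z) *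
            (ind (¬ x ∈ S0) * ind (¬ y ∈ S0) * ind (¬ z ∈ S0)))))))
            (fun c => ind (Sum.inl c ∈ P)) (fun x => ind (Sum.inr x ∈ P) +
              ind (x ∈ S0 ∧ ¬ x ∈ S)),
          ← sum4_sub (fun c : C => ¬ Sum.inl c ∈ P) (fun v : V => ¬ Sum.inr v ∈ P)
            (fun c x y z => ind (R c x y z) *
            (ind (¬ x ∈ S0) * ind (¬ y ∈ S0) * ind (¬ z ∈ S0))),
          hsL, Finset.sum_add_distrib, hsR, hVr, hCr] at hle
      have hsS : ∑ x : V, ind (x ∈ S0 ∧ ¬ x ∈ S) ≤ 117 * ε * m := by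
        rw [sum_ind_card]
        have : univ.filter (fun x : V => x ∈ S0 ∧ ¬ x ∈ S) = S0 \ S := by ext; simp
        rw [this]; exact hSd
      have hgoal : ∑ c : C', ∑ x : V', ∑ y : V', ∑ z : V', ind (R c.1 x.1 y.1 z.1) *
          (ind (¬ S' x) * ind (¬ S' y) * ind (¬ S' z)) =
          ∑ c : C', ∑ x : V', ∑ y : V', ∑ z : V', ind (R c.1 x.1 y.1 z.1) *
          (ind (¬ x.1 ∈ S0) * ind (¬ y.1 ∈ S0) * ind (¬ z.1 ∈ S0)) := by
        refine Finset.sum_congr rfl fun c _ => Finset.sum_congr rfl fun x _ =>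
          Finset.sum_congr rfl fun y _ => Finset.sum_congr rfl fun z _ => ?_
        rw [hmem, hmem, hmem]
      rw [hgoal]
      have hγ' : γ / 100 * (Fintype.card C' : ℝ) * (Fintype.card V' : ℝ)^3
          ≤ γ / 100 * m * (3 * m)^3 := by gcongr
      have k1 : (a:ℝ) * (m:ℝ)^3 ≤ β / 4 * m * (m:ℝ)^3 :=
        mul_le_mul_of_nonneg_right ha (by positivity)
      have k2 : (m:ℝ)^3 * ∑ x : V, ind (x ∈ S0 ∧ ¬ x ∈ S) ≤ (m:ℝ)^3 * (117 * ε * m) :=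
        mul_le_mul_of_nonneg_left hsS (by positivity)
      have k3 : β / 4 * m * (m:ℝ)^3 = γ * (m:ℝ)^4 / 8000000 := by rw [hβd, hεd]; ring
      have k4 : (m:ℝ)^3 * (117 * ε * m) = 117 * (γ * (m:ℝ)^4) / 200000 := by rw [hεd]; ring
      have k5 : 0 ≤ γ * (m:ℝ)^4 := by positivity
      linarith)
  set Q1 := P'.image (Sum.map Subtype.val Subtype.val : C' ⊕ V' → C ⊕ V) with hQ1
  have hQ1M : Mb R Q1 := Mb.map (R := R) (Subtype.val : C' → C) (Subtype.val : V' → V)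
    Subtype.val_injective Subtype.val_injective hP'
  have hdis : Disjoint P Q1 := by
    rw [Finset.disjoint_right]
    intro w hw
    rw [hQ1, Finset.mem_image] at hw
    obtain ⟨u, -, rfl⟩ := hw
    rcases u with u | u
    · exact u.2
    · exact u.2
  have hPQ := Mb.union hP hQ1M hdis
  set Q := univ \ (P ∪ Q1) with hQd
  have hcQ := hPQ.card hR
  have hl : Q.toLeft.card = m - (P ∪ Q1).toLeft.card := by
    rw [hQd, Finset.toLeft_sdiff, Finset.card_sdiff_of_subset
      (Finset.toLeft_subset_toLeft (Finset.subset_univ _))]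
    congr 1
    rw [← hC, ← Finset.card_univ]
    congr 1
    ext; simp
  have hr : Q.toRight.card = 3 * m - (P ∪ Q1).toRight.card := by
    rw [hQd, Finset.toRight_sdiff, Finset.card_sdiff_of_subset
      (Finset.toRight_subset_toRight (Finset.subset_univ _))]
    congr 1
    rw [← hV, ← Finset.card_univ]
    congr 1
    ext; simp
  have hfin := hPabs Q (by
      rw [hQd]
      exact (Finset.disjoint_sdiff).mono_left Finset.subset_union_left)
    (by omega)
    (by
      have hsub : Q ⊆ (univ \ P').image (Sum.map Subtype.val Subtype.val : C' ⊕ V' → C ⊕ V) := by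
        intro w hw
        rw [hQd, Finset.mem_sdiff, Finset.mem_union, not_or] at hw
        obtain ⟨-, hwP, hwQ⟩ := hw
        rw [Finset.mem_image]
        rcases w with w | w
        · refine ⟨Sum.inl ⟨w, hwP⟩, ?_, rfl⟩
          rw [Finset.mem_sdiff]
          refine ⟨Finset.mem_univ _, fun h => hwQ ?_⟩
          rw [hQ1]
          exact Finset.mem_image_of_mem _ h
        · refine ⟨Sum.inr ⟨w, hwP⟩, ?_, rfl⟩
          rw [Finset.mem_sdiff]
          refine ⟨Finset.mem_univ _, fun h => hwQ ?_⟩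
          rw [hQ1]
          exact Finset.mem_image_of_mem _ h
      have h1 : Q.card ≤ (univ \ P').card := (Finset.card_le_card hsub).trans Finset.card_image_le
      have h2 : (Q.card : ℝ) ≤ (univ \ P').card := by exact_mod_cast h1
      refine h2.trans (hP'c.trans ?_)
      exact mul_le_mul_of_nonneg_left hcCr hκ.le)
  have huniv : (univ : Finset (C ⊕ V)) = (P ∪ Q) ∪ Q1 := by
    have h1 : (P ∪ Q1) ∪ Q = univ := by
      rw [hQd]; exact Finset.union_sdiff_of_subset (Finset.subset_univ _)
    rw [← h1]
    ext w
    simp only [Finset.mem_union]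
    tauto
  rw [huniv]
  refine Mb.union hfin hQ1M ?_
  rw [Finset.disjoint_union_left]
  refine ⟨hdis, ?_⟩
  rw [hQd]
  exact (Finset.disjoint_sdiff).symm.mono_right Finset.subset_union_right

end RM

namespace RM
open Finset

lemma rot4 {I : Type*} [DecidableEq I] (a b c d : I) (hab : a ≠ b) (hac : a ≠ c) (had : a ≠ d)
    (hbc : b ≠ c) (hbd : b ≠ d) (hcd : c ≠ d) : ∃ ρ : Equiv.Perm I,
    ρ a = b ∧ ρ b = c ∧ ρ c = d ∧ ρ d = a ∧ ∀ i, i ≠ a → i ≠ b → i ≠ c → i ≠ d → ρ i = i := by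
  refine ⟨Equiv.swap a b * Equiv.swap b c * Equiv.swap c d, ?_, ?_, ?_, ?_, ?_⟩
  · simp only [Equiv.Perm.mul_apply]
    rw [Equiv.swap_apply_of_ne_of_ne hac had, Equiv.swap_apply_of_ne_of_ne hab hac,
      Equiv.swap_apply_left]
  · simp only [Equiv.Perm.mul_apply]
    rw [Equiv.swap_apply_of_ne_of_ne hbc hbd, Equiv.swap_apply_left,
      Equiv.swap_apply_of_ne_of_ne hac.symm hbc.symm]
  · simp only [Equiv.Perm.mul_apply]
    rw [Equiv.swap_apply_left, Equiv.swap_apply_of_ne_of_ne hbd.symm hcd.symm,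
      Equiv.swap_apply_of_ne_of_ne had.symm hbd.symm]
  · simp only [Equiv.Perm.mul_apply]
    rw [Equiv.swap_apply_right, Equiv.swap_apply_right, Equiv.swap_apply_right]
  · intro i h1 h2 h3 h4
    simp only [Equiv.Perm.mul_apply]
    rw [Equiv.swap_apply_of_ne_of_ne h3 h4, Equiv.swap_apply_of_ne_of_ne h2 h3,
      Equiv.swap_apply_of_ne_of_ne h1 h2]

lemma sum3_perm {I : Type*} [Fintype I] (a b c : Equiv.Perm I) (f : I → I → I → ℝ) :
    ∑ i, ∑ j, ∑ k, f (a i) (b j) (c k) = ∑ i, ∑ j, ∑ k, f i j k := by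
  rw [Equiv.sum_comp a (fun i => ∑ j, ∑ k, f i (b j) (c k))]
  refine Finset.sum_congr rfl fun i _ => ?_
  rw [Equiv.sum_comp b (fun j => ∑ k, f i j (c k))]
  refine Finset.sum_congr rfl fun j _ => ?_
  rw [Equiv.sum_comp c (fun k => f i j k)]

lemma sum_ind_eq1 {A : Type*} [Fintype A] (a : A) : ∑ x, ind (x = a) = 1 := by
  have := sum_ind_eq' a (fun _ => (1:ℝ))
  simpa using this

lemma sum_ind_eq1' {A : Type*} [Fintype A] (a : A) : ∑ x, ind (a = x) = 1 := by
  have := sum_ind_eq a (fun _ => (1:ℝ))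
  simpa using this

set_option maxHeartbeats 1000000 in
lemma tp_triple {I : Type*} [Fintype I] [DecidableEq I] (Q0 Q1 Q2 Q3 : I → I → I → Prop) (i0 : I)
    (hN : 100 ≤ Fintype.card I)
    (h0 : ∑ i, ∑ j, ∑ k, ind (¬ Q0 i j k) ≤ (Fintype.card I : ℝ)^3 / 10)
    (h1 : ∑ i, ∑ j, ∑ k, ind (¬ Q1 i j k) ≤ (Fintype.card I : ℝ)^3 / 10)
    (h2 : ∑ i, ∑ j, ∑ k, ind (¬ Q2 i j k) ≤ (Fintype.card I : ℝ)^3 / 10)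
    (h3 : ∑ i, ∑ j, ∑ k, ind (¬ Q3 i j k) ≤ (Fintype.card I : ℝ)^3 / 10) :
    ∃ i j k, Q0 i j k ∧ Q1 i j k ∧ Q2 i j k ∧ Q3 i j k ∧ i0 ≠ i ∧ i0 ≠ j ∧ i0 ≠ k ∧ i ≠ j ∧
      i ≠ k ∧ j ≠ k := by
  by_contra hcon
  push Not at hcon
  have key : ∀ i j k, (1:ℝ) ≤ ind (¬ Q0 i j k) + ind (¬ Q1 i j k) + ind (¬ Q2 i j k)
      + ind (¬ Q3 i j k) + ind (i0 = i) + ind (i0 = j) + ind (i0 = k) + ind (i = j) + ind (i = k)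
      + ind (j = k) := by
    intro i j k
    have n0 := ind_nonneg (¬ Q0 i j k)
    have n1 := ind_nonneg (¬ Q1 i j k)
    have n2 := ind_nonneg (¬ Q2 i j k)
    have n3 := ind_nonneg (¬ Q3 i j k)
    have n4 := ind_nonneg (i0 = i)
    have n5 := ind_nonneg (i0 = j)
    have n6 := ind_nonneg (i0 = k)
    have n7 := ind_nonneg (i = j)
    have n8 := ind_nonneg (i = k)
    have n9 := ind_nonneg (j = k)
    by_cases q0 : Q0 i j k
    swap
    · rw [ind_true q0]; linarith
    by_cases q1 : Q1 i j k
    swap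
    · rw [ind_true q1]; linarith
    by_cases q2 : Q2 i j k
    swap
    · rw [ind_true q2]; linarith
    by_cases q3 : Q3 i j k
    swap
    · rw [ind_true q3]; linarith
    by_cases q4 : i0 = i
    · rw [ind_true q4]; linarith
    by_cases q5 : i0 = j
    · rw [ind_true q5]; linarith
    by_cases q6 : i0 = k
    · rw [ind_true q6]; linarith
    by_cases q7 : i = j
    · rw [ind_true q7]; linarith
    by_cases q8 : i = k
    · rw [ind_true q8]; linarith
    have q9 := hcon i j k q0 q1 q2 q3 q4 q5 q6 q7 q8
    rw [ind_true q9]; linarith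
  have hs := Finset.sum_le_sum fun i (_ : i ∈ (univ : Finset I)) =>
    Finset.sum_le_sum fun j (_ : j ∈ (univ : Finset I)) =>
    Finset.sum_le_sum fun k (_ : k ∈ (univ : Finset I)) => key i j k
  simp only [Finset.sum_add_distrib, Finset.sum_const, Finset.card_univ, nsmul_eq_mul, mul_one,
    sum_ind_eq1, sum_ind_eq1', ← Finset.mul_sum] at hs
  have hN' : (100:ℝ) ≤ Fintype.card I := by exact_mod_cast hN
  set N : ℝ := (Fintype.card I : ℝ)
  have : 100 * (N * N) ≤ N * (N * N) := mul_le_mul_of_nonneg_right hN' (by positivity)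
  have e : N ^ 3 = N * (N * N) := by ring
  rw [e] at h0 h1 h2 h3
  have hp : 0 < N * N := by positivity
  linarith

set_option maxHeartbeats 1000000 in
lemma tp {I : Type*} [Fintype I] [DecidableEq I] (Q : I → I → I → I → Prop)
    (hN : 100 ≤ Fintype.card I)
    (h0 : ∀ i, ∑ j, ∑ k, ∑ l, ind (¬ Q i j k l) ≤ (Fintype.card I : ℝ)^3 / 10)
    (h1 : ∀ j, ∑ i, ∑ k, ∑ l, ind (¬ Q i j k l) ≤ (Fintype.card I : ℝ)^3 / 10)
    (h2 : ∀ k, ∑ i, ∑ j, ∑ l, ind (¬ Q i j k l) ≤ (Fintype.card I : ℝ)^3 / 10)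
    (h3 : ∀ l, ∑ i, ∑ j, ∑ k, ind (¬ Q i j k l) ≤ (Fintype.card I : ℝ)^3 / 10) :
    ∃ α β γ : Equiv.Perm I, ∀ i, Q i (α i) (β i) (γ i) := by
  classical
  obtain ⟨⟨α, β, γ⟩, -, hmax⟩ := Finset.exists_max_image
    (univ : Finset (Equiv.Perm I × Equiv.Perm I × Equiv.Perm I))
    (fun t => (univ.filter fun i => Q i (t.1 i) (t.2.1 i) (t.2.2 i)).card) ⟨(1, 1, 1), mem_univ _⟩
  refine ⟨α, β, γ, ?_⟩
  by_contra hcon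
  push Not at hcon
  obtain ⟨a, ha⟩ := hcon
  obtain ⟨b, c, d, q0, q1, q2, q3, hab, hac, had, hbc, hbd, hcd⟩ := tp_triple
    (fun b c d => Q a (α b) (β c) (γ d)) (fun b c d => Q b (α c) (β d) (γ a))
    (fun b c d => Q c (α d) (β a) (γ b)) (fun b c d => Q d (α a) (β b) (γ c)) a hN
    (by rw [sum3_perm α β γ (fun x y z => ind (¬ Q a x y z))]; exact h0 a)
    (by
      have := sum3_perm 1 α β (fun x y z => ind (¬ Q x y z (γ a)))
      simp only [Equiv.Perm.coe_one, id_eq] at this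
      rw [this]; exact h3 _)
    (by
      have := sum3_perm γ 1 α (fun x y z => ind (¬ Q y z (β a) x))
      simp only [Equiv.Perm.coe_one, id_eq] at this
      rw [this, Finset.sum_comm]
      refine le_trans (le_of_eq ?_) (h2 (β a))
      refine Finset.sum_congr rfl fun i _ => Finset.sum_comm)
    (by
      have := sum3_perm β γ 1 (fun x y z => ind (¬ Q z (α a) x y))
      simp only [Equiv.Perm.coe_one, id_eq] at this
      rw [this]
      refine le_trans (le_of_eq ?_) (h1 (α a))
      have : ∀ x : I, ∑ y, ∑ z, ind (¬ Q z (α a) x y) = ∑ z, ∑ y, ind (¬ Q z (α a) x y) :=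
        fun x => Finset.sum_comm
      simp only [this]
      exact Finset.sum_comm)
  obtain ⟨ρ, ra, rb, rc, rd, ro⟩ := rot4 a b c d hab hac had hbc hbd hcd
  have hm := hmax (α * ρ, β * (ρ * ρ), γ * (ρ * (ρ * ρ))) (mem_univ _)
  have hlt : (univ.filter fun i => Q i (α i) (β i) (γ i)).card <
      (univ.filter fun i => Q i (α (ρ i)) (β (ρ (ρ i))) (γ (ρ (ρ (ρ i))))).card := by
    apply Finset.card_lt_card
    rw [Finset.ssubset_iff_of_subset]
    · refine ⟨a, ?_, ?_⟩
      · simp only [mem_filter, mem_univ, true_and, ra, rb, rc]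
        exact q0
      · simp only [mem_filter, mem_univ, true_and]; exact ha
    · intro i hi
      simp only [mem_filter, mem_univ, true_and] at hi ⊢
      by_cases ia : i = a
      · subst ia; rw [ra, rb, rc]; exact q0
      by_cases ib : i = b
      · subst ib; rw [rb, rc, rd]; exact q1
      by_cases ic : i = c
      · subst ic; rw [rc, rd, ra]; exact q2
      by_cases id' : i = d
      · subst id'; rw [rd, ra, rb]; exact q3
      rw [ro i ia ib ic id', ro i ia ib ic id', ro i ia ib ic id']
      exact hi
  exact absurd hm (not_le.mpr hlt)
end RM

namespace RM
open Finset

lemma enum_finset {V : Type} [DecidableEq V] (S : Finset V) (r : ℕ) (h : S.card = r) :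
    ∃ f : Fin r → V, Function.Injective f ∧ (∀ i, f i ∈ S) ∧ (∀ v ∈ S, ∃ i, f i = v) ∧
      ∀ g : V → ℝ, ∑ i, g (f i) = ∑ v ∈ S, g v := by
  let e := (S.equivFinOfCardEq h).symm
  refine ⟨fun i => (e i).1, ?_, fun i => (e i).2, ?_, ?_⟩
  · intro i j hij; exact e.injective (Subtype.ext hij)
  · intro v hv
    exact ⟨e.symm ⟨v, hv⟩, by simp⟩
  · intro g
    rw [Equiv.sum_comp e (fun v => g v.1)]
    exact Finset.sum_coe_sort S g

set_option maxHeartbeats 1000000 in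
lemma tp_Mb {C V : Type} [DecidableEq C] [DecidableEq V] (R : C → V → V → V → Prop)
    (C' : Finset C) (A' W' : Finset V) (r : ℕ) (hC' : C'.card = r) (hA' : A'.card = r)
    (hW' : W'.card = 2 * r) (hd : Disjoint A' W') (hr : 100 ≤ r)
    (hc : ∀ c ∈ C', ∑ a ∈ A', ∑ w ∈ W', ∑ z ∈ W', ind (¬ R c a w z) ≤ (r:ℝ)^3/10)
    (ha : ∀ a ∈ A', ∑ c ∈ C', ∑ w ∈ W', ∑ z ∈ W', ind (¬ R c a w z) ≤ (r:ℝ)^3/10)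
    (hw : ∀ w ∈ W', ∑ c ∈ C', ∑ a ∈ A', ∑ z ∈ W', ind (¬ R c a w z) ≤ (r:ℝ)^3/10)
    (hz : ∀ z ∈ W', ∑ c ∈ C', ∑ a ∈ A', ∑ w ∈ W', ind (¬ R c a w z) ≤ (r:ℝ)^3/10) :
    Mb R (C'.disjSum (A' ∪ W')) := by
  obtain ⟨W1, hW1, hW1c⟩ := Finset.exists_subset_card_eq (s := W') (n := r) (by omega)
  have hW2c : (W' \ W1).card = r := by
    rw [Finset.card_sdiff_of_subset hW1]; omega
  obtain ⟨fC, iC, mC, sC, SC⟩ := enum_finset C' r hC'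
  obtain ⟨fA, iA, mA, sA, SA⟩ := enum_finset A' r hA'
  obtain ⟨f1, i1, m1, s1, S1⟩ := enum_finset W1 r hW1c
  obtain ⟨f2, i2, m2, s2, S2⟩ := enum_finset (W' \ W1) r hW2c
  have S1' : ∀ g : V → ℝ, (∀ v, 0 ≤ g v) → ∑ i, g (f1 i) ≤ ∑ v ∈ W', g v := by
    intro g hg; rw [S1]; exact Finset.sum_le_sum_of_subset_of_nonneg hW1 (fun v _ _ => hg v)
  have S2' : ∀ g : V → ℝ, (∀ v, 0 ≤ g v) → ∑ i, g (f2 i) ≤ ∑ v ∈ W', g v := by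
    intro g hg; rw [S2]
    exact Finset.sum_le_sum_of_subset_of_nonneg Finset.sdiff_subset (fun v _ _ => hg v)
  have m1' : ∀ i, f1 i ∈ W' := fun i => hW1 (m1 i)
  have m2' : ∀ i, f2 i ∈ W' := fun i => (Finset.mem_sdiff.mp (m2 i)).1
  obtain ⟨α, β, γ, hQ⟩ := tp (fun i j k l => R (fC i) (fA j) (f1 k) (f2 l)) (by simpa using hr)
    (by
      intro i
      rw [Fintype.card_fin]
      refine le_trans ?_ (hc _ (mC i))
      rw [SA (fun a => ∑ k, ∑ l, ind (¬ R (fC i) a (f1 k) (f2 l)))]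
      refine Finset.sum_le_sum fun a _ => ?_
      refine le_trans (S1' (fun w => ∑ l, ind (¬ R (fC i) a w (f2 l)))
        (fun v => Finset.sum_nonneg fun _ _ => ind_nonneg _)) ?_
      exact Finset.sum_le_sum fun w _ => S2' (fun z => ind (¬ R (fC i) a w z)) (fun v => ind_nonneg _))
    (by
      intro j
      rw [Fintype.card_fin]
      refine le_trans ?_ (ha _ (mA j))
      rw [SC (fun c => ∑ k, ∑ l, ind (¬ R c (fA j) (f1 k) (f2 l)))]
      refine Finset.sum_le_sum fun c _ => ?_
      refine le_trans (S1' (fun w => ∑ l, ind (¬ R c (fA j) w (f2 l)))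
        (fun v => Finset.sum_nonneg fun _ _ => ind_nonneg _)) ?_
      exact Finset.sum_le_sum fun w _ => S2' (fun z => ind (¬ R c (fA j) w z)) (fun v => ind_nonneg _))
    (by
      intro k
      rw [Fintype.card_fin]
      refine le_trans ?_ (hw _ (m1' k))
      rw [SC (fun c => ∑ j, ∑ l, ind (¬ R c (fA j) (f1 k) (f2 l)))]
      refine Finset.sum_le_sum fun c _ => ?_
      rw [SA (fun a => ∑ l, ind (¬ R c a (f1 k) (f2 l)))]
      exact Finset.sum_le_sum fun a _ => S2' (fun z => ind (¬ R c a (f1 k) z)) (fun v => ind_nonneg _))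
    (by
      intro l
      rw [Fintype.card_fin]
      refine le_trans ?_ (hz _ (m2' l))
      rw [SC (fun c => ∑ j, ∑ k, ind (¬ R c (fA j) (f1 k) (f2 l)))]
      refine Finset.sum_le_sum fun c _ => ?_
      rw [SA (fun a => ∑ k, ind (¬ R c a (f1 k) (f2 l)))]
      exact Finset.sum_le_sum fun a _ => S1' (fun w => ind (¬ R c a w (f2 l))) (fun v => ind_nonneg _))
  have nA1 : ∀ i j, fA i ≠ f1 j := fun i j h => Finset.disjoint_left.mp hd (mA i) (h ▸ m1' j)
  have nA2 : ∀ i j, fA i ≠ f2 j := fun i j h => Finset.disjoint_left.mp hd (mA i) (h ▸ m2' j)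
  have n12 : ∀ i j, f1 i ≠ f2 j := fun i j h => (Finset.mem_sdiff.mp (m2 j)).2 (h ▸ m1 i)
  have hM := Mb.biUnion (R := R) (univ : Finset (Fin r))
    (fun i => {Sum.inl (fC i), Sum.inr (fA (α i)), Sum.inr (f1 (β i)), Sum.inr (f2 (γ i))})
    (fun i _ => Mb.single (hQ i))
    (by
      intro i _ j _ hij
      have e1 : fC i ≠ fC j := fun h => hij (iC h)
      have e2 : fA (α i) ≠ fA (α j) := fun h => hij (α.injective (iA h))
      have e3 : f1 (β i) ≠ f1 (β j) := fun h => hij (β.injective (i1 h))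
      have e4 : f2 (γ i) ≠ f2 (γ j) := fun h => hij (γ.injective (i2 h))
      have g1 := nA1 (α i) (β j)
      have g2 := nA2 (α i) (γ j)
      have g3 := n12 (β i) (γ j)
      have g4 := (nA1 (α j) (β i)).symm
      have g5 := (nA2 (α j) (γ i)).symm
      have g6 := (n12 (β j) (γ i)).symm
      rw [Finset.disjoint_left]
      intro a ha hb
      simp only [mem_insert, mem_singleton] at ha hb
      rcases ha with rfl | rfl | rfl | rfl
      · simp [e1] at hb
      · simp [e2, g1, g2] at hb
      · simp [e3, g3, g4] at hb
      · simp [e4, g5, g6] at hb)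
  convert hM using 1
  ext a
  rw [Finset.mem_biUnion]
  rcases a with c | v
  · rw [Finset.inl_mem_disjSum]
    constructor
    · intro h
      obtain ⟨i, rfl⟩ := sC c h
      exact ⟨i, mem_univ _, by simp⟩
    · rintro ⟨i, -, hi⟩
      simp only [mem_insert, mem_singleton, Sum.inl.injEq, reduceCtorEq, or_false] at hi
      rw [hi]; exact mC i
  · rw [Finset.inr_mem_disjSum, Finset.mem_union]
    constructor
    · rintro (h | h)
      · obtain ⟨i, rfl⟩ := sA v h
        exact ⟨α.symm i, mem_univ _, by simp⟩
      · by_cases h' : v ∈ W1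
        · obtain ⟨i, rfl⟩ := s1 v h'
          exact ⟨β.symm i, mem_univ _, by simp⟩
        · obtain ⟨i, rfl⟩ := s2 v (Finset.mem_sdiff.mpr ⟨h, h'⟩)
          exact ⟨γ.symm i, mem_univ _, by simp⟩
    · rintro ⟨i, -, hi⟩
      simp only [mem_insert, mem_singleton, Sum.inr.injEq, reduceCtorEq, false_or] at hi
      rcases hi with rfl | rfl | rfl
      · exact Or.inl (mA _)
      · exact Or.inr (m1' _)
      · exact Or.inr (m2' _)
end RM

namespace RM
open Finset

lemma sum_ind_mem {V : Type*} [Fintype V] [DecidableEq V] (S : Finset V) :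
    ∑ x, ind (x ∈ S) = (S.card : ℝ) := by
  rw [sum_ind_card]
  congr 2
  ext; simp

lemma sum_ind_mem_le {V : Type*} [DecidableEq V] (T S : Finset V) :
    ∑ x ∈ T, ind (x ∈ S) ≤ (S.card : ℝ) := by
  rw [sum_ind_card]
  exact_mod_cast Finset.card_le_card (fun x hx => (Finset.mem_filter.mp hx).2)

lemma St.cons {C V : Type} [DecidableEq C] [DecidableEq V] {R : C → V → V → V → Prop}
    {C1 : Finset C} {V1 : Finset V} (h : Mb R (C1.disjSum V1)) {c : C} {x y z : V}
    (hr : R c x y z) (hc : c ∉ C1) (hx : x ∉ V1) (hy : y ∉ V1) (hz : z ∉ V1) :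
    Mb R ((insert c C1).disjSum (insert x (insert y (insert z V1)))) := by
  have := Mb.cons c x y z (C1.disjSum V1) hr (by simpa using hc) (by simpa using hx)
    (by simpa using hy) (by simpa using hz) h
  convert this using 1
  ext a
  rcases a with a | a <;> simp

lemma St.card {C V : Type} [DecidableEq C] [DecidableEq V] {R : C → V → V → V → Prop}
    (hR : ∀ c x y z, R c x y z → x ≠ y ∧ x ≠ z ∧ y ≠ z)
    {C1 : Finset C} {V1 : Finset V} (h : Mb R (C1.disjSum V1)) : V1.card = 3 * C1.card := by
  have := Mb.card hR h
  simpa using this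

section
variable {C V : Type} [Fintype C] [Fintype V] [DecidableEq C] [DecidableEq V]
  (R : C → V → V → V → Prop) (m : ℕ)

lemma s2_step (hm : 1000 ≤ m) (hV : Fintype.card V = 3 * m)
    (hdeg : ∀ c v, 5 * (m:ℝ)^2 - 7 * m + 4 ≤ ∑ x, ∑ y, ind (R c v x y))
    (A V1 : Finset V) (hA : 100 * A.card ≤ 101 * m) (hV1 : 100 * V1.card ≤ m) (c : C) :
    ∃ x y z, R c x y z ∧ x ∉ A ∧ x ∉ V1 ∧ y ∉ A ∧ y ∉ V1 ∧ z ∉ V1 := by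
  obtain ⟨x, hx⟩ : ∃ x, x ∉ A ∪ V1 := by
    by_contra hcon
    push Not at hcon
    have h1 : (A ∪ V1) = univ := by ext x; simpa using hcon x
    have h2 := Finset.card_union_le A V1
    rw [h1, Finset.card_univ, hV] at h2
    omega
  rw [Finset.mem_union] at hx
  push Not at hx
  by_contra hcon
  push Not at hcon
  have key : ∀ y z, ind (R c x y z) ≤ ind (y ∈ A) + ind (y ∈ V1) + ind (z ∈ V1) := by
    intro y z
    have n1 := ind_nonneg (y ∈ A)
    have n2 := ind_nonneg (y ∈ V1)
    have n3 := ind_nonneg (z ∈ V1)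
    by_cases hr : R c x y z
    · rw [ind_true hr]
      by_cases h1 : y ∈ A
      · rw [ind_true h1]; linarith
      by_cases h2 : y ∈ V1
      · rw [ind_true h2]; linarith
      rw [ind_true (hcon x y z hr hx.1 hx.2 h1 h2)]; linarith
    · rw [ind_false hr]; linarith
  have hs := (hdeg c x).trans (Finset.sum_le_sum fun y (_ : y ∈ (univ : Finset V)) =>
    Finset.sum_le_sum fun z (_ : z ∈ (univ : Finset V)) => key y z)
  simp only [Finset.sum_add_distrib, Finset.sum_const, Finset.card_univ, nsmul_eq_mul,
    ← Finset.mul_sum, sum_ind_mem, hV] at hs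
  push_cast at hs
  have h1 : 100 * (A.card:ℝ) ≤ 101 * m := by exact_mod_cast hA
  have h2 : 100 * (V1.card:ℝ) ≤ m := by exact_mod_cast hV1
  have h3 : (1000:ℝ) ≤ m := by exact_mod_cast hm
  have p1 := mul_le_mul_of_nonneg_left h1 (show (0:ℝ) ≤ m by positivity)
  have p2 := mul_le_mul_of_nonneg_left h2 (show (0:ℝ) ≤ m by positivity)
  have p3 := mul_le_mul_of_nonneg_left h3 (show (0:ℝ) ≤ m by positivity)
  linarith

lemma s3_step (hm : 1000 ≤ m) (hV : Fintype.card V = 3 * m) (A V1 : Finset V) (C1 : Finset C)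
    (v : V) (G : Finset C) (hG : m ≤ 1000 * G.card)
    (hG2 : ∀ c ∈ G, (m:ℝ)^2 / 2000 ≤ ∑ x ∈ Aᶜ, ∑ y ∈ Aᶜ, ind (R c v x y))
    (hV1 : 20000 * V1.card ≤ m) (hC1 : 2000 * C1.card ≤ m) :
    ∃ c x y, R c v x y ∧ c ∉ C1 ∧ x ∉ A ∧ x ∉ V1 ∧ y ∉ A ∧ y ∉ V1 := by
  obtain ⟨c, hcG, hc⟩ : ∃ c ∈ G, c ∉ C1 := by
    by_contra hcon
    push Not at hcon
    have := Finset.card_le_card (show G ⊆ C1 from hcon)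
    omega
  refine ⟨c, ?_⟩
  by_contra hcon
  push Not at hcon
  have key : ∀ x ∈ Aᶜ, ∀ y ∈ Aᶜ, ind (R c v x y) ≤ ind (x ∈ V1) + ind (y ∈ V1) := by
    intro x hx y hy
    have n2 := ind_nonneg (x ∈ V1)
    have n3 := ind_nonneg (y ∈ V1)
    by_cases hr : R c v x y
    · rw [ind_true hr]
      by_cases h2 : x ∈ V1
      · rw [ind_true h2]; linarith
      rw [ind_true (hcon x y hr hc (by simpa using hx) h2 (by simpa using hy))]; linarith
    · rw [ind_false hr]; linarith
  have hs := (hG2 c hcG).trans (Finset.sum_le_sum fun x hx =>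
    Finset.sum_le_sum fun y hy => key x hx y hy)
  simp only [Finset.sum_add_distrib, Finset.sum_const, nsmul_eq_mul,
    ← Finset.mul_sum] at hs
  have hAc : ((Aᶜ).card : ℝ) ≤ 3 * m := by
    have := Finset.card_le_univ Aᶜ
    rw [hV] at this
    exact_mod_cast this
  have q := sum_ind_mem_le Aᶜ V1
  have q0 : 0 ≤ ∑ x ∈ Aᶜ, ind (x ∈ V1) := Finset.sum_nonneg fun _ _ => ind_nonneg _
  have h2 : 20000 * (V1.card:ℝ) ≤ m := by exact_mod_cast hV1
  have h3 : (1000:ℝ) ≤ m := by exact_mod_cast hm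
  have p1 : ((Aᶜ).card : ℝ) * ∑ x ∈ Aᶜ, ind (x ∈ V1) ≤ 3 * m * V1.card :=
    mul_le_mul hAc q q0 (by positivity)
  have p2 := mul_le_mul_of_nonneg_left h2 (show (0:ℝ) ≤ m by positivity)
  have p3 := mul_le_mul_of_nonneg_left h3 (show (0:ℝ) ≤ m by positivity)
  linarith

set_option maxHeartbeats 1000000 in
lemma s4_step (hm : 1000 ≤ m) (hC : Fintype.card C = m) (hV : Fintype.card V = 3 * m)
    (A V1 : Finset V) (C1 : Finset C)
    (hA : 100 * A.card ≤ 101 * m) (hA2 : 99 * m ≤ 100 * A.card)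
    (hW : ∀ w, w ∉ A → ∑ c, ∑ a ∈ A, ∑ z, ind (¬ R c w a z) ≤ 13 / 1000 * (m:ℝ)^3)
    (hV1 : 100 * V1.card ≤ m) (hC1 : 100 * C1.card ≤ m) :
    ∃ c x y z, R c x y z ∧ c ∉ C1 ∧ x ∉ A ∧ x ∉ V1 ∧ y ∈ A ∧ y ∉ V1 ∧ z ∈ A ∧ z ∉ V1 := by
  obtain ⟨x, hx⟩ : ∃ x, x ∉ A ∪ V1 := by
    by_contra hcon
    push Not at hcon
    have h1 : (A ∪ V1) = univ := by ext x; simpa using hcon x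
    have h2 := Finset.card_union_le A V1
    rw [h1, Finset.card_univ, hV] at h2
    omega
  rw [Finset.mem_union] at hx
  push Not at hx
  by_contra hcon
  push Not at hcon
  have key : ∀ c, ∀ y ∈ A, ∀ z, (ind (z ∈ A) : ℝ) ≤ ind (¬ R c x y z) + ind (c ∈ C1) + ind (y ∈ V1)
      + ind (z ∈ V1) := by
    intro c y hy z
    have n1 := ind_nonneg (c ∈ C1)
    have n2 := ind_nonneg (y ∈ V1)
    have n3 := ind_nonneg (z ∈ V1)
    have n4 := ind_nonneg (¬ R c x y z)
    have n5 := ind_le_one (z ∈ A)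
    by_cases h1 : c ∈ C1
    · rw [ind_true h1]; linarith
    by_cases h2 : y ∈ V1
    · rw [ind_true h2]; linarith
    by_cases hr : R c x y z
    · by_cases h3 : z ∈ A
      · rw [ind_true (hcon c x y z hr h1 hx.1 hx.2 hy h2 h3)]; linarith
      · rw [ind_false h3]; linarith
    · rw [ind_true hr]; linarith
  have hs := Finset.sum_le_sum fun c (_ : c ∈ (univ : Finset C)) =>
    Finset.sum_le_sum fun y (hy : y ∈ A) =>
    Finset.sum_le_sum fun z (_ : z ∈ (univ : Finset V)) => key c y hy z
  have hw := hW x hx.1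
  simp only [Finset.sum_add_distrib, Finset.sum_const, Finset.card_univ, nsmul_eq_mul,
    ← Finset.mul_sum, sum_ind_mem, hV, hC] at hs
  push_cast at hs
  have q := sum_ind_mem_le A V1
  have h1 : 100 * (A.card:ℝ) ≤ 101 * m := by exact_mod_cast hA
  have h1' : 99 * (m:ℝ) ≤ 100 * A.card := by exact_mod_cast hA2
  have h2 : 100 * (V1.card:ℝ) ≤ m := by exact_mod_cast hV1
  have h2' : 100 * (C1.card:ℝ) ≤ m := by exact_mod_cast hC1
  have h3 : (1000:ℝ) ≤ m := by exact_mod_cast hm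
  set a : ℝ := (A.card : ℝ)
  set v : ℝ := (V1.card : ℝ)
  set u : ℝ := (C1.card : ℝ)
  set M : ℝ := (m : ℝ)
  have hM : 0 < M := by linarith
  have a0 : 0 ≤ a := by positivity
  have b1 : (99/100 * M) * (99/100 * M) ≤ a * a := mul_le_mul (by linarith) (by linarith)
    (by positivity) a0
  have b2 : a * u ≤ (101/100 * M) * (M / 100) := mul_le_mul (by linarith) (by linarith)
    (by positivity) (by positivity)
  have b3 : a * v ≤ (101/100 * M) * (M / 100) := mul_le_mul (by linarith) (by linarith)
    (by positivity) (by positivity)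
  have b4 : M * ∑ x ∈ A, ind (x ∈ V1) ≤ M * (M / 100) :=
    mul_le_mul_of_nonneg_left (by linarith) hM.le
  have c1 := mul_le_mul_of_nonneg_left b1 hM.le
  have c2 := mul_le_mul_of_nonneg_left b2 hM.le
  have c3 := mul_le_mul_of_nonneg_left b3 hM.le
  have c4 := mul_le_mul_of_nonneg_left b4 hM.le
  have hp : 0 < M * M * M := by positivity
  ring_nf at hs hw c1 c2 c3 c4 hp
  linarith
end
end RM

namespace RM
open Finset

section
variable {C V : Type} [Fintype C] [Fintype V] [DecidableEq C] [DecidableEq V]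
  (R : C → V → V → V → Prop) (m : ℕ)

lemma split_sum2 (A : Finset V) (f : V → V → ℝ) :
    ∑ x, ∑ y, f x y = ∑ x ∈ A, ∑ y, f x y + ∑ x ∈ Aᶜ, ∑ y ∈ A, f x y
      + ∑ x ∈ Aᶜ, ∑ y ∈ Aᶜ, f x y := by
  rw [← Finset.sum_add_sum_compl A (fun x => ∑ y, f x y), add_assoc, ← Finset.sum_add_distrib]
  congr 1
  exact Finset.sum_congr rfl fun x _ => (Finset.sum_add_sum_compl A (fun y => f x y)).symm

lemma card_compl_real (hV : Fintype.card V = 3 * m) (A : Finset V) :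
    ((Aᶜ).card : ℝ) = 3 * m - A.card := by
  have h1 := Finset.card_add_card_compl A
  rw [hV] at h1
  have h2 : (A.card : ℝ) + (Aᶜ).card = 3 * m := by exact_mod_cast h1
  linarith

lemma dlow (hR : ∀ c x y z, R c x y z → x ≠ y ∧ x ≠ z ∧ y ≠ z) (hV : Fintype.card V = 3 * m)
    (hdeg : ∀ c v, 5 * (m:ℝ)^2 - 7 * m + 4 ≤ ∑ x, ∑ y, ind (R c v x y))
    (A : Finset V) (c : C) (w : V) (hw : w ∉ A) :
    5 * (m:ℝ)^2 - 7 * m + 4 - A.card * (6 * m - A.card - 3)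
      ≤ ∑ x ∈ Aᶜ, ∑ y ∈ Aᶜ, ind (R c w x y) := by
  have h := hdeg c w
  rw [split_sum2 A] at h
  have hcc := card_compl_real m hV A
  have h1 : ∑ x ∈ A, ∑ y, ind (R c w x y) ≤ ∑ x ∈ A, (3 * (m:ℝ) - 2) := by
    refine Finset.sum_le_sum fun x hx => ?_
    have hxw : x ≠ w := fun e => hw (e ▸ hx)
    calc ∑ y, ind (R c w x y) ≤ ∑ y, (1 - ind (y = x) - ind (y = w)) := by
          refine Finset.sum_le_sum fun y _ => ?_
          by_cases hr : R c w x y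
          · obtain ⟨a1, a2, a3⟩ := hR _ _ _ _ hr
            rw [ind_true hr, ind_false (Ne.symm a3), ind_false (Ne.symm a2)]; norm_num
          · rw [ind_false hr]
            by_cases e : y = x
            · rw [ind_true e, ind_false (e ▸ hxw)]; norm_num
            · rw [ind_false e]; have := ind_le_one (y = w); linarith
      _ = 3 * m - 2 := by
          simp only [Finset.sum_sub_distrib, sum_ind_eq1, Finset.sum_const, Finset.card_univ, hV,
            nsmul_eq_mul]
          push_cast; ring
  have h2 : ∑ x ∈ Aᶜ, ∑ y ∈ A, ind (R c w x y) ≤ ∑ x ∈ Aᶜ, (A.card * (1 - ind (x = w)) : ℝ) := by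
    refine Finset.sum_le_sum fun x hx => ?_
    calc ∑ y ∈ A, ind (R c w x y) ≤ ∑ y ∈ A, (1 - ind (x = w)) := by
          refine Finset.sum_le_sum fun y _ => ?_
          by_cases hr : R c w x y
          · obtain ⟨a1, a2, a3⟩ := hR _ _ _ _ hr
            rw [ind_true hr, ind_false (Ne.symm a1)]; norm_num
          · rw [ind_false hr]; have := ind_le_one (x = w); linarith
      _ = _ := by rw [Finset.sum_const, nsmul_eq_mul]
  have h3 : ∑ x ∈ Aᶜ, ind (x = w) = 1 := by
    rw [Finset.sum_eq_single w]
    · exact ind_true rfl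
    · intro b _ hb; exact ind_false hb
    · intro hc; exact absurd (by simpa using hw) hc
  simp only [← Finset.mul_sum, Finset.sum_sub_distrib, Finset.sum_const, nsmul_eq_mul, h3, hcc]
    at h1 h2
  have e : (A.card:ℝ) * (6 * m - A.card - 3) = A.card * (3 * m - 2)
    + A.card * ((3 * m - A.card) * 1 - 1) := by ring
  rw [e]
  linarith

lemma missup (hV : Fintype.card V = 3 * m)
    (hdeg : ∀ c v, 5 * (m:ℝ)^2 - 7 * m + 4 ≤ ∑ x, ∑ y, ind (R c v x y))
    (A : Finset V) (c : C) (w : V) :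
    ∑ x ∈ A, ∑ y, ind (¬ R c w x y) ≤ (A.card - m) * (5 * m - A.card) + 7 * m
      + ∑ x ∈ Aᶜ, ∑ y ∈ Aᶜ, ind (R c w x y) := by
  have h := hdeg c w
  rw [split_sum2 A] at h
  have hcc := card_compl_real m hV A
  have h2 : ∑ x ∈ Aᶜ, ∑ y ∈ A, ind (R c w x y) ≤ ∑ x ∈ Aᶜ, ∑ y ∈ A, (1:ℝ) :=
    Finset.sum_le_sum fun x _ => Finset.sum_le_sum fun y _ => ind_le_one _
  simp only [ind_not, Finset.sum_sub_distrib, Finset.sum_const, Finset.card_univ, hV,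
    nsmul_eq_mul, mul_one, hcc] at h2 ⊢
  push_cast
  have e : ((A.card:ℝ) - m) * (5 * m - A.card) = A.card * (3 * m) + (3 * m - A.card) * A.card
    - 5 * (m:ℝ)^2 := by ring
  rw [e]
  linarith

lemma meet_bound (hs1 : ∀ c x y z, R c x y z → R c y x z) (hs2 : ∀ c x y z, R c x y z → R c x z y)
    (W U : Finset V) (hU : U ⊆ W) (c : C)
    (h : ∀ x ∈ W, ∀ y ∈ W, ∀ z ∈ W, R c x y z → x ∈ U ∨ y ∈ U ∨ z ∈ U) :
    ∑ x ∈ W, ∑ y ∈ W, ∑ z ∈ W, ind (R c x y z) ≤ 3 * ∑ x ∈ U, ∑ y ∈ W, ∑ z ∈ W, ind (R c x y z) := by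
  have key : ∀ x ∈ W, ∀ y ∈ W, ∀ z ∈ W, ind (R c x y z) ≤ ind (x ∈ U) * ind (R c x y z)
      + ind (y ∈ U) * ind (R c y x z) + ind (z ∈ U) * ind (R c z x y) := by
    intro x hx y hy z hz
    by_cases hr : R c x y z
    · rw [ind_true hr, ind_true (hs1 _ _ _ _ hr), ind_true (hs1 _ _ _ _ (hs2 _ _ _ _ hr))]
      have n1 := ind_nonneg (x ∈ U)
      have n2 := ind_nonneg (y ∈ U)
      have n3 := ind_nonneg (z ∈ U)
      rcases h x hx y hy z hz hr with h1 | h1 | h1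
      · rw [ind_true h1]; linarith
      · rw [ind_true h1]; linarith
      · rw [ind_true h1]; linarith
    · rw [ind_false hr]
      have := mul_nonneg (ind_nonneg (y ∈ U)) (ind_nonneg (R c y x z))
      have := mul_nonneg (ind_nonneg (z ∈ U)) (ind_nonneg (R c z x y))
      linarith
  have hres : ∀ g : V → ℝ, ∑ x ∈ W, ind (x ∈ U) * g x = ∑ x ∈ U, g x := by
    intro g
    rw [← Finset.sum_subset hU]
    · exact Finset.sum_congr rfl fun x hx => by rw [ind_true hx, one_mul]
    · intro x _ hx; rw [ind_false hx, zero_mul]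
  refine le_trans (Finset.sum_le_sum fun x hx => Finset.sum_le_sum fun y hy =>
    Finset.sum_le_sum fun z hz => key x hx y hy z hz) ?_
  simp only [Finset.sum_add_distrib]
  have e1 : ∑ x ∈ W, ∑ y ∈ W, ∑ z ∈ W, ind (x ∈ U) * ind (R c x y z)
      = ∑ x ∈ U, ∑ y ∈ W, ∑ z ∈ W, ind (R c x y z) := by
    simp only [← Finset.mul_sum]
    exact hres _
  have e2 : ∑ x ∈ W, ∑ y ∈ W, ∑ z ∈ W, ind (y ∈ U) * ind (R c y x z)
      = ∑ x ∈ U, ∑ y ∈ W, ∑ z ∈ W, ind (R c x y z) := by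
    rw [Finset.sum_comm]; exact e1
  have e3 : ∑ x ∈ W, ∑ y ∈ W, ∑ z ∈ W, ind (z ∈ U) * ind (R c z x y)
      = ∑ x ∈ U, ∑ y ∈ W, ∑ z ∈ W, ind (R c x y z) := by
    rw [← e1]
    rw [Finset.sum_congr rfl fun x _ => Finset.sum_comm]
    exact Finset.sum_comm
  rw [e1, e2, e3]
  linarith

set_option maxHeartbeats 1000000 in
lemma s1_step (hR : ∀ c x y z, R c x y z → x ≠ y ∧ x ≠ z ∧ y ≠ z)
    (hs1 : ∀ c x y z, R c x y z → R c y x z) (hs2 : ∀ c x y z, R c x y z → R c x z y)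
    (hm : 1000 ≤ m) (hC : Fintype.card C = m) (hV : Fintype.card V = 3 * m)
    (hdeg : ∀ c v, 5 * (m:ℝ)^2 - 7 * m + 4 ≤ ∑ x, ∑ y, ind (R c v x y))
    (A V1 : Finset V) (C1 : Finset C) (k : ℕ) (hA : A.card + k = m) (hk : 2 * k ≤ m)
    (hb : ∀ w, w ∉ A → ∑ c, ∑ x ∈ Aᶜ, ∑ y ∈ Aᶜ, ind (R c w x y) ≤ 12/1000 * (m:ℝ)^3)
    (hV1 : V1.card = 3 * C1.card) (hC1 : C1.card < k) (hVA : V1 ⊆ Aᶜ) :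
    ∃ c x y z, R c x y z ∧ c ∉ C1 ∧ x ∉ A ∧ x ∉ V1 ∧ y ∉ A ∧ y ∉ V1 ∧ z ∉ A ∧ z ∉ V1 := by
  by_contra hcon
  push Not at hcon
  have hcc := card_compl_real m hV A
  have hmR : (1000:ℝ) ≤ m := by exact_mod_cast hm
  have hAR : (A.card:ℝ) = m - k := by
    have : (A.card:ℝ) + k = m := by exact_mod_cast hA
    linarith
  have hkR : (2:ℝ) * k ≤ m := by exact_mod_cast hk
  have hC1R : (C1.card:ℝ) + 1 ≤ k := by exact_mod_cast hC1
  have h1 : ∀ c ∈ C1ᶜ, 2 * (m:ℝ) * (4 * m * C1.card + 2)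
      ≤ 3 * ∑ x ∈ V1, ∑ y ∈ Aᶜ, ∑ z ∈ Aᶜ, ind (R c x y z) := by
    intro c hc
    refine le_trans ?_ (meet_bound R hs1 hs2 Aᶜ V1 hVA c ?_)
    · have hd : ∀ w ∈ Aᶜ, 4 * (m:ℝ) * C1.card + 2 ≤ ∑ x ∈ Aᶜ, ∑ y ∈ Aᶜ, ind (R c w x y) := by
        intro w hw
        refine le_trans ?_ (dlow R m hR hV hdeg A c w (by simpa using hw))
        rw [hAR]
        have e : 5 * (m:ℝ)^2 - 7 * m + 4 - (m - k) * (6 * m - (m - k) - 3)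
          = 4 * m * (k - 1) + ((k - 1) * (k - 2) + 2) := by ring
        rw [e]
        have hk1 : (0:ℝ) ≤ (k - 1) * (k - 2) := by
          have hk0 : 1 ≤ k := by omega
          rcases Nat.eq_or_lt_of_le hk0 with h | h
          · rw [← h]; norm_num
          · have : (2:ℝ) ≤ k := by exact_mod_cast h
            exact mul_nonneg (by linarith) (by linarith)
        have : 4 * (m:ℝ) * C1.card ≤ 4 * m * (k - 1) :=
          mul_le_mul_of_nonneg_left (by linarith) (by positivity)
        linarith
      have h3 := Finset.sum_le_sum hd
      rw [Finset.sum_const, nsmul_eq_mul, hcc, hAR] at h3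
      refine le_trans ?_ h3
      apply mul_le_mul_of_nonneg_right _ (by positivity)
      have : (0:ℝ) ≤ k := by positivity
      linarith
    · intro x hx y hy z hz hr
      by_contra hno
      push Not at hno
      exact hno.2.2 (hcon c x y z hr (by simpa using hc) (by simpa using hx) hno.1
        (by simpa using hy) hno.2.1 (by simpa using hz))
  have h4 := Finset.sum_le_sum h1
  rw [Finset.sum_const, nsmul_eq_mul, ← Finset.mul_sum] at h4
  have h5 : ∑ c ∈ C1ᶜ, ∑ x ∈ V1, ∑ y ∈ Aᶜ, ∑ z ∈ Aᶜ, ind (R c x y z)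
      ≤ V1.card * (12/1000 * (m:ℝ)^3) := by
    calc ∑ c ∈ C1ᶜ, ∑ x ∈ V1, ∑ y ∈ Aᶜ, ∑ z ∈ Aᶜ, ind (R c x y z)
        ≤ ∑ c, ∑ x ∈ V1, ∑ y ∈ Aᶜ, ∑ z ∈ Aᶜ, ind (R c x y z) := by
          apply Finset.sum_le_sum_of_subset_of_nonneg (Finset.subset_univ _)
          intro c _ _
          exact Finset.sum_nonneg fun _ _ => Finset.sum_nonneg fun _ _ =>
            Finset.sum_nonneg fun _ _ => ind_nonneg _
      _ = ∑ x ∈ V1, ∑ c, ∑ y ∈ Aᶜ, ∑ z ∈ Aᶜ, ind (R c x y z) := Finset.sum_comm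
      _ ≤ ∑ x ∈ V1, (12/1000 * (m:ℝ)^3) :=
          Finset.sum_le_sum fun x hx => hb x (by simpa using hVA hx)
      _ = _ := by rw [Finset.sum_const, nsmul_eq_mul]
  have h6 : ((C1ᶜ).card : ℝ) = m - C1.card := by
    have h1 := Finset.card_add_card_compl C1
    rw [hC] at h1
    have h2 : (C1.card : ℝ) + (C1ᶜ).card = m := by exact_mod_cast h1
    linarith
  have h7 : (V1.card:ℝ) = 3 * C1.card := by exact_mod_cast hV1
  rw [h6] at h4
  rw [h7] at h5
  set j : ℝ := (C1.card:ℝ)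
  have j0 : 0 ≤ j := by positivity
  have h8 : (m:ℝ) / 2 * (2 * (m:ℝ) * (4 * m * j + 2)) ≤ (m - j) * (2 * (m:ℝ) * (4 * m * j + 2)) :=
    mul_le_mul_of_nonneg_right (by linarith) (by positivity)
  have h9 : 0 ≤ j * (m:ℝ)^3 := by positivity
  have h10 : 0 < (m:ℝ)^2 := by positivity
  have e : (m:ℝ) / 2 * (2 * (m:ℝ) * (4 * m * j + 2)) = 4 * (j * (m:ℝ)^3) + 2 * (m:ℝ)^2 := by ring
  rw [e] at h8
  have e2 : 3 * j * (12/1000 * (m:ℝ)^3) = 36/1000 * (j * (m:ℝ)^3) := by ring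
  rw [e2] at h5
  linarith
end
end RM

namespace RM
open Finset

lemma inter_out {V : Type} [DecidableEq V] {x : V} {S A : Finset V} (h : x ∉ A) :
    (insert x S) ∩ A = S ∩ A := Finset.insert_inter_of_notMem h

lemma inter_in {V : Type} [DecidableEq V] {x : V} {S A : Finset V} (h : x ∈ A) (hS : x ∉ S) :
    ((insert x S) ∩ A).card = (S ∩ A).card + 1 := by
  rw [Finset.insert_inter_of_mem h, Finset.card_insert_of_notMem (by simp [hS])]

section
variable {C V : Type} [Fintype C] [Fintype V] [DecidableEq C] [DecidableEq V]
  (R : C → V → V → V → Prop) (m : ℕ)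

lemma s1 (hR : ∀ c x y z, R c x y z → x ≠ y ∧ x ≠ z ∧ y ≠ z)
    (hs1 : ∀ c x y z, R c x y z → R c y x z) (hs2 : ∀ c x y z, R c x y z → R c x z y)
    (hm : 1000 ≤ m) (hC : Fintype.card C = m) (hV : Fintype.card V = 3 * m)
    (hdeg : ∀ c v, 5 * (m:ℝ)^2 - 7 * m + 4 ≤ ∑ x, ∑ y, ind (R c v x y))
    (A : Finset V) (k : ℕ) (hA : A.card + k = m) (hk : 2 * k ≤ m)
    (hb : ∀ w, w ∉ A → ∑ c, ∑ x ∈ Aᶜ, ∑ y ∈ Aᶜ, ind (R c w x y) ≤ 12/1000 * (m:ℝ)^3) :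
    ∀ j ≤ k, ∃ (C1 : Finset C) (V1 : Finset V), Mb R (C1.disjSum V1) ∧ C1.card = j ∧ V1 ⊆ Aᶜ := by
  intro j
  induction j with
  | zero =>
    intro _
    refine ⟨∅, ∅, ?_, rfl, by simp⟩
    simpa using Mb.nil
  | succ j ih =>
    intro hj
    obtain ⟨C1, V1, hM, hc1, hv1⟩ := ih (by omega)
    obtain ⟨c, x, y, z, hr, hc, hx, hx', hy, hy', hz, hz'⟩ := s1_step R m hR hs1 hs2 hm hC hV hdeg
      A V1 C1 k hA hk hb (St.card hR hM) (by omega) hv1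
    refine ⟨_, _, St.cons hM hr hc hx' hy' hz', ?_, ?_⟩
    · rw [Finset.card_insert_of_notMem hc, hc1]
    · intro a ha
      simp only [mem_insert] at ha
      rw [Finset.mem_compl]
      rcases ha with rfl | rfl | rfl | ha
      · exact hx
      · exact hy
      · exact hz
      · simpa using hv1 ha

/-- state of the partial matching: `D` is the surplus of `A` -/
def Sta (R : C → V → V → V → Prop) (m : ℕ) (A : Finset V) (C1 : Finset C) (V1 : Finset V)
    (D : ℕ) : Prop :=
  Mb R (C1.disjSum V1) ∧ C1.card + A.card = (V1 ∩ A).card + m + D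

lemma s2 (hR : ∀ c x y z, R c x y z → x ≠ y ∧ x ≠ z ∧ y ≠ z)
    (hm : 1000 ≤ m) (hV : Fintype.card V = 3 * m)
    (hdeg : ∀ c v, 5 * (m:ℝ)^2 - 7 * m + 4 ≤ ∑ x, ∑ y, ind (R c v x y))
    (A : Finset V) (hA : 100 * A.card ≤ 101 * m) (C0 : Finset C) (V0 : Finset V) (D0 : ℕ)
    (h0 : Sta R m A C0 V0 D0) (T : Finset C) (hT : 300 * (C0.card + T.card) ≤ m) :
    ∃ C1 V1 D, Sta R m A C1 V1 D ∧ T ⊆ C1 ∧ C1.card ≤ C0.card + T.card ∧ D ≤ D0 + T.card := by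
  induction T using Finset.induction_on with
  | empty => exact ⟨C0, V0, D0, h0, by simp, by simp, by simp⟩
  | insert c T hcT ih =>
    rw [Finset.card_insert_of_notMem hcT] at hT ⊢
    obtain ⟨C1, V1, D, ⟨hM, hD⟩, hTC, hc1, hD1⟩ := ih (by omega)
    by_cases hc : c ∈ C1
    · refine ⟨C1, V1, D, ⟨hM, hD⟩, ?_, by omega, by omega⟩
      intro a ha
      rcases Finset.mem_insert.mp ha with rfl | ha
      · exact hc
      · exact hTC ha
    have hv := St.card hR hM
    obtain ⟨x, y, z, hr, hx, hx', hy, hy', hz'⟩ := s2_step R m hm hV hdeg A V1 hA (by omega) c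
    have hM' := St.cons hM hr hc hx' hy' hz'
    by_cases hz : z ∈ A
    · refine ⟨_, _, D, ⟨hM', ?_⟩, Finset.insert_subset_insert c hTC, ?_, by omega⟩
      · rw [inter_out hx, inter_out hy, inter_in hz hz', Finset.card_insert_of_notMem hc]; omega
      · rw [Finset.card_insert_of_notMem hc]; omega
    · refine ⟨_, _, D + 1, ⟨hM', ?_⟩, Finset.insert_subset_insert c hTC, ?_, by omega⟩
      · rw [inter_out hx, inter_out hy, inter_out hz, Finset.card_insert_of_notMem hc]; omega
      · rw [Finset.card_insert_of_notMem hc]; omega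

lemma s3 (hR : ∀ c x y z, R c x y z → x ≠ y ∧ x ≠ z ∧ y ≠ z)
    (hm : 1000 ≤ m) (hV : Fintype.card V = 3 * m)
    (A : Finset V)
    (hAc : ∀ a ∈ A, ∃ G : Finset C, m ≤ 1000 * G.card ∧
      ∀ c ∈ G, (m:ℝ)^2 / 2000 ≤ ∑ x ∈ Aᶜ, ∑ y ∈ Aᶜ, ind (R c a x y))
    (C0 : Finset C) (V0 : Finset V) (D : ℕ)
    (h0 : Sta R m A C0 V0 D) (T : Finset V) (hTA : T ⊆ A)
    (hT : 60000 * (C0.card + T.card) ≤ m) :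
    ∃ C1 V1, Sta R m A C1 V1 D ∧ C0 ⊆ C1 ∧ T ⊆ V1 ∧ C1.card ≤ C0.card + T.card := by
  induction T using Finset.induction_on with
  | empty => exact ⟨C0, V0, h0, by simp, by simp, by simp⟩
  | insert a T haT ih =>
    rw [Finset.card_insert_of_notMem haT] at hT ⊢
    obtain ⟨C1, V1, ⟨hM, hD⟩, hCC, hTC, hc1⟩ := ih
      (fun x hx => hTA (Finset.mem_insert_of_mem hx)) (by omega)
    have haA : a ∈ A := hTA (Finset.mem_insert_self _ _)
    by_cases ha : a ∈ V1
    · refine ⟨C1, V1, ⟨hM, hD⟩, hCC, ?_, by omega⟩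
      intro b hb
      rcases Finset.mem_insert.mp hb with rfl | hb
      · exact ha
      · exact hTC hb
    have hv := St.card hR hM
    obtain ⟨G, hG, hG2⟩ := hAc a haA
    obtain ⟨c, x, y, hr, hc, hx, hx', hy, hy'⟩ := s3_step R m hm hV A V1 C1 a G hG hG2
      (by omega) (by omega)
    obtain ⟨d1, d2, d3⟩ := hR _ _ _ _ hr
    refine ⟨_, _, ⟨St.cons hM hr hc ha hx' hy', ?_⟩, hCC.trans (Finset.subset_insert _ _), ?_, ?_⟩
    · rw [inter_in haA (by simp [d1, d2, ha]), inter_out hx, inter_out hy,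
        Finset.card_insert_of_notMem hc]
      omega
    · intro b hb
      rcases Finset.mem_insert.mp hb with rfl | hb
      · simp
      · simp [hTC hb]
    · rw [Finset.card_insert_of_notMem hc]; omega

lemma s4 (hR : ∀ c x y z, R c x y z → x ≠ y ∧ x ≠ z ∧ y ≠ z)
    (hm : 1000 ≤ m) (hC : Fintype.card C = m) (hV : Fintype.card V = 3 * m)
    (A : Finset V) (hA : 100 * A.card ≤ 101 * m) (hA2 : 99 * m ≤ 100 * A.card)
    (hW : ∀ w, w ∉ A → ∑ c, ∑ a ∈ A, ∑ z, ind (¬ R c w a z) ≤ 13 / 1000 * (m:ℝ)^3)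
    (D : ℕ) : ∀ (C0 : Finset C) (V0 : Finset V)
    (h0 : Sta R m A C0 V0 D) (hT : 300 * (C0.card + D) ≤ m),
    ∃ C1 V1, Sta R m A C1 V1 0 ∧ C0 ⊆ C1 ∧ V0 ⊆ V1 ∧ C1.card ≤ C0.card + D := by
  induction D with
  | zero => exact fun C0 V0 h0 _ => ⟨C0, V0, h0, by simp, by simp, by simp⟩
  | succ D ih =>
    intro C0 V0 h0 hT
    obtain ⟨hM, hD⟩ := h0
    have hv := St.card hR hM
    obtain ⟨c, x, y, z, hr, hc, hx, hx', hy, hy', hz, hz'⟩ := s4_step R m hm hC hV A V0 C0 hA hA2 hW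
      (by omega) (by omega)
    obtain ⟨d1, d2, d3⟩ := hR _ _ _ _ hr
    obtain ⟨C1, V1, hS, hCC, hVV, hcard⟩ := ih _ _ ⟨St.cons hM hr hc hx' hy' hz', by
      rw [inter_out hx, inter_in hy (by simp [d3, hy']), inter_in hz hz',
        Finset.card_insert_of_notMem hc]
      omega⟩ (by rw [Finset.card_insert_of_notMem hc]; omega)
    rw [Finset.card_insert_of_notMem hc] at hcard
    refine ⟨C1, V1, hS, (Finset.subset_insert _ _).trans hCC, ?_, by omega⟩
    intro a ha
    exact hVV (by simp [ha])
end
end RM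

namespace RM
open Finset

lemma markov {ι : Type*} (s : Finset ι) (f : ι → ℝ) (t B : ℝ) [DecidablePred fun i => t < f i]
    (hf : ∀ i ∈ s, 0 ≤ f i)
    (h : ∑ i ∈ s, f i ≤ B) : ((s.filter fun i => t < f i).card : ℝ) * t ≤ B := by
  refine le_trans ?_ h
  calc ((s.filter fun i => t < f i).card : ℝ) * t = ∑ i ∈ s.filter fun i => t < f i, t := by
        rw [Finset.sum_const, nsmul_eq_mul]
    _ ≤ ∑ i ∈ s.filter fun i => t < f i, f i :=
        Finset.sum_le_sum fun i hi => (Finset.mem_filter.mp hi).2.le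
    _ ≤ ∑ i ∈ s, f i := Finset.sum_le_sum_of_subset_of_nonneg (Finset.filter_subset _ _)
        (fun i hi _ => hf i hi)

lemma sum3_le {X Y Z : Type*} {S S' : Finset X} {T T' : Finset Y} {U U' : Finset Z}
    (hS : S ⊆ S') (hT : T ⊆ T') (hU : U ⊆ U') (f g : X → Y → Z → ℝ)
    (hfg : ∀ x y z, f x y z ≤ g x y z) (hg : ∀ x y z, 0 ≤ g x y z) :
    ∑ x ∈ S, ∑ y ∈ T, ∑ z ∈ U, f x y z ≤ ∑ x ∈ S', ∑ y ∈ T', ∑ z ∈ U', g x y z := by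
  refine (Finset.sum_le_sum_of_subset_of_nonneg hS fun x _ _ => Finset.sum_nonneg fun y _ =>
    Finset.sum_nonneg fun z _ => hg x y z).trans' (Finset.sum_le_sum fun x _ => ?_)
  refine (Finset.sum_le_sum_of_subset_of_nonneg hT fun y _ _ =>
    Finset.sum_nonneg fun z _ => hg x y z).trans' (Finset.sum_le_sum fun y _ => ?_)
  exact (Finset.sum_le_sum_of_subset_of_nonneg hU fun z _ _ => hg x y z).trans'
    (Finset.sum_le_sum fun z _ => hfg x y z)

section
variable {C V : Type} [Fintype C] [Fintype V] [DecidableEq C] [DecidableEq V]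
  (R : C → V → V → V → Prop) (m : ℕ)

set_option maxHeartbeats 1000000 in
lemma s5 (hs1 : ∀ c x y z, R c x y z → R c y x z) (hs2 : ∀ c x y z, R c x y z → R c x z y)
    (hR : ∀ c x y z, R c x y z → x ≠ y ∧ x ≠ z ∧ y ≠ z)
    (hm : 1000 ≤ m) (hC : Fintype.card C = m) (hV : Fintype.card V = 3 * m)
    (A : Finset V)
    (hW : ∀ w, w ∉ A → ∑ c, ∑ a ∈ A, ∑ z, ind (¬ R c w a z) ≤ 13 / 1000 * (m:ℝ)^3)
    (C1 : Finset C) (V1 : Finset V) (h : Sta R m A C1 V1 0) (hC1 : 10 * C1.card ≤ m)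
    (hc : ∀ c, c ∉ C1 → ∑ w ∈ Aᶜ, ∑ a ∈ A, ∑ z, ind (¬ R c w a z) ≤ 1 / 1000 * (m:ℝ)^3)
    (ha : ∀ a ∈ A, a ∉ V1 → ∑ c, ∑ w ∈ Aᶜ, ∑ z, ind (¬ R c w a z) ≤ 1 / 1000 * (m:ℝ)^3) :
    Mb R univ := by
  obtain ⟨hM, hD⟩ := h
  have hv := St.card hR hM
  have hCle : C1.card ≤ m := by omega
  obtain ⟨r, hr⟩ : ∃ r, r + C1.card = m := ⟨m - C1.card, by omega⟩
  have hrr : (9/10 : ℝ) * m ≤ r := by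
    have h1 : 9 * m ≤ 10 * r := by omega
    have h2 : 9 * (m:ℝ) ≤ 10 * r := by exact_mod_cast h1
    linarith
  have hr3 : 13 / 1000 * (m:ℝ)^3 ≤ (r:ℝ)^3/10 := by
    have := pow_le_pow_left₀ (by positivity) hrr 3
    have hp : 0 ≤ (m:ℝ)^3 := by positivity
    rw [mul_pow] at this
    linarith
  have hr3' : 1 / 1000 * (m:ℝ)^3 ≤ (r:ℝ)^3/10 := by
    have hp : 0 ≤ (m:ℝ)^3 := by positivity
    linarith
  have hsub1 : C1ᶜ ⊆ univ := Finset.subset_univ _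
  have hsub2 : A \ V1 ⊆ A := Finset.sdiff_subset
  have hsub3 : Aᶜ \ V1 ⊆ Aᶜ := Finset.sdiff_subset
  have hsub4 : Aᶜ \ V1 ⊆ univ := Finset.subset_univ _
  have sw1 : ∀ c a w z, ind (¬ R c a w z) ≤ ind (¬ R c w a z) := fun c a w z =>
    ind_mono (fun h h' => h (hs1 _ _ _ _ h'))
  have sw2 : ∀ c a w z, ind (¬ R c a w z) ≤ ind (¬ R c z a w) := fun c a w z =>
    ind_mono (fun h h' => h (hs2 _ _ _ _ (hs1 _ _ _ _ h')))
  have hcard1 : (A ∩ V1).card + (A \ V1).card = A.card := Finset.card_inter_add_card_sdiff A V1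
  have hcard2 : (Aᶜ ∩ V1).card + (Aᶜ \ V1).card = (Aᶜ).card := Finset.card_inter_add_card_sdiff Aᶜ V1
  have hcard3 : (V1 ∩ A).card + (V1 \ A).card = V1.card := Finset.card_inter_add_card_sdiff V1 A
  have hcard4 := Finset.card_add_card_compl A
  have e1 : V1 \ A = Aᶜ ∩ V1 := by ext x; simp [and_comm]
  have hcard5 := Finset.card_add_card_compl C1
  rw [Finset.inter_comm] at hcard3
  rw [Finset.inter_comm] at hD
  rw [e1] at hcard3
  rw [hV] at hcard4
  rw [hC] at hcard5
  have hT := tp_Mb R C1ᶜ (A \ V1) (Aᶜ \ V1) r (by omega) (by omega) (by omega)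
    (by
      rw [Finset.disjoint_left]
      intro x hx hx'
      simp only [mem_sdiff, mem_compl] at hx hx'
      exact hx'.1 hx.1) (by omega)
    (by
      intro c hc'
      refine le_trans ?_ ((hc c (by simpa using hc')).trans hr3')
      rw [Finset.sum_comm (s := Aᶜ)]
      exact sum3_le hsub2 hsub3 hsub4 _ _ (fun a w z => sw1 c a w z) (fun _ _ _ => ind_nonneg _))
    (by
      intro a ha'
      have := Finset.mem_sdiff.mp ha'
      refine le_trans ?_ ((ha a this.1 this.2).trans hr3')
      exact sum3_le hsub1 hsub3 hsub4 _ _ (fun c w z => sw1 c a w z) (fun _ _ _ => ind_nonneg _))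
    (by
      intro w hw'
      refine le_trans ?_ ((hW w (by simpa using (Finset.mem_sdiff.mp hw').1)).trans hr3)
      exact sum3_le hsub1 hsub2 hsub4 _ _ (fun c a z => sw1 c a w z) (fun _ _ _ => ind_nonneg _))
    (by
      intro z hz'
      refine le_trans ?_ ((hW z (by simpa using (Finset.mem_sdiff.mp hz').1)).trans hr3)
      exact sum3_le hsub1 hsub2 hsub4 _ _ (fun c a w => sw2 c a w z) (fun _ _ _ => ind_nonneg _))
  have hU := Mb.union hM hT (by
    rw [Finset.disjoint_left]
    rintro (x | x) hx hx'
    · simp at hx hx'; exact hx' hx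
    · simp at hx hx'
      rcases hx' with h | h
      · exact h.2 hx
      · exact h.2 hx)
  convert hU using 1
  ext x
  rcases x with x | x
  · simp [em]
  · simp only [mem_univ, mem_union, inr_mem_disjSum, mem_sdiff, mem_compl, true_iff]
    tauto

set_option maxHeartbeats 1000000 in
lemma ext_core (hs1 : ∀ c x y z, R c x y z → R c y x z) (hs2 : ∀ c x y z, R c x y z → R c x z y)
    (hR : ∀ c x y z, R c x y z → x ≠ y ∧ x ≠ z ∧ y ≠ z)
    (hm : 10000000000000 ≤ m) (hC : Fintype.card C = m) (hV : Fintype.card V = 3 * m)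
    (hdeg : ∀ c v, 5 * (m:ℝ)^2 - 7 * m + 4 ≤ ∑ x, ∑ y, ind (R c v x y))
    (A : Finset V) (hA1 : 1000000000000 * A.card ≤ 1000000000000 * m + m)
    (hA2 : 1000000000000 * m ≤ 1000000000000 * A.card + m)
    (hb : ∀ w, w ∉ A → ∑ c, ∑ x ∈ Aᶜ, ∑ y ∈ Aᶜ, ind (R c w x y) ≤ 12/1000 * (m:ℝ)^3)
    (hAc : ∀ a ∈ A, ∃ G : Finset C, m ≤ 1000 * G.card ∧
      ∀ c ∈ G, (m:ℝ)^2 / 2000 ≤ ∑ x ∈ Aᶜ, ∑ y ∈ Aᶜ, ind (R c a x y))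
    (hd : ∑ c, ∑ w ∈ Aᶜ, ∑ x ∈ Aᶜ, ∑ y ∈ Aᶜ, ind (R c w x y)
      ≤ 50 / 1000000000000 * (m:ℝ)^4) : Mb R univ := by
  classical
  have hmR : (10000000000000:ℝ) ≤ m := by exact_mod_cast hm
  have hA1R : (A.card:ℝ) - m ≤ m / 1000000000000 := by
    have : 1000000000000 * (A.card:ℝ) ≤ 1000000000000 * m + m := by exact_mod_cast hA1
    linarith
  have hA2R : (m:ℝ) - A.card ≤ m / 1000000000000 := by
    have : 1000000000000 * (m:ℝ) ≤ 1000000000000 * A.card + m := by exact_mod_cast hA2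
    linarith
  have hmm : (10000000000000:ℝ) * m ≤ (m:ℝ)^2 := by
    rw [sq]; exact mul_le_mul_of_nonneg_right hmR (by linarith)
  have hmiss : ∀ c w, ∑ x ∈ A, ∑ y, ind (¬ R c w x y) ≤ 6 / 1000000000000 * (m:ℝ)^2
      + ∑ x ∈ Aᶜ, ∑ y ∈ Aᶜ, ind (R c w x y) := by
    intro c w
    refine (missup R m hV hdeg A c w).trans ?_
    have h1 : ((A.card:ℝ) - m) * (5 * m - A.card) ≤ m / 1000000000000 * (5 * m) := by
      have a0 : (0:ℝ) ≤ A.card := by positivity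
      exact mul_le_mul hA1R (by linarith) (by linarith) (by linarith)
    have e : (m:ℝ) / 1000000000000 * (5 * m) = 5 / 1000000000000 * (m:ℝ)^2 := by ring
    linarith
  have hm3 : (m:ℝ)^3 = m * (m:ℝ)^2 := by ring
  have hm4 : (m:ℝ)^4 = m * (m * (m:ℝ)^2) := by ring
  have hm4' : (m:ℝ)^4 = m * (m:ℝ)^3 := by ring
  have hW : ∀ w, w ∉ A → ∑ c, ∑ a ∈ A, ∑ z, ind (¬ R c w a z) ≤ 13 / 1000 * (m:ℝ)^3 := by
    intro w hw
    refine (Finset.sum_le_sum fun c _ => hmiss c w).trans ?_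
    rw [Finset.sum_add_distrib, Finset.sum_const, Finset.card_univ, hC, nsmul_eq_mul]
    have := hb w hw
    have hp : 0 ≤ (m:ℝ)^3 := by positivity
    have e : (m:ℝ) * (6 / 1000000000000 * (m:ℝ)^2) = 6 / 1000000000000 * (m:ℝ)^3 := by ring
    linarith
  have htot : ∑ c, ∑ w ∈ Aᶜ, ∑ a ∈ A, ∑ z, ind (¬ R c w a z) ≤ 1 / 10000000000 * (m:ℝ)^4 := by
    refine (Finset.sum_le_sum fun c _ => Finset.sum_le_sum fun w _ => hmiss c w).trans ?_
    simp only [Finset.sum_add_distrib, Finset.sum_const, Finset.card_univ, hC, nsmul_eq_mul]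
    have hcc := card_compl_real m hV A
    have hcc' : ((Aᶜ).card : ℝ) ≤ 3 * m := by
      rw [hcc]; have : (0:ℝ) ≤ A.card := by positivity
      linarith
    have h1 : (m:ℝ) * ((Aᶜ).card * (6 / 1000000000000 * (m:ℝ)^2))
        ≤ m * (3 * m * (6 / 1000000000000 * (m:ℝ)^2)) :=
      mul_le_mul_of_nonneg_left (mul_le_mul_of_nonneg_right hcc' (by positivity)) (by positivity)
    have e : (m:ℝ) * (3 * m * (6 / 1000000000000 * (m:ℝ)^2)) = 18 / 1000000000000 * (m:ℝ)^4 := by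
      ring
    have hp : 0 ≤ (m:ℝ)^4 := by positivity
    linarith
  have fin : ∀ n : ℕ, (n:ℝ) * (1/1000 * (m:ℝ)^3) ≤ 1 / 10000000000 * (m:ℝ)^4 →
      10000000 * n ≤ m := by
    intro n hn
    have hp : 0 < (m:ℝ)^3 := by positivity
    have h1 : (10000000 * (n:ℝ)) * (m:ℝ)^3 ≤ m * (m:ℝ)^3 := by
      rw [hm4'] at hn; linarith
    have := le_of_mul_le_mul_right h1 hp
    exact_mod_cast this
  have hCb := fin _ (markov univ (fun c => ∑ w ∈ Aᶜ, ∑ a ∈ A, ∑ z, ind (¬ R c w a z))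
    (1/1000 * (m:ℝ)^3) _ (fun c _ => Finset.sum_nonneg fun _ _ => Finset.sum_nonneg fun _ _ =>
      Finset.sum_nonneg fun _ _ => ind_nonneg _) htot)
  have htot2 : ∑ a ∈ A, ∑ c, ∑ w ∈ Aᶜ, ∑ z, ind (¬ R c w a z) ≤ 1 / 10000000000 * (m:ℝ)^4 := by
    refine le_trans (le_of_eq ?_) htot
    rw [Finset.sum_comm]
    exact Finset.sum_congr rfl fun c _ => Finset.sum_comm
  have hAb := fin _ (markov A (fun a => ∑ c, ∑ w ∈ Aᶜ, ∑ z, ind (¬ R c w a z))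
    (1/1000 * (m:ℝ)^3) _ (fun c _ => Finset.sum_nonneg fun _ _ => Finset.sum_nonneg fun _ _ =>
      Finset.sum_nonneg fun _ _ => ind_nonneg _) htot2)
  set Cb := univ.filter fun c => 1/1000 * (m:ℝ)^3 < ∑ w ∈ Aᶜ, ∑ a ∈ A, ∑ z, ind (¬ R c w a z)
    with hCbd
  set Ab := A.filter fun a => 1/1000 * (m:ℝ)^3 < ∑ c, ∑ w ∈ Aᶜ, ∑ z, ind (¬ R c w a z) with hAbd
  have hst0 : ∃ C0 V0 D0, Sta R m A C0 V0 D0 ∧ 1000000000000 * C0.card ≤ m ∧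
      1000000000000 * D0 ≤ m := by
    rcases le_total A.card m with h | h
    · obtain ⟨C0, V0, hM, hc0, hv0⟩ := s1 R m hR hs1 hs2 (by omega) hC hV hdeg A (m - A.card)
        (by omega) (by omega) hb (m - A.card) le_rfl
      refine ⟨C0, V0, 0, ⟨hM, ?_⟩, by omega, by omega⟩
      have : V0 ∩ A = ∅ := by
        rw [← Finset.disjoint_iff_inter_eq_empty, Finset.disjoint_left]
        intro x hx; simpa using hv0 hx
      rw [this]; simp; omega
    · refine ⟨∅, ∅, A.card - m, ⟨by simpa using Mb.nil, ?_⟩, by simp, by omega⟩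
      simp; omega
  obtain ⟨C0, V0, D0, hS0, hc0, hd0⟩ := hst0
  obtain ⟨C1, V1, D1, hS1, hT1, hc1, hd1⟩ := s2 R m hR (by omega) hV hdeg A (by omega) C0 V0 D0 hS0
    Cb (by omega)
  obtain ⟨C2, V2, hS2, hC12, hT2, hc2⟩ := s3 R m hR (by omega) hV A hAc C1 V1 D1 hS1 Ab
    (Finset.filter_subset _ _) (by omega)
  obtain ⟨C3, V3, hS3, hC23, hV23, hc3⟩ := s4 R m hR (by omega) hC hV A (by omega) (by omega) hW D1
    C2 V2 hS2 (by omega)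
  refine s5 R m hs1 hs2 hR (by omega) hC hV A hW C3 V3 hS3 (by omega) ?_ ?_
  · intro c hc
    by_contra hcon
    push Not at hcon
    exact hc (hC23 (hC12 (hT1 (by rw [hCbd, Finset.mem_filter]; exact ⟨mem_univ _, hcon⟩))))
  · intro a ha ha'
    by_contra hcon
    push Not at hcon
    exact ha' (hV23 (hT2 (by rw [hAbd, Finset.mem_filter]; exact ⟨ha, hcon⟩)))
end
end RM

namespace RM
open Finset

section
variable {C V : Type} [Fintype C] [Fintype V] [DecidableEq C] [DecidableEq V]
  (R : C → V → V → V → Prop) (m : ℕ)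

lemma compl_cmp (hV : Fintype.card V = 3 * m) (S A : Finset V) (p : V → V → Prop) :
    ∑ x ∈ Sᶜ, ∑ y ∈ Sᶜ, ind (p x y) ≤ ∑ x ∈ Aᶜ, ∑ y ∈ Aᶜ, ind (p x y) + 6 * m * (A \ S).card := by
  have key : ∀ x ∈ Sᶜ, ∀ y ∈ Sᶜ, ind (p x y) ≤ ind (x ∉ A) * (ind (y ∉ A) * ind (p x y))
      + ind (x ∈ A \ S) + ind (y ∈ A \ S) := by
    intro x hx y hy
    have n1 := ind_nonneg (x ∈ A \ S)
    have n2 := ind_nonneg (y ∈ A \ S)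
    have n3 := mul_nonneg (ind_nonneg (x ∉ A)) (mul_nonneg (ind_nonneg (y ∉ A)) (ind_nonneg (p x y)))
    have n4 := ind_le_one (p x y)
    by_cases h1 : x ∈ A
    · rw [ind_true (show x ∈ A \ S by simp at hx ⊢; exact ⟨h1, hx⟩)]; linarith
    by_cases h2 : y ∈ A
    · rw [ind_true (show y ∈ A \ S by simp at hy ⊢; exact ⟨h2, hy⟩)]; linarith
    rw [ind_true h1, ind_true h2]; linarith
  have hs := Finset.sum_le_sum fun x hx => Finset.sum_le_sum fun y hy => key x hx y hy
  refine hs.trans ?_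
  simp only [Finset.sum_add_distrib, Finset.sum_const, nsmul_eq_mul, ← Finset.mul_sum]
  have hres : ∀ g : V → ℝ, (∀ v, 0 ≤ g v) →
      ∑ x ∈ Sᶜ, ind (x ∉ A) * g x ≤ ∑ x ∈ Aᶜ, g x := by
    intro g hg
    refine (Finset.sum_le_sum_of_subset_of_nonneg (Finset.subset_univ _) fun x _ _ =>
      mul_nonneg (ind_nonneg _) (hg x)).trans (le_of_eq ?_)
    rw [← Finset.sum_subset (Finset.subset_univ Aᶜ)]
    · exact Finset.sum_congr rfl fun x hx => by rw [ind_true (by simpa using hx), one_mul]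
    · intro x _ hx; rw [ind_false (by simpa using hx), zero_mul]
  have h1 : ∑ x ∈ Sᶜ, ind (x ∉ A) * ∑ y ∈ Sᶜ, ind (y ∉ A) * ind (p x y)
      ≤ ∑ x ∈ Aᶜ, ∑ y ∈ Aᶜ, ind (p x y) := by
    refine (hres _ fun x => Finset.sum_nonneg fun y _ =>
      mul_nonneg (ind_nonneg _) (ind_nonneg _)).trans ?_
    exact Finset.sum_le_sum fun x _ => hres _ fun y => ind_nonneg _
  have h2 := sum_ind_mem_le Sᶜ (A \ S)
  have h3 : ((Sᶜ).card : ℝ) ≤ 3 * m := by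
    have := Finset.card_le_univ Sᶜ
    rw [hV] at this
    exact_mod_cast this
  have q0 : 0 ≤ ∑ x ∈ Sᶜ, ind (x ∈ A \ S) := Finset.sum_nonneg fun _ _ => ind_nonneg _
  have p1 : ((Sᶜ).card : ℝ) * ∑ x ∈ Sᶜ, ind (x ∈ A \ S) ≤ 3 * m * (A \ S).card :=
    mul_le_mul h3 h2 q0 (by positivity)
  linarith

/-- average bound from few large colours -/
lemma avg_bound (hC : Fintype.card C = m) (f : C → ℝ) (G : Finset C) (B b : ℝ)
    (hB : ∀ c, f c ≤ B) (hb : ∀ c, c ∉ G → f c ≤ b) (hb0 : 0 ≤ b) :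
    ∑ c, f c ≤ G.card * B + m * b := by
  rw [← Finset.sum_add_sum_compl G]
  have h1 : ∑ c ∈ G, f c ≤ ∑ c ∈ G, B := Finset.sum_le_sum fun c _ => hB c
  have h2 : ∑ c ∈ Gᶜ, f c ≤ ∑ c ∈ Gᶜ, b := Finset.sum_le_sum fun c hc => hb c (by simpa using hc)
  have h3 : ((Gᶜ).card : ℝ) ≤ m := by
    have := Finset.card_le_univ Gᶜ
    rw [hC] at this
    exact_mod_cast this
  rw [Finset.sum_const, nsmul_eq_mul] at h1 h2
  have := mul_le_mul_of_nonneg_right h3 hb0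
  linarith

set_option maxHeartbeats 2000000 in
lemma ext_case (hs1 : ∀ c x y z, R c x y z → R c y x z) (hs2 : ∀ c x y z, R c x y z → R c x z y)
    (hR : ∀ c x y z, R c x y z → x ≠ y ∧ x ≠ z ∧ y ≠ z)
    (hm : 10000000000000000000000 ≤ m) (hC : Fintype.card C = m) (hV : Fintype.card V = 3 * m)
    (hdeg : ∀ c v, 5 * (m:ℝ)^2 - 7 * m + 4 ≤ ∑ x, ∑ y, ind (R c v x y))
    (S : Finset V) (hS : S.card = m)
    (hlow : ∑ c, ∑ w ∈ Sᶜ, ∑ x ∈ Sᶜ, ∑ y ∈ Sᶜ, ind (R c w x y)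
      ≤ 1 / 100000000000000000000 * (m:ℝ)^4) : Mb R univ := by
  classical
  have hmR : (10000000000000000000000:ℝ) ≤ m := by exact_mod_cast hm
  have hm0 : (0:ℝ) < m := by linarith
  have hScc : ((Sᶜ).card : ℝ) = 2 * m := by
    rw [card_compl_real m hV S, hS]; ring
  obtain ⟨dW, hdW⟩ : ∃ dW : C → V → ℝ, dW = fun c v => ∑ x ∈ Sᶜ, ∑ y ∈ Sᶜ, ind (R c v x y) := ⟨_, rfl⟩
  have hdW' : ∀ c v, ∑ x ∈ Sᶜ, ∑ y ∈ Sᶜ, ind (R c v x y) = dW c v := fun c v => by rw [hdW]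
  have dW0 : ∀ c v, 0 ≤ dW c v := fun c v => by
    rw [hdW]; exact Finset.sum_nonneg fun _ _ => Finset.sum_nonneg fun _ _ => ind_nonneg _
  have dW4 : ∀ c v, dW c v ≤ 4 * (m:ℝ)^2 := fun c v => by
    rw [← hdW']
    refine (Finset.sum_le_sum fun x _ => Finset.sum_le_sum fun y _ => ind_le_one _).trans ?_
    simp only [Finset.sum_const, nsmul_eq_mul, mul_one, hScc]
    apply le_of_eq; ring
  obtain ⟨G, hG⟩ : ∃ G : V → Finset C, G = fun v => univ.filter fun c => (m:ℝ)^2/1000 ≤ dW c v :=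
    ⟨_, rfl⟩
  have hGm : ∀ v c, c ∈ G v ↔ (m:ℝ)^2/1000 ≤ dW c v := by intro v c; rw [hG]; simp
  obtain ⟨A, hA⟩ : ∃ A : Finset V, A = univ.filter fun v => m ≤ 1000 * (G v).card := ⟨_, rfl⟩
  have hAm : ∀ v, v ∈ A ↔ m ≤ 1000 * (G v).card := by intro v; rw [hA]; simp
  have hm4 : (m:ℝ)^4 = m * (m:ℝ)^3 := by ring
  have hp3 : 0 < (m:ℝ)^3 := by positivity
  have hp4 : 0 < (m:ℝ)^4 := by positivity
  simp only [hdW'] at hlow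
  -- sums for vertices not in A
  have hsum : ∀ v, v ∉ A → ∑ c, dW c v ≤ 5/1000 * (m:ℝ)^3 := by
    intro v hv
    have h1 := avg_bound m hC (fun c => dW c v) (G v) (4 * (m:ℝ)^2) ((m:ℝ)^2/1000)
      (fun c => dW4 c v) (fun c hc => by
        rw [hGm] at hc; exact (not_le.mp hc).le) (by positivity)
    have h2 : 1000 * ((G v).card : ℝ) ≤ m := by
      have : 1000 * (G v).card ≤ m := by rw [hAm] at hv; omega
      exact_mod_cast this
    have h3 : ((G v).card : ℝ) * (4 * (m:ℝ)^2) ≤ m / 1000 * (4 * (m:ℝ)^2) :=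
      mul_le_mul_of_nonneg_right (by linarith) (by positivity)
    refine h1.trans ?_
    have e : m / 1000 * (4 * (m:ℝ)^2) + m * ((m:ℝ)^2/1000) = 5/1000 * (m:ℝ)^3 := by ring
    linarith
  -- F1
  have F1 : ((A \ S).card : ℝ) ≤ m / 100000000000000 := by
    have h1 : ∀ v ∈ A \ S, (m:ℝ)^3 / 1000000 ≤ ∑ c, dW c v := by
      intro v hv
      have hvA := (hAm v).mp (Finset.mem_sdiff.mp hv).1
      have h2 : (m:ℝ) ≤ 1000 * ((G v).card : ℝ) := by exact_mod_cast hvA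
      have h3 : ∑ c ∈ G v, (m:ℝ)^2/1000 ≤ ∑ c ∈ G v, dW c v :=
        Finset.sum_le_sum fun c hc => (hGm v c).mp hc
      have h4 : ∑ c ∈ G v, dW c v ≤ ∑ c, dW c v :=
        Finset.sum_le_sum_of_subset_of_nonneg (Finset.subset_univ _) fun c _ _ => dW0 c v
      rw [Finset.sum_const, nsmul_eq_mul] at h3
      have h5 : (m:ℝ) / 1000 * ((m:ℝ)^2/1000) ≤ (G v).card * ((m:ℝ)^2/1000) :=
        mul_le_mul_of_nonneg_right (by linarith) (by positivity)
      have e : (m:ℝ) / 1000 * ((m:ℝ)^2/1000) = (m:ℝ)^3 / 1000000 := by ring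
      linarith
    have h2 := Finset.sum_le_sum h1
    have h3 : ∑ v ∈ A \ S, ∑ c, dW c v ≤ ∑ v ∈ Sᶜ, ∑ c, dW c v := by
      apply Finset.sum_le_sum_of_subset_of_nonneg
      · intro x hx; simp at hx ⊢; exact hx.2
      · intro x _ _; exact Finset.sum_nonneg fun c _ => dW0 c x
    rw [Finset.sum_comm (s := Sᶜ)] at h3
    rw [Finset.sum_const, nsmul_eq_mul] at h2
    have h4 : ((A \ S).card : ℝ) * (m:ℝ)^3 ≤ m / 100000000000000 * (m:ℝ)^3 := by
      rw [hm4] at hlow; linarith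
    exact le_of_mul_le_mul_right h4 hp3
  -- F2
  have F2 : ((S \ A).card : ℝ) ≤ m / 100000000000000000000 := by
    have h1 : ∀ c w, ∑ x ∈ S, ∑ y, ind (¬ R c w x y) ≤ 7 * m + dW c w := by
      intro c w
      have := missup R m hV hdeg S c w
      rw [hS, hdW'] at this
      simpa using this
    have h2 : ∑ c, ∑ w ∈ Sᶜ, ∑ x ∈ S, ∑ y, ind (¬ R c w x y)
        ≤ 2 / 100000000000000000000 * (m:ℝ)^4 := by
      refine (Finset.sum_le_sum fun c _ => Finset.sum_le_sum fun w _ => h1 c w).trans ?_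
      simp only [Finset.sum_add_distrib, Finset.sum_const, nsmul_eq_mul, Finset.card_univ, hC,
        hScc]
      have h3 : (10000000000000000000000:ℝ) * (m:ℝ)^3 ≤ m * (m:ℝ)^3 :=
        mul_le_mul_of_nonneg_right hmR hp3.le
      rw [← hm4] at h3
      have e : (m:ℝ) * (2 * m * (7 * m)) = 14 * (m:ℝ)^3 := by ring
      linarith
    have h3 : ∀ v ∈ S \ A, 3 * (m:ℝ)^3 ≤ ∑ c, ∑ w ∈ Sᶜ, ∑ y, ind (¬ R c w v y) := by
      intro v hv
      have h4 := hsum v (Finset.mem_sdiff.mp hv).2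
      have h5 : ∑ c, ∑ w ∈ Sᶜ, ∑ y ∈ Sᶜ, ind (¬ R c v w y)
          ≤ ∑ c, ∑ w ∈ Sᶜ, ∑ y, ind (¬ R c w v y) :=
        sum3_le (Finset.Subset.refl _) (Finset.Subset.refl _) (Finset.subset_univ _) _ _
          (fun c w y => ind_mono fun h h' => h (hs1 _ _ _ _ h')) (fun _ _ _ => ind_nonneg _)
      simp only [ind_not, Finset.sum_sub_distrib, Finset.sum_const, nsmul_eq_mul,
        Finset.card_univ, hC, hScc, hdW'] at h5 ⊢
      have e : (m:ℝ) * (2 * m * (2 * m * 1)) = 4 * (m:ℝ)^3 := by ring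
      linarith
    have h4 := Finset.sum_le_sum h3
    have h5 : ∑ v ∈ S \ A, ∑ c, ∑ w ∈ Sᶜ, ∑ y, ind (¬ R c w v y)
        ≤ ∑ v ∈ S, ∑ c, ∑ w ∈ Sᶜ, ∑ y, ind (¬ R c w v y) := by
      apply Finset.sum_le_sum_of_subset_of_nonneg Finset.sdiff_subset
      intro _ _ _
      exact Finset.sum_nonneg fun _ _ => Finset.sum_nonneg fun _ _ =>
        Finset.sum_nonneg fun _ _ => ind_nonneg _
    have h6 : ∑ v ∈ S, ∑ c, ∑ w ∈ Sᶜ, ∑ y, ind (¬ R c w v y)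
        = ∑ c, ∑ w ∈ Sᶜ, ∑ x ∈ S, ∑ y, ind (¬ R c w x y) := by
      rw [Finset.sum_comm]
      exact Finset.sum_congr rfl fun c _ => Finset.sum_comm
    rw [Finset.sum_const, nsmul_eq_mul] at h4
    have h7 : ((S \ A).card : ℝ) * (m:ℝ)^3 ≤ m / 100000000000000000000 * (m:ℝ)^3 := by
      rw [hm4] at h2; linarith
    exact le_of_mul_le_mul_right h7 hp3
  have hc1 : ((A ∩ S).card : ℝ) + (A \ S).card = A.card := by
    exact_mod_cast Finset.card_inter_add_card_sdiff A S
  have hc2 : ((A ∩ S).card : ℝ) + (S \ A).card = m := by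
    rw [← hS, Finset.inter_comm]
    exact_mod_cast Finset.card_inter_add_card_sdiff S A
  have nn1 : (0:ℝ) ≤ (A \ S).card := by positivity
  have nn2 : (0:ℝ) ≤ (S \ A).card := by positivity
  have hdA : ∀ c v, ∑ x ∈ Aᶜ, ∑ y ∈ Aᶜ, ind (R c v x y)
      ≤ dW c v + 6 / 100000000000000000000 * (m:ℝ)^2 := by
    intro c v
    have h1 := compl_cmp m hV A S (fun x y => ind (R c v x y) = 1)
    have e : ∀ x y, ind (ind (R c v x y) = 1) = ind (R c v x y) := fun x y =>
      ind_congr ⟨ind_eq_one, ind_true⟩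
    simp only [e, hdW'] at h1
    have h2 : 6 * (m:ℝ) * (S \ A).card ≤ 6 * m * (m / 100000000000000000000) :=
      mul_le_mul_of_nonneg_left F2 (by positivity)
    have e2 : 6 * (m:ℝ) * (m / 100000000000000000000) = 6 / 100000000000000000000 * (m:ℝ)^2 := by ring
    linarith
  refine ext_core R m hs1 hs2 hR (by omega) hC hV hdeg A ?_ ?_ ?_ ?_ ?_
  · have : (1000000000000:ℝ) * A.card ≤ 1000000000000 * m + m := by linarith
    exact_mod_cast this
  · have : (1000000000000:ℝ) * m ≤ 1000000000000 * A.card + m := by linarith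
    exact_mod_cast this
  · intro w hw
    refine (Finset.sum_le_sum fun c _ => hdA c w).trans ?_
    rw [Finset.sum_add_distrib, Finset.sum_const, nsmul_eq_mul, Finset.card_univ, hC]
    have := hsum w hw
    have e : (m:ℝ) * (6 / 100000000000000000000 * (m:ℝ)^2) = 6 / 100000000000000000000 * (m:ℝ)^3 := by
      ring
    linarith
  · intro a ha
    refine ⟨G a, (hAm a).mp ha, ?_⟩
    intro c hc
    have h0 := (hGm a c).mp hc
    have h1 := compl_cmp m hV S A (fun x y => R c a x y)
    simp only [hdW'] at h1
    have h2 : 6 * (m:ℝ) * (A \ S).card ≤ 6 * m * (m / 100000000000000) :=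
      mul_le_mul_of_nonneg_left F1 (by positivity)
    have e2 : 6 * (m:ℝ) * (m / 100000000000000) = 6 / 100000000000000 * (m:ℝ)^2 := by ring
    have hp2 : 0 < (m:ℝ)^2 := by positivity
    linarith
  · refine (Finset.sum_le_sum fun c _ => Finset.sum_le_sum fun w _ => hdA c w).trans ?_
    simp only [Finset.sum_add_distrib, Finset.sum_const, nsmul_eq_mul, Finset.card_univ, hC]
    have hcA : ((Aᶜ).card : ℝ) ≤ 3 * m := by
      have := Finset.card_le_univ Aᶜ
      rw [hV] at this
      exact_mod_cast this
    have h1 : ∀ c, ∑ w ∈ Aᶜ, dW c w ≤ ∑ w ∈ Sᶜ, dW c w + (S \ A).card * (4 * (m:ℝ)^2) := by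
      intro c
      have h2 : ∑ w ∈ S \ A, dW c w ≤ ∑ w ∈ S \ A, 4 * (m:ℝ)^2 :=
        Finset.sum_le_sum fun w _ => dW4 c w
      rw [Finset.sum_const, nsmul_eq_mul] at h2
      have h3 : ∑ w ∈ Aᶜ, dW c w ≤ ∑ w ∈ Sᶜ ∪ (S \ A), dW c w := by
        apply Finset.sum_le_sum_of_subset_of_nonneg
        · intro x hx
          simp at hx ⊢
          tauto
        · intro x _ _; exact dW0 c x
      have h4 : ∑ w ∈ Sᶜ ∪ (S \ A), dW c w = ∑ w ∈ Sᶜ, dW c w + ∑ w ∈ S \ A, dW c w := by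
        apply Finset.sum_union
        rw [Finset.disjoint_left]
        intro x hx hx'
        simp at hx hx'
        exact hx hx'.1
      linarith
    have h2 := Finset.sum_le_sum fun c (_ : c ∈ (univ : Finset C)) => h1 c
    rw [Finset.sum_add_distrib, Finset.sum_const, nsmul_eq_mul, Finset.card_univ, hC] at h2
    have h3 : (m:ℝ) * ((S \ A).card * (4 * (m:ℝ)^2))
        ≤ m * (m / 100000000000000000000 * (4 * (m:ℝ)^2)) :=
      mul_le_mul_of_nonneg_left (mul_le_mul_of_nonneg_right F2 (by positivity)) hm0.le
    have h4 : (m:ℝ) * ((Aᶜ).card * (6 / 100000000000000000000 * (m:ℝ)^2))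
        ≤ m * (3 * m * (6 / 100000000000000000000 * (m:ℝ)^2)) :=
      mul_le_mul_of_nonneg_left (mul_le_mul_of_nonneg_right hcA (by positivity)) hm0.le
    have e3 : (m:ℝ) * (m / 100000000000000000000 * (4 * (m:ℝ)^2))
      = 4 / 100000000000000000000 * (m:ℝ)^4 := by ring
    have e4 : (m:ℝ) * (3 * m * (6 / 100000000000000000000 * (m:ℝ)^2))
      = 18 / 100000000000000000000 * (m:ℝ)^4 := by ring
    linarith
end
end RM

namespace RM
open Finset

lemma sum_compl_ind {V : Type} [Fintype V] [DecidableEq V] (S : Finset V) (g : V → ℝ) :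
    ∑ x, ind (¬ x ∈ S) * g x = ∑ x ∈ Sᶜ, g x := by
  rw [← Finset.sum_subset (Finset.subset_univ Sᶜ)]
  · exact Finset.sum_congr rfl fun x hx => by rw [ind_true (by simpa using hx), one_mul]
  · intro x _ hx; rw [ind_false (by simpa using hx), zero_mul]

theorem rm : ∃ m0 : ℕ, ∀ (C V : Type) [Fintype C] [Fintype V] [DecidableEq C] [DecidableEq V]
    (R : C → V → V → V → Prop) (m : ℕ), (∀ c x y z, R c x y z → x ≠ y ∧ x ≠ z ∧ y ≠ z) →
    (∀ c x y z, R c x y z → R c y x z) → (∀ c x y z, R c x y z → R c x z y) →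
    m0 ≤ m → Fintype.card C = m → Fintype.card V = 3 * m →
    (∀ c v, 5 * (m:ℝ)^2 - 7 * m + 4 ≤ ∑ x, ∑ y, ind (R c v x y)) → Mb R univ := by
  obtain ⟨m0, h0⟩ := nonext (1 / 100000000000000000000) (by norm_num) (by norm_num)
  refine ⟨max m0 10000000000000000000000, ?_⟩
  intro C V _ _ _ _ R m hR hs1 hs2 hm hC hV hdeg
  by_cases hext : ∀ S : Finset V, S.card = m → (1 / 100000000000000000000) * (m:ℝ)^4 ≤
      ∑ c, ∑ x, ∑ y, ∑ z, ind (R c x y z) * (ind (¬ x ∈ S) * ind (¬ y ∈ S) * ind (¬ z ∈ S))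
  · exact h0 C V R m hR ((le_max_left _ _).trans hm) hC hV
      (fun c v => by have := hdeg c v; linarith) hext
  · push Not at hext
    obtain ⟨S, hS, hlow⟩ := hext
    refine ext_case R m hs1 hs2 hR ((le_max_right _ _).trans hm) hC hV hdeg S hS
      (le_trans (le_of_eq ?_) hlow.le)
    refine Finset.sum_congr rfl fun c _ => ?_
    rw [← sum_compl_ind]
    refine Finset.sum_congr rfl fun x _ => ?_
    rw [← sum_compl_ind, Finset.mul_sum]
    refine Finset.sum_congr rfl fun y _ => ?_
    rw [← sum_compl_ind, Finset.mul_sum, Finset.mul_sum]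
    refine Finset.sum_congr rfl fun z _ => ?_
    ring

lemma Mb.extract {C V : Type} [DecidableEq C] [DecidableEq V] {R : C → V → V → V → Prop}
    {P : Finset (C ⊕ V)} (h : Mb R P) : ∃ g : C → Finset V,
    (∀ c, Sum.inl c ∈ P → ∃ x y z, R c x y z ∧ g c = {x, y, z}) ∧
    (∀ c, Sum.inl c ∈ P → ∀ v ∈ g c, Sum.inr v ∈ P) ∧
    ∀ c c', Sum.inl c ∈ P → Sum.inl c' ∈ P → c ≠ c' → Disjoint (g c) (g c') := by
  induction h with
  | nil => exact ⟨fun _ => ∅, by simp, by simp, by simp⟩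
  | cons c x y z P h hc hx hy hz hP ih =>
    obtain ⟨g, g1, g2, g3⟩ := ih
    have memC : ∀ d, Sum.inl d ∈ ({Sum.inl c, Sum.inr x, Sum.inr y, Sum.inr z} : Finset (C ⊕ V)) ∪ P
        → d ≠ c → Sum.inl d ∈ P := by
      intro d hd hdc
      simpa [hdc] using hd
    have hdis : ∀ d, Sum.inl d ∈ P → Disjoint ({x, y, z} : Finset V) (g d) := by
      intro d hd
      rw [Finset.disjoint_left]
      intro v hv hv'
      have := g2 d hd v hv'
      simp only [mem_insert, mem_singleton] at hv
      rcases hv with rfl | rfl | rfl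
      · exact hx this
      · exact hy this
      · exact hz this
    refine ⟨Function.update g c {x, y, z}, ?_, ?_, ?_⟩
    · intro d hd
      by_cases hdc : d = c
      · subst hdc
        exact ⟨x, y, z, h, by simp⟩
      · rw [Function.update_of_ne hdc]; exact g1 d (memC d hd hdc)
    · intro d hd v hv
      by_cases hdc : d = c
      · subst hdc
        rw [Function.update_self] at hv
        simp only [mem_insert, mem_singleton] at hv
        rcases hv with rfl | rfl | rfl <;> simp
      · rw [Function.update_of_ne hdc] at hv
        exact Finset.mem_union_right _ (g2 d (memC d hd hdc) v hv)
    · intro d d' hd hd' hne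
      by_cases hdc : d = c
      · subst hdc
        rw [Function.update_self, Function.update_of_ne (Ne.symm hne)]
        exact hdis d' (memC d' hd' (Ne.symm hne))
      · rw [Function.update_of_ne hdc]
        by_cases hdc' : d' = c
        · subst hdc'
          rw [Function.update_self]
          exact (hdis d (memC d hd hdc)).symm
        · rw [Function.update_of_ne hdc']
          exact g3 d d' (memC d hd hdc) (memC d' hd' hdc') hne

lemma deg_pairs {V : Type} [Fintype V] [DecidableEq V] (F : Finset (Finset V))
    (hF : ∀ e ∈ F, e.card = 3) (v : V) :
    2 * ((F.filter fun e => v ∈ e).card : ℝ) ≤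
      ∑ x, ∑ y, ind (v ≠ x ∧ v ≠ y ∧ x ≠ y ∧ ({v, x, y} : Finset V) ∈ F) := by
  classical
  rw [← Fintype.sum_prod_type' (fun x y => ind (v ≠ x ∧ v ≠ y ∧ x ≠ y ∧ ({v, x, y} : Finset V) ∈ F)),
    sum_ind_card univ (fun p : V × V => v ≠ p.1 ∧ v ≠ p.2 ∧ p.1 ≠ p.2 ∧ ({v, p.1, p.2} : Finset V) ∈ F)]
  have hn : (F.filter fun e => v ∈ e).card * 2 ≤ (univ.filter (fun p : V × V => v ≠ p.1 ∧ v ≠ p.2 ∧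
      p.1 ≠ p.2 ∧ ({v, p.1, p.2} : Finset V) ∈ F)).card := by
    rw [Finset.card_eq_sum_card_fiberwise (f := fun p : V × V => ({v, p.1, p.2} : Finset V))
      (t := F.filter fun e => v ∈ e)]
    · rw [← smul_eq_mul, ← Finset.sum_const]
      refine Finset.sum_le_sum fun e he => ?_
      rw [Finset.mem_filter] at he
      have hc : (e.erase v).card = 2 := by
        rw [Finset.card_erase_of_mem he.2, hF e he.1]
      obtain ⟨x, y, hxy, hexy⟩ := Finset.card_eq_two.mp hc
      have hev : e = {v, x, y} := by
        rw [← hexy, Finset.insert_erase he.2]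
      have hx : v ≠ x := by
        rintro rfl
        have : v ∈ e.erase v := by rw [hexy]; simp
        simp at this
      have hy : v ≠ y := by
        rintro rfl
        have : v ∈ e.erase v := by rw [hexy]; simp
        simp at this
      have hev' : ({v, y, x} : Finset V) = {v, x, y} := by
        rw [Finset.pair_comm]
      have hcard2 : ({(x, y), (y, x)} : Finset (V × V)).card = 2 := by
        apply Finset.card_pair
        intro h
        exact hxy (Prod.mk.inj h).1
      rw [← hcard2]
      apply Finset.card_le_card
      intro p hp
      simp only [mem_insert, mem_singleton] at hp
      rw [Finset.mem_filter, Finset.mem_filter]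
      rcases hp with rfl | rfl
      · exact ⟨⟨mem_univ _, hx, hy, hxy, hev ▸ he.1⟩, hev.symm⟩
      · exact ⟨⟨mem_univ _, hy, hx, hxy.symm, by rw [hev', ← hev]; exact he.1⟩, by
          simp only []; rw [hev', ← hev]⟩
    · intro p hp
      simp only [coe_filter, mem_univ, true_and, Set.mem_setOf_eq] at hp ⊢
      exact ⟨hp.2.2.2, by simp⟩
  have : ((F.filter fun e => v ∈ e).card : ℝ) * 2 ≤ ((univ.filter (fun p : V × V => v ≠ p.1 ∧ v ≠ p.2 ∧
      p.1 ≠ p.2 ∧ ({v, p.1, p.2} : Finset V) ∈ F)).card : ℝ) := by exact_mod_cast hn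
  linarith
end RM

theorem rainbow_matching_three_uniform :
    ∃ N : ℕ, ∀ n : ℕ, 3 ∣ n → N ≤ n →
      ∀ F : Fin (n / 3) → Finset (Finset (Fin n)),
        (∀ i, ∀ e ∈ F i, e.card = 3) →
        (∀ i, ∀ v : Fin n,
          Nat.choose (n - 1) 2 - Nat.choose (2 * n / 3) 2 <
            ((F i).filter (fun e => v ∈ e)).card) →
        ∃ g : Fin (n / 3) → Finset (Fin n),
          (∀ i, g i ∈ F i) ∧ ∀ i j, i ≠ j → Disjoint (g i) (g j) := by
  obtain ⟨m0, h0⟩ := RM.rm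
  refine ⟨3 * (m0 + 1), ?_⟩
  rintro n ⟨m, rfl⟩ hN F hF hdeg
  have hmb := h0 (Fin (3 * m / 3)) (Fin (3 * m))
    (fun c x y z => x ≠ y ∧ x ≠ z ∧ y ≠ z ∧ ({x, y, z} : Finset (Fin (3 * m))) ∈ F c) m
    (fun c x y z h => ⟨h.1, h.2.1, h.2.2.1⟩)
    (fun c x y z h => ⟨h.1.symm, h.2.2.1, h.2.1, by
      rw [Finset.insert_comm]; exact h.2.2.2⟩)
    (fun c x y z h => ⟨h.2.1, h.1, h.2.2.1.symm, by
      rw [Finset.pair_comm]; exact h.2.2.2⟩)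
    (by omega) (by rw [Fintype.card_fin]; omega) (by rw [Fintype.card_fin])
    (by
      intro c v
      refine le_trans ?_ (RM.deg_pairs (F c) (hF c) v)
      have h1 := hdeg c v
      have e : 2 * (3 * m) / 3 = 2 * m := by omega
      rw [e] at h1
      have h2 : (3 * m - 1).choose 2 + 1 ≤
        ((F c).filter (fun e => v ∈ e)).card + (2 * m).choose 2 := by omega
      have h3 : (((3 * m - 1).choose 2 : ℕ) : ℝ) + 1 ≤
        (((F c).filter (fun e => v ∈ e)).card : ℝ) + (((2 * m).choose 2 : ℕ) : ℝ) := by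
        exact_mod_cast h2
      rw [Nat.cast_choose_two, Nat.cast_choose_two, Nat.cast_sub (by omega)] at h3
      push_cast at h3
      linarith)
  obtain ⟨g, g1, -, g3⟩ := RM.Mb.extract hmb
  refine ⟨g, ?_, ?_⟩
  · intro i
    obtain ⟨x, y, z, h, e⟩ := g1 i (Finset.mem_univ _)
    rw [e]; exact h.2.2.2
  · intro i j hij
    exact g3 i j (Finset.mem_univ _) (Finset.mem_univ _) hij
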